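/- Under the standing assumptions (α ∈ (1/3,1/2), T > 0, α-Hölder rough path 𝐗, monotone family of interpolation spaces, analytic C₀-semigroup S on the scale, F satisfying (F), G satisfying (G)), for every y₀ ∈ B_γ with |y₀|_{B_γ} ≤ ρ there exists T* = T*(α, γ, ρ, X, F, G) ∈ (0,T] such that there exists a unique controlled rough path (y, y') ∈ D^{2α}_{X,γ}([0,T*]) satisfying y' = G(y) and, for all t ∈ [0,T*], y_t = S(t)y₀ + ∫₀ᵗ S(t−s)F(y_s) ds + ∫₀ᵗ S(t−s)G(y_s) d𝐗_s, where the last term is the rough convolution, i.e. the limit of the compensated Riemann sums Σ_{[u,v]∈π} S(t−u)[G(y_u) X_{u,v} + DG(y_u)G(y_u) X⁽²⁾_{u,v}] over partitions π of [0,t] with vanishing mesh. -/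

import Mathlib

open Set

/-- A monotone family of interpolation spaces: a scale `(B_θ)_{θ ∈ ℝ}` of separable Banach
spaces realised inside a common ambient real vector space `E`; `Mem θ x` means `x ∈ B_θ`,
`N θ x` denotes the norm `|x|_θ`.  For `β₁ ≤ β₂` the space `B_{β₂}` is contained in `B_{β₁}`
with dense and continuous embedding, and the interpolation inequality holds. -/
structure BanachScale where
  E : Type
  [inst_add : AddCommGroup E]
  [inst_mod : Module ℝ E]
  Mem : ℝ → E → Prop
  N : ℝ → E → ℝ
  mem_zero : ∀ θ : ℝ, Mem θ 0
  mem_add : ∀ (θ : ℝ) (x y : E), Mem θ x → Mem θ y → Mem θ (x + y)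
  mem_neg : ∀ (θ : ℝ) (x : E), Mem θ x → Mem θ (-x)
  mem_smul : ∀ (θ c : ℝ) (x : E), Mem θ x → Mem θ (c • x)
  N_nonneg : ∀ (θ : ℝ) (x : E), 0 ≤ N θ x
  N_zero : ∀ θ : ℝ, N θ 0 = 0
  N_eq_zero : ∀ (θ : ℝ) (x : E), Mem θ x → N θ x = 0 → x = 0
  N_add : ∀ (θ : ℝ) (x y : E), Mem θ x → Mem θ y → N θ (x + y) ≤ N θ x + N θ y
  N_smul : ∀ (θ c : ℝ) (x : E), N θ (c • x) = |c| * N θ x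
  mem_mono : ∀ ⦃β₁ β₂ : ℝ⦄, β₁ ≤ β₂ → ∀ x : E, Mem β₂ x → Mem β₁ x
  embed_bound : ∀ ⦃β₁ β₂ : ℝ⦄, β₁ ≤ β₂ → ∃ C > (0:ℝ), ∀ x : E, Mem β₂ x → N β₁ x ≤ C * N β₂ x
  embed_dense : ∀ ⦃β₁ β₂ : ℝ⦄, β₁ ≤ β₂ → ∀ x : E, Mem β₁ x → ∀ ε > (0:ℝ),
    ∃ y : E, Mem β₂ y ∧ N β₁ (x - y) < ε
  complete : ∀ (θ : ℝ) (u : ℕ → E), (∀ n, Mem θ (u n)) →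
    (∀ ε > (0:ℝ), ∃ M : ℕ, ∀ m ≥ M, ∀ n ≥ M, N θ (u m - u n) < ε) →
    ∃ x : E, Mem θ x ∧ ∀ ε > (0:ℝ), ∃ M : ℕ, ∀ n ≥ M, N θ (u n - x) < ε
  separable : ∀ θ : ℝ, ∃ D : Set E, D.Countable ∧ (∀ x ∈ D, Mem θ x) ∧
    ∀ x : E, Mem θ x → ∀ ε > (0:ℝ), ∃ y ∈ D, N θ (x - y) < ε
  interp : ∀ ⦃θ β γ : ℝ⦄, θ ≤ β → β ≤ γ → ∃ C > (0:ℝ), ∀ x : E, Mem γ x →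
    N β x ^ (γ - θ) ≤ C * (N θ x ^ (γ - β) * N γ x ^ (β - θ))

attribute [instance] BanachScale.inst_add BanachScale.inst_mod

/-- An analytic `C₀`-semigroup `(S(t))_{t ≥ 0}` acting on a scale of Banach spaces,
together with the standard parabolic bounds
`|(S(t) - Id)x|_η ≲ t^σ |x|_{η+σ}` and `|S(t)x|_{η+σ} ≲ t^{-σ} |x|_η` for `σ ∈ [0,1]`,
with constants uniform on compact time intervals. -/
structure ScaleSemigroup (𝓑 : BanachScale) where
  S : ℝ → 𝓑.E →ₗ[ℝ] 𝓑.E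
  S_id : ∀ x : 𝓑.E, S 0 x = x
  S_comp : ∀ s t : ℝ, 0 ≤ s → 0 ≤ t → ∀ x : 𝓑.E, S (s + t) x = S s (S t x)
  S_mem : ∀ (t θ : ℝ) (x : 𝓑.E), 0 ≤ t → 𝓑.Mem θ x → 𝓑.Mem θ (S t x)
  S_bounded : ∀ θ Tm : ℝ, 0 < Tm → ∃ C > (0:ℝ), ∀ (t : ℝ) (x : 𝓑.E), 0 ≤ t → t ≤ Tm →
    𝓑.Mem θ x → 𝓑.N θ (S t x) ≤ C * 𝓑.N θ x
  S_strong_cont : ∀ (θ : ℝ) (x : 𝓑.E), 𝓑.Mem θ x → ∀ ε > (0:ℝ), ∃ δ > (0:ℝ),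
    ∀ t : ℝ, 0 < t → t < δ → 𝓑.N θ (S t x - x) < ε
  S_smoothing : ∀ η σ Tm : ℝ, 0 ≤ σ → σ ≤ 1 → 0 < Tm → ∃ C > (0:ℝ),
    ∀ (t : ℝ) (x : 𝓑.E), 0 < t → t ≤ Tm → 𝓑.Mem η x →
      𝓑.Mem (η + σ) (S t x) ∧ 𝓑.N (η + σ) (S t x) ≤ C * t ^ (-σ) * 𝓑.N η x
  S_holdId : ∀ η σ Tm : ℝ, 0 ≤ σ → σ ≤ 1 → 0 < Tm → ∃ C > (0:ℝ),
    ∀ (t : ℝ) (x : 𝓑.E), 0 < t → t ≤ Tm → 𝓑.Mem (η + σ) x →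
      𝓑.N η (S t x - x) ≤ C * t ^ σ * 𝓑.N (η + σ) x

/-- A (one-dimensional) `α`-Hölder rough path `𝐗 = (X, X⁽²⁾)` on `[0,T]`:
`X ∈ C^α`, `X₀ = 0`, `X⁽²⁾ ∈ C^{2α}` on the simplex, satisfying Chen's relation. -/
structure RoughPath (α T : ℝ) where
  X : ℝ → ℝ
  X2 : ℝ → ℝ → ℝ
  X_zero : X 0 = 0
  holderX : ∃ C : ℝ, ∀ s t : ℝ, 0 ≤ s → s ≤ t → t ≤ T → |X t - X s| ≤ C * (t - s) ^ α
  holderX2 : ∃ C : ℝ, ∀ s t : ℝ, 0 ≤ s → s ≤ t → t ≤ T → |X2 s t| ≤ C * (t - s) ^ (2 * α)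
  chen : ∀ s u t : ℝ, 0 ≤ s → s ≤ u → u ≤ t → t ≤ T →
    X2 s t - X2 s u - X2 u t = (X u - X s) * (X t - X u)

/-- The supremum norm `‖f‖_{∞, B_θ}` over `[0,T]`. -/
noncomputable def scaleSupNorm (𝓑 : BanachScale) (θ T : ℝ) (f : ℝ → 𝓑.E) : ℝ :=
  sSup {r : ℝ | ∃ t : ℝ, 0 ≤ t ∧ t ≤ T ∧ r = 𝓑.N θ (f t)}

/-- The `η`-Hölder seminorm (in `B_θ`) of a two-parameter function on `[0,T]`. -/
noncomputable def scaleHolderNorm2 (𝓑 : BanachScale) (θ η T : ℝ) (F : ℝ → ℝ → 𝓑.E) : ℝ :=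
  sSup {r : ℝ | ∃ s t : ℝ, 0 ≤ s ∧ s < t ∧ t ≤ T ∧ r = 𝓑.N θ (F s t) / (t - s) ^ η}

/-- The `η`-Hölder seminorm `‖f‖_{η, B_θ}` over `[0,T]`. -/
noncomputable def scaleHolderNorm (𝓑 : BanachScale) (θ η T : ℝ) (f : ℝ → 𝓑.E) : ℝ :=
  scaleHolderNorm2 𝓑 θ η T fun s t => f t - f s

/-- The `η`-Hölder seminorm of a real-valued path on `[0,T]`. -/
noncomputable def realHolderNorm (η T : ℝ) (X : ℝ → ℝ) : ℝ :=
  sSup {r : ℝ | ∃ s t : ℝ, 0 ≤ s ∧ s < t ∧ t ≤ T ∧ r = |X t - X s| / (t - s) ^ η}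

/-- `f : [0,T] → B_θ` is `η`-Hölder continuous. -/
def IsHolderOn (𝓑 : BanachScale) (θ η T : ℝ) (f : ℝ → 𝓑.E) : Prop :=
  ∃ C : ℝ, ∀ s t : ℝ, 0 ≤ s → s ≤ t → t ≤ T → 𝓑.N θ (f t - f s) ≤ C * (t - s) ^ η

/-- The remainder `R^y_{s,t} = y_t - y_s - y'_s X_{s,t}` of a controlled rough path. -/
def gubRemainder (𝓑 : BanachScale) (X : ℝ → ℝ) (y y' : ℝ → 𝓑.E) (s t : ℝ) : 𝓑.E :=
  y t - y s - (X t - X s) • y' s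

/-- `(y, y')` is a controlled rough path in `D^{2α}_{X,γ}([0,T])`:
`y ∈ C([0,T]; B_γ)`, `y' ∈ C([0,T]; B_{γ-α}) ∩ C^α([0,T]; B_{γ-2α})` and the remainder
`R^y ∈ C^α([0,T]; B_{γ-α}) ∩ C^{2α}([0,T]; B_{γ-2α})`. -/
structure IsControlledPath (𝓑 : BanachScale) (α γ T : ℝ) (X : ℝ → ℝ)
    (y y' : ℝ → 𝓑.E) : Prop where
  mem_y : ∀ t : ℝ, 0 ≤ t → t ≤ T → 𝓑.Mem γ (y t)
  mem_y' : ∀ t : ℝ, 0 ≤ t → t ≤ T → 𝓑.Mem (γ - α) (y' t)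
  cont_y : ∀ t : ℝ, 0 ≤ t → t ≤ T → ∀ ε > (0:ℝ), ∃ δ > (0:ℝ), ∀ s : ℝ, 0 ≤ s → s ≤ T →
    |s - t| < δ → 𝓑.N γ (y s - y t) < ε
  cont_y' : ∀ t : ℝ, 0 ≤ t → t ≤ T → ∀ ε > (0:ℝ), ∃ δ > (0:ℝ), ∀ s : ℝ, 0 ≤ s → s ≤ T →
    |s - t| < δ → 𝓑.N (γ - α) (y' s - y' t) < ε
  holder_y' : ∃ C : ℝ, ∀ s t : ℝ, 0 ≤ s → s ≤ t → t ≤ T →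
    𝓑.N (γ - 2 * α) (y' t - y' s) ≤ C * (t - s) ^ α
  rem_alpha : ∃ C : ℝ, ∀ s t : ℝ, 0 ≤ s → s ≤ t → t ≤ T →
    𝓑.N (γ - α) (gubRemainder 𝓑 X y y' s t) ≤ C * (t - s) ^ α
  rem_two_alpha : ∃ C : ℝ, ∀ s t : ℝ, 0 ≤ s → s ≤ t → t ≤ T →
    𝓑.N (γ - 2 * α) (gubRemainder 𝓑 X y y' s t) ≤ C * (t - s) ^ (2 * α)

/-- The norm `‖(y,y')‖_{X,2α,γ}` on `D^{2α}_{X,γ}([0,T])`. -/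
noncomputable def crpNorm (𝓑 : BanachScale) (α γ T : ℝ) (X : ℝ → ℝ)
    (y y' : ℝ → 𝓑.E) : ℝ :=
  scaleSupNorm 𝓑 γ T y + scaleSupNorm 𝓑 (γ - α) T y'
    + scaleHolderNorm 𝓑 (γ - 2 * α) α T y'
    + scaleHolderNorm2 𝓑 (γ - α) α T (gubRemainder 𝓑 X y y')
    + scaleHolderNorm2 𝓑 (γ - 2 * α) (2 * α) T (gubRemainder 𝓑 X y y')

/-- A partition `a = t_0 < t_1 < ⋯ < t_n = b` of the interval `[a,b]`. -/
structure RPartition (a b : ℝ) where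
  n : ℕ
  t : ℕ → ℝ
  n_pos : 0 < n
  strict : ∀ i : ℕ, i < n → t i < t (i + 1)
  first : t 0 = a
  last : t n = b

/-- The mesh `|π|` of a partition. -/
noncomputable def RPartition.mesh {a b : ℝ} (π : RPartition a b) : ℝ :=
  sSup {r : ℝ | ∃ i : ℕ, i < π.n ∧ r = π.t (i + 1) - π.t i}

/-- The compensated Riemann sum `Σ_{[u,v] ∈ π} S(b - u)[y_u X_{u,v} + y'_u X⁽²⁾_{u,v}]`. -/
noncomputable def convRiemannSum (𝓑 : BanachScale) (Sg : ScaleSemigroup 𝓑)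
    (X : ℝ → ℝ) (X2 : ℝ → ℝ → ℝ) (y y' : ℝ → 𝓑.E) {a b : ℝ} (π : RPartition a b) : 𝓑.E :=
  ∑ i ∈ Finset.range π.n,
    Sg.S (b - π.t i)
      ((X (π.t (i + 1)) - X (π.t i)) • y (π.t i) + X2 (π.t i) (π.t (i + 1)) • y' (π.t i))

/-- `I` is the rough convolution `∫_a^b S(b-r) y_r d𝐗_r`, i.e. the limit in `B_θ` of the
compensated Riemann sums over partitions of `[a,b]` with vanishing mesh. -/
def IsRoughConvolution (𝓑 : BanachScale) (Sg : ScaleSemigroup 𝓑) (X : ℝ → ℝ)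
    (X2 : ℝ → ℝ → ℝ) (y y' : ℝ → 𝓑.E) (θ a b : ℝ) (I : 𝓑.E) : Prop :=
  𝓑.Mem θ I ∧ ∀ ε > (0:ℝ), ∃ δ > (0:ℝ), ∀ π : RPartition a b, π.mesh < δ →
    𝓑.N θ (convRiemannSum 𝓑 Sg X X2 y y' π - I) ≤ ε

/-- Left Riemann sum of a `B`-valued function. -/
noncomputable def intRiemannSum (𝓑 : BanachScale) (f : ℝ → 𝓑.E) {a b : ℝ}
    (π : RPartition a b) : 𝓑.E :=
  ∑ i ∈ Finset.range π.n, (π.t (i + 1) - π.t i) • f (π.t i)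

/-- `I = ∫_a^b f(s) ds` as a `B_θ`-valued Riemann integral. -/
def IsRiemannIntegral (𝓑 : BanachScale) (θ : ℝ) (f : ℝ → 𝓑.E) (a b : ℝ) (I : 𝓑.E) : Prop :=
  𝓑.Mem θ I ∧ ∀ ε > (0:ℝ), ∃ δ > (0:ℝ), ∀ π : RPartition a b, π.mesh < δ →
    𝓑.N θ (intRiemannSum 𝓑 f π - I) ≤ ε

/-- Assumption (F): the drift `F : B_γ → B_{γ-δ}` is locally Lipschitz continuous and
satisfies a linear growth condition. -/
structure AssumptionF (𝓑 : BanachScale) (γ δ : ℝ) (F : 𝓑.E → 𝓑.E) : Prop where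
  maps : ∀ x : 𝓑.E, 𝓑.Mem γ x → 𝓑.Mem (γ - δ) (F x)
  locLip : ∀ R > (0:ℝ), ∃ L : ℝ, ∀ x y : 𝓑.E, 𝓑.Mem γ x → 𝓑.Mem γ y →
    𝓑.N γ x ≤ R → 𝓑.N γ y ≤ R → 𝓑.N (γ - δ) (F x - F y) ≤ L * 𝓑.N γ (x - y)
  linGrowth : ∃ C : ℝ, ∀ x : 𝓑.E, 𝓑.Mem γ x → 𝓑.N (γ - δ) (F x) ≤ C * (1 + 𝓑.N γ x)

/-- Assumption (G): for `θ ∈ {0, α, 2α}` the diffusion coefficient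
`G : B_{γ-θ} → B_{γ-θ-σ}` is three times continuously (Fréchet) differentiable with bounded
derivatives `DG`, `D²G`, `D³G`, and the derivative of `x ↦ DG(x)G(x) : B_{γ-α} → B_{γ-2α-σ}`
is bounded. -/
structure AssumptionG (𝓑 : BanachScale) (α σ γ : ℝ) (G : 𝓑.E → 𝓑.E)
    (DG : 𝓑.E → 𝓑.E →ₗ[ℝ] 𝓑.E)
    (D2G : 𝓑.E → 𝓑.E →ₗ[ℝ] 𝓑.E →ₗ[ℝ] 𝓑.E)
    (D3G : 𝓑.E → 𝓑.E →ₗ[ℝ] 𝓑.E →ₗ[ℝ] 𝓑.E →ₗ[ℝ] 𝓑.E) : Prop where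
  maps : ∀ θ ∈ ({0, α, 2 * α} : Set ℝ), ∀ x : 𝓑.E, 𝓑.Mem (γ - θ) x → 𝓑.Mem (γ - θ - σ) (G x)
  DG_maps : ∀ θ ∈ ({0, α, 2 * α} : Set ℝ), ∀ x h : 𝓑.E, 𝓑.Mem (γ - θ) x → 𝓑.Mem (γ - θ) h →
    𝓑.Mem (γ - θ - σ) (DG x h)
  DG_bound : ∀ θ ∈ ({0, α, 2 * α} : Set ℝ), ∃ C : ℝ, ∀ x h : 𝓑.E, 𝓑.Mem (γ - θ) x →
    𝓑.Mem (γ - θ) h → 𝓑.N (γ - θ - σ) (DG x h) ≤ C * 𝓑.N (γ - θ) h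
  DG_isDeriv : ∀ θ ∈ ({0, α, 2 * α} : Set ℝ), ∀ x : 𝓑.E, 𝓑.Mem (γ - θ) x → ∀ ε > (0:ℝ),
    ∃ δ > (0:ℝ), ∀ h : 𝓑.E, 𝓑.Mem (γ - θ) h → 𝓑.N (γ - θ) h < δ →
      𝓑.N (γ - θ - σ) (G (x + h) - G x - DG x h) ≤ ε * 𝓑.N (γ - θ) h
  D2G_maps : ∀ θ ∈ ({0, α, 2 * α} : Set ℝ), ∀ x h k : 𝓑.E, 𝓑.Mem (γ - θ) x →
    𝓑.Mem (γ - θ) h → 𝓑.Mem (γ - θ) k → 𝓑.Mem (γ - θ - σ) (D2G x h k)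
  D2G_bound : ∀ θ ∈ ({0, α, 2 * α} : Set ℝ), ∃ C : ℝ, ∀ x h k : 𝓑.E, 𝓑.Mem (γ - θ) x →
    𝓑.Mem (γ - θ) h → 𝓑.Mem (γ - θ) k →
    𝓑.N (γ - θ - σ) (D2G x h k) ≤ C * (𝓑.N (γ - θ) h * 𝓑.N (γ - θ) k)
  D2G_isDeriv : ∀ θ ∈ ({0, α, 2 * α} : Set ℝ), ∀ x : 𝓑.E, 𝓑.Mem (γ - θ) x → ∀ ε > (0:ℝ),
    ∃ δ > (0:ℝ), ∀ h : 𝓑.E, 𝓑.Mem (γ - θ) h → 𝓑.N (γ - θ) h < δ → ∀ k : 𝓑.E,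
      𝓑.Mem (γ - θ) k →
      𝓑.N (γ - θ - σ) (DG (x + h) k - DG x k - D2G x h k) ≤ ε * (𝓑.N (γ - θ) h * 𝓑.N (γ - θ) k)
  D3G_maps : ∀ θ ∈ ({0, α, 2 * α} : Set ℝ), ∀ x h k l : 𝓑.E, 𝓑.Mem (γ - θ) x →
    𝓑.Mem (γ - θ) h → 𝓑.Mem (γ - θ) k → 𝓑.Mem (γ - θ) l → 𝓑.Mem (γ - θ - σ) (D3G x h k l)
  D3G_bound : ∀ θ ∈ ({0, α, 2 * α} : Set ℝ), ∃ C : ℝ, ∀ x h k l : 𝓑.E, 𝓑.Mem (γ - θ) x →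
    𝓑.Mem (γ - θ) h → 𝓑.Mem (γ - θ) k → 𝓑.Mem (γ - θ) l →
    𝓑.N (γ - θ - σ) (D3G x h k l) ≤ C * (𝓑.N (γ - θ) h * (𝓑.N (γ - θ) k * 𝓑.N (γ - θ) l))
  D3G_isDeriv : ∀ θ ∈ ({0, α, 2 * α} : Set ℝ), ∀ x : 𝓑.E, 𝓑.Mem (γ - θ) x → ∀ ε > (0:ℝ),
    ∃ δ > (0:ℝ), ∀ h : 𝓑.E, 𝓑.Mem (γ - θ) h → 𝓑.N (γ - θ) h < δ → ∀ k l : 𝓑.E,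
      𝓑.Mem (γ - θ) k → 𝓑.Mem (γ - θ) l →
      𝓑.N (γ - θ - σ) (D2G (x + h) k l - D2G x k l - D3G x h k l)
        ≤ ε * (𝓑.N (γ - θ) h * (𝓑.N (γ - θ) k * 𝓑.N (γ - θ) l))
  D3G_cont : ∀ θ ∈ ({0, α, 2 * α} : Set ℝ), ∀ x : 𝓑.E, 𝓑.Mem (γ - θ) x → ∀ ε > (0:ℝ),
    ∃ δ > (0:ℝ), ∀ x' : 𝓑.E, 𝓑.Mem (γ - θ) x' → 𝓑.N (γ - θ) (x' - x) < δ →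
      ∀ h k l : 𝓑.E, 𝓑.Mem (γ - θ) h → 𝓑.Mem (γ - θ) k → 𝓑.Mem (γ - θ) l →
      𝓑.N (γ - θ - σ) (D3G x' h k l - D3G x h k l)
        ≤ ε * (𝓑.N (γ - θ) h * (𝓑.N (γ - θ) k * 𝓑.N (γ - θ) l))
  DGG_deriv_bounded : ∃ (L : 𝓑.E → 𝓑.E →ₗ[ℝ] 𝓑.E) (C : ℝ),
    (∀ x h : 𝓑.E, 𝓑.Mem (γ - α) x → 𝓑.Mem (γ - α) h →
      𝓑.Mem (γ - 2 * α - σ) (L x h) ∧ 𝓑.N (γ - 2 * α - σ) (L x h) ≤ C * 𝓑.N (γ - α) h) ∧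
    ∀ x : 𝓑.E, 𝓑.Mem (γ - α) x → ∀ ε > (0:ℝ), ∃ δ > (0:ℝ), ∀ h : 𝓑.E, 𝓑.Mem (γ - α) h →
      𝓑.N (γ - α) h < δ →
      𝓑.N (γ - 2 * α - σ) (DG (x + h) (G (x + h)) - DG x (G x) - L x h) ≤ ε * 𝓑.N (γ - α) h

/-- `y` is a (mild) solution on `[0,T']` of the rough evolution equation
`dy = (Ay + F(y))dt + G(y)d𝐗`, `y(0) = y₀`: the pair `(y, G(y))` is a controlled rough
path in `D^{2α}_{X,γ}([0,T'])` and the mild formulation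
`y_t = S(t)y₀ + ∫₀ᵗ S(t-s)F(y_s)ds + ∫₀ᵗ S(t-s)G(y_s)d𝐗_s` holds, the rough convolution
being the limit of the compensated Riemann sums
`Σ S(t-u)[G(y_u)X_{u,v} + DG(y_u)G(y_u)X⁽²⁾_{u,v}]`. -/
structure IsSolution (𝓑 : BanachScale) (Sg : ScaleSemigroup 𝓑) (α γ : ℝ)
    (X : ℝ → ℝ) (X2 : ℝ → ℝ → ℝ) (F G : 𝓑.E → 𝓑.E) (DG : 𝓑.E → 𝓑.E →ₗ[ℝ] 𝓑.E)
    (y₀ : 𝓑.E) (T' : ℝ) (y : ℝ → 𝓑.E) : Prop where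
  controlled : IsControlledPath 𝓑 α γ T' X y fun t => G (y t)
  init : y 0 = y₀
  mild : ∀ t : ℝ, 0 < t → t ≤ T' → ∃ D Z : 𝓑.E,
    IsRiemannIntegral 𝓑 γ (fun s => Sg.S (t - s) (F (y s))) 0 t D ∧
    IsRoughConvolution 𝓑 Sg X X2 (fun s => G (y s)) (fun s => DG (y s) (G (y s)))
      (γ - 2 * α) 0 t Z ∧
    y t = Sg.S t y₀ + D + Z

/-- The Borel σ-algebra of `B_θ`, generated by the `|·|_θ`-balls of `B_θ`,
as a σ-algebra on the ambient space. -/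
def scaleBorel (𝓑 : BanachScale) (θ : ℝ) : MeasurableSpace 𝓑.E :=
  MeasurableSpace.generateFrom
    {s : Set 𝓑.E | ∃ (c : 𝓑.E) (r : ℝ), s = {x | 𝓑.Mem θ x ∧ 𝓑.N θ (x - c) < r}}


/-- Membership in `B_θ` together with a norm bound. -/
def Bd {𝓑 : BanachScale} (θ : ℝ) (x : 𝓑.E) (r : ℝ) : Prop := 𝓑.Mem θ x ∧ 𝓑.N θ x ≤ r

namespace Bd
variable {𝓑 : BanachScale} {θ : ℝ} {x y : 𝓑.E} {r s : ℝ}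

lemma nonneg (h : Bd θ x r) : 0 ≤ r := (𝓑.N_nonneg θ x).trans h.2

lemma zero (hr : 0 ≤ r) : Bd θ (0 : 𝓑.E) r := ⟨𝓑.mem_zero θ, by rw [𝓑.N_zero]; exact hr⟩

lemma mono (h : Bd θ x r) (hrs : r ≤ s) : Bd θ x s := ⟨h.1, h.2.trans hrs⟩

lemma congr (h : Bd θ x r) (hxy : y = x) (hrs : r ≤ s) : Bd θ y s := by
  subst hxy; exact h.mono hrs

lemma add (h : Bd θ x r) (h' : Bd θ y s) : Bd θ (x + y) (r + s) :=
  ⟨𝓑.mem_add θ x y h.1 h'.1, (𝓑.N_add θ x y h.1 h'.1).trans (add_le_add h.2 h'.2)⟩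

lemma neg (h : Bd θ x r) : Bd θ (-x) r := by
  refine ⟨𝓑.mem_neg θ x h.1, ?_⟩
  have := 𝓑.N_smul θ (-1) x
  simp at this
  rw [this]; exact h.2

lemma sub (h : Bd θ x r) (h' : Bd θ y s) : Bd θ (x - y) (r + s) := by
  rw [sub_eq_add_neg]; exact h.add h'.neg

lemma symm (h : Bd θ (x - y) r) : Bd θ (y - x) r := by
  rw [← neg_sub]; exact h.neg

lemma smul (h : Bd θ x r) {c k : ℝ} (hc : |c| ≤ k) : Bd θ (c • x) (k * r) := by
  refine ⟨𝓑.mem_smul θ c x h.1, ?_⟩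
  rw [𝓑.N_smul]
  exact mul_le_mul hc h.2 (𝓑.N_nonneg _ _) ((abs_nonneg c).trans hc)

lemma sum {ι : Type*} (t : Finset ι) (f : ι → 𝓑.E) (R : ι → ℝ) (h : ∀ i ∈ t, Bd θ (f i) (R i)) :
    Bd θ (∑ i ∈ t, f i) (∑ i ∈ t, R i) := by
  classical
  induction t using Finset.induction_on with
  | empty => simpa using Bd.zero le_rfl
  | insert a t ha ih =>
    rw [Finset.sum_insert ha, Finset.sum_insert ha]
    exact (h a (by simp)).add (ih fun i hi => h i (by simp [hi]))

lemma eq_zero (h : ∀ ε > 0, Bd θ x ε) : x = 0 := by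
  refine 𝓑.N_eq_zero θ x (h 1 one_pos).1 (le_antisymm ?_ (𝓑.N_nonneg _ _))
  exact le_of_forall_pos_le_add fun ε hε => by simpa using (h ε hε).2

lemma of_mem (h : 𝓑.Mem θ x) : Bd θ x (𝓑.N θ x) := ⟨h, le_rfl⟩

lemma lim (h : ∀ ε > 0, ∃ y, Bd θ y r ∧ Bd θ (x - y) ε) : Bd θ x r := by
  have h1 : ∀ ε > 0, Bd θ x (r + ε) := fun ε hε => by
    obtain ⟨y, hy, hxy⟩ := h ε hε
    exact (hy.add hxy).congr (by abel) le_rfl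
  exact ⟨(h1 1 one_pos).1, le_of_forall_pos_le_add fun ε hε => (h1 ε hε).2⟩

end Bd

namespace BanachScale
variable (𝓑 : BanachScale)

/-- The space `B_θ` as a submodule of the ambient space. -/
def sub (θ : ℝ) : Submodule ℝ 𝓑.E where
  carrier := {x | 𝓑.Mem θ x}
  add_mem' := fun {a b} ha hb => 𝓑.mem_add θ a b ha hb
  zero_mem' := 𝓑.mem_zero θ
  smul_mem' := fun c x hx => 𝓑.mem_smul θ c x hx

noncomputable instance instNACG (θ : ℝ) : NormedAddCommGroup (𝓑.sub θ) :=
  AddGroupNorm.toNormedAddCommGroup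
    { toFun := fun x => 𝓑.N θ x.1
      map_zero' := 𝓑.N_zero θ
      add_le' := fun x y => 𝓑.N_add θ x.1 y.1 x.2 y.2
      neg' := fun x => by
        have := 𝓑.N_smul θ (-1) x.1
        simpa using this
      eq_zero_of_map_eq_zero' := fun x hx => Subtype.ext (𝓑.N_eq_zero θ x.1 x.2 hx) }

lemma norm_def (θ : ℝ) (x : 𝓑.sub θ) : ‖x‖ = 𝓑.N θ x.1 := rfl

noncomputable instance instNS (θ : ℝ) : NormedSpace ℝ (𝓑.sub θ) where
  norm_smul_le := fun c x => by
    rw [norm_def, norm_def]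
    exact (𝓑.N_smul θ c x.1).le

instance instCS (θ : ℝ) : CompleteSpace (𝓑.sub θ) := by
  refine Metric.complete_of_cauchySeq_tendsto fun u hu => ?_
  obtain ⟨x, hx, h⟩ := 𝓑.complete θ (fun n => (u n).1) (fun n => (u n).2) (by
    intro ε hε
    obtain ⟨M, hM⟩ := Metric.cauchySeq_iff.1 hu ε hε
    refine ⟨M, fun m hm n hn => ?_⟩
    have := hM m hm n hn
    rwa [dist_eq_norm] at this)
  refine ⟨⟨x, hx⟩, Metric.tendsto_atTop.2 fun ε hε => ?_⟩
  obtain ⟨M, hM⟩ := h ε hε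
  refine ⟨M, fun n hn => ?_⟩
  rw [dist_eq_norm]
  exact hM n hn

lemma bd_iff (θ : ℝ) (x : 𝓑.sub θ) (r : ℝ) : Bd θ x.1 r ↔ ‖x‖ ≤ r :=
  ⟨fun h => h.2, fun h => ⟨x.2, h⟩⟩

end BanachScale

section basics
variable {𝓑 : BanachScale}

lemma bd_embed (𝓑 : BanachScale) {a b : ℝ} (hab : a ≤ b) :
    ∃ C ≥ (1:ℝ), ∀ (x : 𝓑.E) r, Bd b x r → Bd a x (C * r) := by
  obtain ⟨C, hC, h⟩ := 𝓑.embed_bound hab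
  refine ⟨max C 1, le_max_right _ _, fun x r hx => ⟨𝓑.mem_mono hab x hx.1, (h x hx.1).trans ?_⟩⟩
  exact mul_le_mul (le_max_left _ _) hx.2 (𝓑.N_nonneg _ _) (hC.le.trans (le_max_left _ _))

lemma bd_geom {θ : ℝ} (x : ℕ → 𝓑.E) {c q : ℝ} (hq0 : 0 ≤ q) (hq : q < 1)
    (h : ∀ n, Bd θ (x (n+1) - x n) (c * q ^ n)) :
    ∃ l, ∀ n, Bd θ (l - x n) (c * q ^ n / (1 - q)) := by
  have hm : ∀ n, 𝓑.Mem θ (x n - x 0) := by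
    intro n
    induction n with
    | zero => simpa using 𝓑.mem_zero θ
    | succ n ih =>
      have := 𝓑.mem_add θ _ _ (h n).1 ih
      simpa using this
  let u : ℕ → 𝓑.sub θ := fun n => ⟨x n - x 0, hm n⟩
  have hu : ∀ n, dist (u n) (u (n+1)) ≤ c * q ^ n := by
    intro n
    rw [dist_comm, dist_eq_norm, BanachScale.norm_def]
    have := (h n).2
    simpa [u] using this
  have hc : CauchySeq u := cauchySeq_of_le_geometric q c hq hu
  obtain ⟨l, hl⟩ := cauchySeq_tendsto_of_complete hc
  refine ⟨l.1 + x 0, fun n => ?_⟩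
  have h1 := dist_le_of_le_geometric_of_tendsto q c hq hu hl n
  rw [dist_comm, dist_eq_norm, ← BanachScale.bd_iff] at h1
  exact h1.congr (by simp [u]; abel) le_rfl

/-- Mean value inequality. -/
lemma bd_mvt {θ : ℝ} (f f' : ℝ → 𝓑.E) {C : ℝ} (hf : ∀ r ∈ Icc (0:ℝ) 1, 𝓑.Mem θ (f r))
    (hf' : ∀ r ∈ Icc (0:ℝ) 1, Bd θ (f' r) C)
    (hd : ∀ r ∈ Icc (0:ℝ) 1, ∀ ε > (0:ℝ), ∃ δ > (0:ℝ), ∀ r' ∈ Icc (0:ℝ) 1, |r' - r| < δ →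
      𝓑.N θ (f r' - f r - (r' - r) • f' r) ≤ ε * |r' - r|) :
    Bd θ (f 1 - f 0) C := by
  classical
  let F : ℝ → 𝓑.sub θ := fun r => if h : r ∈ Icc (0:ℝ) 1 then ⟨f r, hf r h⟩ else 0
  let F' : ℝ → 𝓑.sub θ := fun r => if h : r ∈ Icc (0:ℝ) 1 then ⟨f' r, (hf' r h).1⟩ else 0
  have hF : ∀ r (h : r ∈ Icc (0:ℝ) 1), F r = ⟨f r, hf r h⟩ := fun r h => dif_pos h
  have hF' : ∀ r (h : r ∈ Icc (0:ℝ) 1), F' r = ⟨f' r, (hf' r h).1⟩ := fun r h => dif_pos h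
  have key : ‖F 1 - F 0‖ ≤ C := by
    refine norm_image_sub_le_of_norm_deriv_le_segment_01' (f := F) (f' := F') ?_ ?_
    · intro r hr
      rw [hasDerivWithinAt_iff_isLittleO, Asymptotics.isLittleO_iff]
      intro ε hε
      obtain ⟨δ, hδ, H⟩ := hd r hr ε hε
      filter_upwards [self_mem_nhdsWithin, mem_nhdsWithin_of_mem_nhds (Metric.ball_mem_nhds r hδ)]
        with r' hr' hb
      rw [hF r hr, hF r' hr', hF' r hr, Real.norm_eq_abs]
      exact H r' hr' (by simpa [Real.dist_eq] using hb)
    · intro r hr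
      have hr' : r ∈ Icc (0:ℝ) 1 := ⟨hr.1, hr.2.le⟩
      rw [hF' r hr']
      exact (hf' r hr').2
  have e0 : (0:ℝ) ∈ Icc (0:ℝ) 1 := by simp
  have e1 : (1:ℝ) ∈ Icc (0:ℝ) 1 := by simp
  rw [hF 1 e1, hF 0 e0, ← BanachScale.bd_iff] at key
  exact key

end basics

section semigroup
variable {𝓑 : BanachScale} (Sg : ScaleSemigroup 𝓑)

lemma sg_bdd (θ : ℝ) : ∃ C ≥ (1:ℝ), ∀ (t : ℝ) (x : 𝓑.E) r, 0 ≤ t → t ≤ 1 → Bd θ x r →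
    Bd θ (Sg.S t x) (C * r) := by
  obtain ⟨C, hC, h⟩ := Sg.S_bounded θ 1 one_pos
  refine ⟨max C 1, le_max_right _ _, fun t x r h0 h1 hx => ⟨Sg.S_mem t θ x h0 hx.1,
    (h t x h0 h1 hx.1).trans ?_⟩⟩
  exact mul_le_mul (le_max_left _ _) hx.2 (𝓑.N_nonneg _ _) (hC.le.trans (le_max_left _ _))

lemma sg_smooth1 (a b : ℝ) (hab : a ≤ b) (hb : b ≤ a + 1) :
    ∃ C ≥ (1:ℝ), ∀ (t : ℝ) (x : 𝓑.E) r, 0 < t → t ≤ 1 → Bd a x r →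
    Bd b (Sg.S t x) (C * t ^ (-(b - a)) * r) := by
  obtain ⟨C, hC, h⟩ := Sg.S_smoothing a (b - a) 1 (by linarith) (by linarith) one_pos
  refine ⟨max C 1, le_max_right _ _, fun t x r h0 h1 hx => ?_⟩
  obtain ⟨h2, h3⟩ := h t x h0 h1 hx.1
  rw [add_sub_cancel] at h2 h3
  refine ⟨h2, h3.trans ?_⟩
  have := Real.rpow_nonneg h0.le (-(b-a))
  exact mul_le_mul (by gcongr; exact le_max_left _ _) hx.2 (𝓑.N_nonneg _ _) (by positivity)

lemma sg_smooth (a b : ℝ) (hab : a ≤ b) (hb : b ≤ a + 2) :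
    ∃ C ≥ (1:ℝ), ∀ (t : ℝ) (x : 𝓑.E) r, 0 < t → t ≤ 1 → Bd a x r →
    Bd b (Sg.S t x) (C * t ^ (-(b - a)) * r) := by
  obtain ⟨C1, hC1, h1⟩ := sg_smooth1 Sg a ((a+b)/2) (by linarith) (by linarith)
  obtain ⟨C2, hC2, h2⟩ := sg_smooth1 Sg ((a+b)/2) b (by linarith) (by linarith)
  have hp : (0:ℝ) < 2 ^ (b - a) := Real.rpow_pos_of_pos two_pos _
  refine ⟨C2 * C1 * 2 ^ (b - a), ?_, fun t x r h0 ht hx => ?_⟩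
  · have : (1:ℝ) ≤ 2 ^ (b - a) := Real.one_le_rpow (by norm_num) (by linarith)
    have h12 : 1 ≤ C2 * C1 := one_le_mul_of_one_le_of_one_le hC2 hC1
    exact one_le_mul_of_one_le_of_one_le h12 this
  · have e : Sg.S t x = Sg.S (t/2) (Sg.S (t/2) x) := by
      rw [← Sg.S_comp _ _ (by linarith) (by linarith)]; congr 2; ring
    refine (h2 (t/2) _ _ (by linarith) (by linarith) (h1 (t/2) x r (by linarith) (by linarith) hx)).congr
      e (le_of_eq ?_)
    have e2 : (t/2) ^ (-(b - (a+b)/2)) * (t/2) ^ (-((a+b)/2 - a)) = 2 ^ (b-a) * t ^ (-(b-a)) := by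
      rw [← Real.rpow_add (by linarith), Real.div_rpow h0.le (by norm_num), div_eq_mul_inv,
        ← Real.rpow_neg (by norm_num), mul_comm]
      congr 2 <;> ring
    calc _ = C2 * C1 * ((t/2) ^ (-(b - (a+b)/2)) * (t/2) ^ (-((a+b)/2 - a))) * r := by ring
      _ = _ := by rw [e2]; ring

lemma sg_hold (a b : ℝ) (hab : a ≤ b) (hb : b ≤ a + 1) :
    ∃ C ≥ (1:ℝ), ∀ (t : ℝ) (x : 𝓑.E) r, 0 ≤ t → t ≤ 1 → Bd b x r →
    Bd a (Sg.S t x - x) (C * t ^ (b - a) * r) := by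
  obtain ⟨C, hC, h⟩ := Sg.S_holdId a (b - a) 1 (by linarith) (by linarith) one_pos
  refine ⟨max C 1, le_max_right _ _, fun t x r h0 h1 hx => ?_⟩
  have hp := Real.rpow_nonneg h0 (b-a)
  have hC1 : (0:ℝ) ≤ max C 1 := le_trans zero_le_one (le_max_right _ _)
  rcases h0.eq_or_lt with h0' | h0'
  · rw [← h0', Sg.S_id, sub_self]
    rw [← h0'] at hp
    exact Bd.zero (mul_nonneg (mul_nonneg hC1 hp) hx.nonneg)
  have h3 := h t x h0' h1
  rw [add_sub_cancel] at h3
  have hm := 𝓑.mem_mono hab x hx.1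
  refine ⟨?_, (h3 hx.1).trans ?_⟩
  · have := 𝓑.mem_add a _ _ (Sg.S_mem t a x h0 hm) (𝓑.mem_neg a x hm)
    rwa [← sub_eq_add_neg] at this
  exact mul_le_mul (by gcongr; exact le_max_left _ _) hx.2 (𝓑.N_nonneg _ _) (by positivity)

lemma sg_add {s t : ℝ} (hs : 0 ≤ s) (ht : 0 ≤ t) (x : 𝓑.E) :
    Sg.S s (Sg.S t x) = Sg.S (s + t) x := (Sg.S_comp s t hs ht x).symm

lemma sg_add' {a b c : ℝ} (hab : a ≤ b) (hbc : b ≤ c) (x : 𝓑.E) :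
    Sg.S (c - b) (Sg.S (b - a) x) = Sg.S (c - a) x := by
  rw [sg_add Sg (by linarith) (by linarith)]; congr 2; ring

end semigroup

/-- interpolation -/
lemma bd_interp (𝓑 : BanachScale) {a b c : ℝ} (hab : a < b) (hbc : b < c) :
    ∃ C ≥ (1:ℝ), ∀ (x : 𝓑.E) K l p q, 0 < l → Bd a x (K * l ^ p) → Bd c x (K * l ^ q) →
      Bd b x (C * (K * l ^ (p * ((c - b) / (c - a)) + q * ((b - a) / (c - a))))) := by
  obtain ⟨C, hC, h⟩ := 𝓑.interp hab.le hbc.le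
  have hca : 0 < c - a := by linarith
  refine ⟨max C 1 ^ (1 / (c - a)), Real.one_le_rpow (le_max_right _ _) (by positivity),
    fun x K l p q hl h1 h2 => ⟨𝓑.mem_mono hbc.le x h2.1, ?_⟩⟩
  have hK : 0 ≤ K := by
    have := h1.nonneg
    exact nonneg_of_mul_nonneg_left this (Real.rpow_pos_of_pos hl p)
  have hM : (0:ℝ) ≤ max C 1 := le_trans zero_le_one (le_max_right _ _)
  have h3 := h x h2.1
  have h4 : 𝓑.N b x ^ (c - a) ≤ max C 1 * ((K * l ^ p) ^ (c - b) * (K * l ^ q) ^ (b - a)) := by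
    refine h3.trans ?_
    refine mul_le_mul (le_max_left _ _) ?_ (mul_nonneg (Real.rpow_nonneg (𝓑.N_nonneg _ _) _)
      (Real.rpow_nonneg (𝓑.N_nonneg _ _) _)) hM
    exact mul_le_mul (Real.rpow_le_rpow (𝓑.N_nonneg _ _) h1.2 (by linarith))
      (Real.rpow_le_rpow (𝓑.N_nonneg _ _) h2.2 (by linarith)) (Real.rpow_nonneg (𝓑.N_nonneg _ _) _)
      (Real.rpow_nonneg h1.nonneg _)
  have h5 : (max C 1 ^ (1 / (c - a)) * (K * l ^ (p * ((c - b) / (c - a)) + q * ((b - a) / (c - a)))))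
      ^ (c - a) = max C 1 * ((K * l ^ p) ^ (c - b) * (K * l ^ q) ^ (b - a)) := by
    have hlp : ∀ z : ℝ, 0 ≤ l ^ z := fun z => (Real.rpow_pos_of_pos hl z).le
    rw [Real.mul_rpow (Real.rpow_nonneg hM _) (mul_nonneg hK (hlp _)),
      Real.mul_rpow hK (hlp _), Real.mul_rpow hK (hlp _), Real.mul_rpow hK (hlp _),
      ← Real.rpow_mul hM, ← Real.rpow_mul hl.le, ← Real.rpow_mul hl.le, ← Real.rpow_mul hl.le]
    have e1 : 1 / (c - a) * (c - a) = 1 := by field_simp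
    have e2 : (p * ((c - b) / (c - a)) + q * ((b - a) / (c - a))) * (c - a)
      = p * (c - b) + q * (b - a) := by field_simp
    have e3 : K ^ (c - a) = K ^ (c - b) * K ^ (b - a) := by
      rw [← Real.rpow_add_of_nonneg hK (by linarith) (by linarith)]; congr 1; ring
    rw [e1, e2, e3, Real.rpow_one, Real.rpow_add hl]
    ring
  rw [← h5] at h4
  refine (Real.rpow_le_rpow_iff (𝓑.N_nonneg _ _) ?_ hca).1 h4
  exact mul_nonneg (Real.rpow_nonneg hM _) (mul_nonneg hK (Real.rpow_nonneg hl.le _))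

lemma bd_mvt_dir {𝓑 : BanachScale} {a b : ℝ} (Φ : 𝓑.E → 𝓑.E) (DΦ : 𝓑.E → 𝓑.E →ₗ[ℝ] 𝓑.E) {Q R : ℝ}
    (hQ : 0 ≤ Q) (hΦ : ∀ x, 𝓑.Mem a x → 𝓑.Mem b (Φ x))
    (hder : ∀ x, 𝓑.Mem a x → ∀ ε > (0:ℝ), ∃ δ > (0:ℝ), ∀ h, 𝓑.Mem a h → 𝓑.N a h < δ →
      𝓑.N b (Φ (x + h) - Φ x - DΦ x h) ≤ ε * (𝓑.N a h * Q))
    {x h : 𝓑.E} (hx : 𝓑.Mem a x) (hh : 𝓑.Mem a h)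
    (hR : ∀ r ∈ Icc (0:ℝ) 1, Bd b (DΦ (x + r • h) h) R) :
    Bd b (Φ (x + h) - Φ x) R := by
  have hm : ∀ r : ℝ, 𝓑.Mem a (x + r • h) := fun r => 𝓑.mem_add _ _ _ hx (𝓑.mem_smul _ _ _ hh)
  have := bd_mvt (θ := b) (fun r => Φ (x + r • h)) (fun r => DΦ (x + r • h) h) (C := R)
    (fun r _ => hΦ _ (hm r)) hR (by
      intro r hr ε hε
      have hN := 𝓑.N_nonneg a h
      have hq : 0 < 𝓑.N a h * Q + 1 := by positivity
      obtain ⟨δ, hδ, H⟩ := hder _ (hm r) (ε / (𝓑.N a h * Q + 1)) (by positivity)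
      refine ⟨δ / (𝓑.N a h + 1), by positivity, fun r' _ hrr => ?_⟩
      have h1 := H ((r' - r) • h) (𝓑.mem_smul _ _ _ hh) (by
        rw [𝓑.N_smul]
        rw [lt_div_iff₀ (by positivity)] at hrr
        refine lt_of_le_of_lt ?_ hrr
        gcongr; linarith)
      have e : x + r • h + (r' - r) • h = x + r' • h := by rw [sub_smul]; abel
      rw [e, map_smul, 𝓑.N_smul] at h1
      refine h1.trans ?_
      have : ε / (𝓑.N a h * Q + 1) * (|r' - r| * 𝓑.N a h * Q)
        = ε * |r' - r| * ((𝓑.N a h * Q) / (𝓑.N a h * Q + 1)) := by ring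
      rw [this]
      refine mul_le_of_le_one_right (by positivity) ?_
      rw [div_le_one hq]; linarith)
  simpa using this

/-- quantitative facts on `G : B_a → B_{a-σ}` -/
structure GLev (𝓑 : BanachScale) (a b C : ℝ) (G : 𝓑.E → 𝓑.E) (DG : 𝓑.E → 𝓑.E →ₗ[ℝ] 𝓑.E) : Prop where
  mem : ∀ x, 𝓑.Mem a x → 𝓑.Mem b (G x)
  dg : ∀ x h r, 𝓑.Mem a x → Bd a h r → Bd b (DG x h) (C * r)
  lip : ∀ x y r, 𝓑.Mem a x → 𝓑.Mem a y → Bd a (x - y) r → Bd b (G x - G y) (C * r)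
  dlip : ∀ x y k r s, 𝓑.Mem a x → 𝓑.Mem a y → Bd a (x - y) r → Bd a k s →
    Bd b (DG x k - DG y k) (C * (r * s))
  lip2 : ∀ x y h r s, 𝓑.Mem a x → 𝓑.Mem a y → Bd a (x - y) r → Bd a h s →
    Bd b (G (x + h) - G x - (G (y + h) - G y)) (C * (r * s))
  dlip2 : ∀ x y h k r s u, 𝓑.Mem a x → 𝓑.Mem a y → Bd a (x - y) r → Bd a h s → Bd a k u →
    Bd b (DG (x + h) k - DG x k - (DG (y + h) k - DG y k)) (C * (r * (s * u)))
  tay : ∀ x y h r s, 𝓑.Mem a x → 𝓑.Mem a y → Bd a (x - y) r → Bd a h s →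
    Bd b (G (x + h) - G x - DG x h - (G (y + h) - G y - DG y h)) (C * (r * (s * s)))
  tay2 : ∀ x h k r s u, 𝓑.Mem a x → Bd a h r → Bd a k s → Bd a (h - k) u →
    Bd b (G (x + h) - G (x + k) - DG x (h - k)) (C * ((r + s) * u))

lemma glev_of {𝓑 : BanachScale} {α σ γ : ℝ} {G : 𝓑.E → 𝓑.E} {DG : 𝓑.E → 𝓑.E →ₗ[ℝ] 𝓑.E}
    {D2G : 𝓑.E → 𝓑.E →ₗ[ℝ] 𝓑.E →ₗ[ℝ] 𝓑.E} {D3G : 𝓑.E → 𝓑.E →ₗ[ℝ] 𝓑.E →ₗ[ℝ] 𝓑.E →ₗ[ℝ] 𝓑.E}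
    (hG : AssumptionG 𝓑 α σ γ G DG D2G D3G) {θ : ℝ} (hθ : θ ∈ ({0, α, 2 * α} : Set ℝ)) :
    ∃ C₀, ∀ C ≥ C₀, GLev 𝓑 (γ - θ) (γ - θ - σ) C G DG := by
  obtain ⟨C1', hC1'⟩ := hG.DG_bound θ hθ
  obtain ⟨C2', hC2'⟩ := hG.D2G_bound θ hθ
  obtain ⟨C3', hC3'⟩ := hG.D3G_bound θ hθ
  refine ⟨max 0 (max C1' (max C2' C3')), fun C hC => ?_⟩
  have hC0 : 0 ≤ C := le_trans (le_max_left _ _) hC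
  have hC1 : C1' ≤ C := le_trans (le_trans (le_max_left _ _) (le_max_right _ _)) hC
  have hC2 : C2' ≤ C :=
    le_trans (le_trans (le_trans (le_max_left _ _) (le_max_right _ _)) (le_max_right _ _)) hC
  have hC3 : C3' ≤ C :=
    le_trans (le_trans (le_trans (le_max_right _ _) (le_max_right _ _)) (le_max_right _ _)) hC
  set a := γ - θ with ha
  set b := a - σ with hb
  have sm : ∀ {x y : 𝓑.E} {c : ℝ}, 𝓑.Mem c x → 𝓑.Mem c y → 𝓑.Mem c (x - y) := by
    intro x y c h1 h2
    rw [sub_eq_add_neg]; exact 𝓑.mem_add _ _ _ h1 (𝓑.mem_neg _ _ h2)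
  have d1 : ∀ x h r, 𝓑.Mem a x → Bd a h r → Bd b (DG x h) (C * r) := fun x h r hx hh =>
    ⟨hG.DG_maps θ hθ x h hx hh.1, (hC1' x h hx hh.1).trans
      (mul_le_mul hC1 hh.2 (𝓑.N_nonneg _ _) hC0)⟩
  have d2 : ∀ x h k r s, 𝓑.Mem a x → Bd a h r → Bd a k s → Bd b (D2G x h k) (C * (r * s)) :=
    fun x h k r s hx hh hk => ⟨hG.D2G_maps θ hθ x h k hx hh.1 hk.1, (hC2' x h k hx hh.1 hk.1).trans
      (mul_le_mul hC2 (mul_le_mul hh.2 hk.2 (𝓑.N_nonneg _ _) hh.nonneg)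
        (mul_nonneg (𝓑.N_nonneg _ _) (𝓑.N_nonneg _ _)) hC0)⟩
  have d3 : ∀ x h k l r s u, 𝓑.Mem a x → Bd a h r → Bd a k s → Bd a l u →
      Bd b (D3G x h k l) (C * (r * (s * u))) :=
    fun x h k l r s u hx hh hk hl => ⟨hG.D3G_maps θ hθ x h k l hx hh.1 hk.1 hl.1,
      (hC3' x h k l hx hh.1 hk.1 hl.1).trans
      (mul_le_mul hC3 (mul_le_mul hh.2 (mul_le_mul hk.2 hl.2 (𝓑.N_nonneg _ _) hk.nonneg)
          (mul_nonneg (𝓑.N_nonneg _ _) (𝓑.N_nonneg _ _)) hh.nonneg)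
        (mul_nonneg (𝓑.N_nonneg _ _) (mul_nonneg (𝓑.N_nonneg _ _) (𝓑.N_nonneg _ _))) hC0)⟩
  -- derivative facts
  have D1 : ∀ x, 𝓑.Mem a x → ∀ ε > (0:ℝ), ∃ δ > (0:ℝ), ∀ h, 𝓑.Mem a h → 𝓑.N a h < δ →
      Bd b (G (x + h) - G x - DG x h) (ε * 𝓑.N a h) := fun x hx ε hε => by
    obtain ⟨δ, hδ, H⟩ := hG.DG_isDeriv θ hθ x hx ε hε
    exact ⟨δ, hδ, fun h hh hn => ⟨sm (sm (hG.maps θ hθ _ (𝓑.mem_add _ _ _ hx hh))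
      (hG.maps θ hθ _ hx)) (hG.DG_maps θ hθ _ _ hx hh), H h hh hn⟩⟩
  have D2 : ∀ x, 𝓑.Mem a x → ∀ ε > (0:ℝ), ∃ δ > (0:ℝ), ∀ h, 𝓑.Mem a h → 𝓑.N a h < δ →
      ∀ k, 𝓑.Mem a k →
      Bd b (DG (x + h) k - DG x k - D2G x h k) (ε * (𝓑.N a h * 𝓑.N a k)) := fun x hx ε hε => by
    obtain ⟨δ, hδ, H⟩ := hG.D2G_isDeriv θ hθ x hx ε hε
    exact ⟨δ, hδ, fun h hh hn k hk => ⟨sm (sm (hG.DG_maps θ hθ _ _ (𝓑.mem_add _ _ _ hx hh) hk)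
      (hG.DG_maps θ hθ _ _ hx hk)) (hG.D2G_maps θ hθ _ _ _ hx hh hk), H h hh hn k hk⟩⟩
  have lip : ∀ x y r, 𝓑.Mem a x → 𝓑.Mem a y → Bd a (x - y) r → Bd b (G x - G y) (C * r) := by
    intro x y r hx hy hr
    have := bd_mvt_dir (a := a) (b := b) (R := C * r) (Q := 1) G DG zero_le_one (hG.maps θ hθ) (by
      simpa using hG.DG_isDeriv θ hθ) hy hr.1
      (fun t _ => d1 _ _ _ (𝓑.mem_add _ _ _ hy (𝓑.mem_smul _ _ _ hr.1)) hr)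
    simpa using this
  have dlip : ∀ x y k r s, 𝓑.Mem a x → 𝓑.Mem a y → Bd a (x - y) r → Bd a k s →
      Bd b (DG x k - DG y k) (C * (r * s)) := by
    intro x y k r s hx hy hr hk
    have := bd_mvt_dir (a := a) (b := b) (R := C * (r * s)) (Q := 𝓑.N a k) (fun z => DG z k)
      (fun z => (D2G z).flip k) (𝓑.N_nonneg _ _) (fun z hz => hG.DG_maps θ hθ z k hz hk.1) (by
      intro z hz ε hε
      obtain ⟨δ, hδ, H⟩ := hG.D2G_isDeriv θ hθ z hz ε hε
      exact ⟨δ, hδ, fun h hh hn => H h hh hn k hk.1⟩) hy hr.1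
      (fun t _ => d2 _ _ _ _ _ (𝓑.mem_add _ _ _ hy (𝓑.mem_smul _ _ _ hr.1)) hr hk)
    simpa using this
  have d2lip : ∀ x y k l r s u, 𝓑.Mem a x → 𝓑.Mem a y → Bd a (x - y) r → Bd a k s → Bd a l u →
      Bd b (D2G x k l - D2G y k l) (C * (r * (s * u))) := by
    intro x y k l r s u hx hy hr hk hl
    have := bd_mvt_dir (a := a) (b := b) (R := C * (r * (s * u))) (Q := 𝓑.N a k * 𝓑.N a l)
      (fun z => D2G z k l)
      (fun z => ((D3G z).flip k).flip l) (mul_nonneg (𝓑.N_nonneg _ _) (𝓑.N_nonneg _ _))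
      (fun z hz => hG.D2G_maps θ hθ z k l hz hk.1 hl.1) (by
      intro z hz ε hε
      obtain ⟨δ, hδ, H⟩ := hG.D3G_isDeriv θ hθ z hz ε hε
      exact ⟨δ, hδ, fun h hh hn => H h hh hn k l hk.1 hl.1⟩) hy hr.1
      (fun t _ => d3 _ _ _ _ _ _ _ (𝓑.mem_add _ _ _ hy (𝓑.mem_smul _ _ _ hr.1)) hr hk hl)
    simpa using this
  have D1' : ∀ c, 𝓑.Mem a c → ∀ x, 𝓑.Mem a x → ∀ ε > (0:ℝ), ∃ δ > (0:ℝ), ∀ h, 𝓑.Mem a h →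
      𝓑.N a h < δ → Bd b (G (x + h + c) - G (x + h) - (G (x + c) - G x) -
        (DG (x + c) h - DG x h)) (ε * (𝓑.N a h)) := by
    intro c hc x hx ε hε
    obtain ⟨δ1, hδ1, H1⟩ := D1 x hx (ε/2) (by linarith)
    obtain ⟨δ2, hδ2, H2⟩ := D1 (x + c) (𝓑.mem_add _ _ _ hx hc) (ε/2) (by linarith)
    refine ⟨min δ1 δ2, lt_min hδ1 hδ2, fun h hh hn => ?_⟩
    refine ((H2 h hh (hn.trans_le (min_le_right _ _))).sub
      (H1 h hh (hn.trans_le (min_le_left _ _)))).congr ?_ (by linarith)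
    rw [add_right_comm x h c]; abel
  have lip2 : ∀ x y h r s, 𝓑.Mem a x → 𝓑.Mem a y → Bd a (x - y) r → Bd a h s →
      Bd b (G (x + h) - G x - (G (y + h) - G y)) (C * (r * s)) := by
    intro x y h r s hx hy hr hh
    have := bd_mvt_dir (a := a) (b := b) (R := C * (r * s)) (Q := 1)
      (fun z => G (z + (x - y)) - G z)
      (fun z => DG (z + (x - y)) - DG z) zero_le_one
      (fun z hz => sm (hG.maps θ hθ _ (𝓑.mem_add _ _ _ hz hr.1)) (hG.maps θ hθ _ hz)) (by
      intro z hz ε hε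
      obtain ⟨δ, hδ, H⟩ := D1' _ hr.1 z hz ε hε
      exact ⟨δ, hδ, fun h hh hn => by simpa using (H h hh hn).2⟩) hy hh.1
      (fun t _ => by
        have hm := (𝓑.mem_add _ _ _ hy (𝓑.mem_smul _ t _ hh.1))
        exact dlip _ _ _ _ _ (𝓑.mem_add _ _ _ hm hr.1) hm (by simpa using hr) hh)
    refine this.congr ?_ le_rfl
    have e1 : y + h + (x - y) = x + h := by abel
    have e2 : y + (x - y) = x := by abel
    simp only [e1, e2]; abel
  have dlip2 : ∀ x y h k r s u, 𝓑.Mem a x → 𝓑.Mem a y → Bd a (x - y) r → Bd a h s → Bd a k u →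
      Bd b (DG (x + h) k - DG x k - (DG (y + h) k - DG y k)) (C * (r * (s * u))) := by
    intro x y h k r s u hx hy hr hh hk
    have := bd_mvt_dir (a := a) (b := b) (R := C * (r * (s * u))) (Q := 𝓑.N a k)
      (fun z => DG (z + (x - y)) k - DG z k)
      (fun z => (D2G (z + (x - y))).flip k - (D2G z).flip k) (𝓑.N_nonneg _ _)
      (fun z hz => sm (hG.DG_maps θ hθ _ _ (𝓑.mem_add _ _ _ hz hr.1) hk.1)
        (hG.DG_maps θ hθ _ _ hz hk.1)) (by
      intro z hz ε hε
      obtain ⟨δ1, hδ1, H1⟩ := D2 z hz (ε/2) (by linarith)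
      obtain ⟨δ2, hδ2, H2⟩ := D2 (z + (x - y)) (𝓑.mem_add _ _ _ hz hr.1) (ε/2) (by linarith)
      refine ⟨min δ1 δ2, lt_min hδ1 hδ2, fun h hh hn => ?_⟩
      refine (((H2 h hh (hn.trans_le (min_le_right _ _)) k hk.1).sub
        (H1 h hh (hn.trans_le (min_le_left _ _)) k hk.1)).congr ?_ (le_of_eq ?_)).2
      · rw [add_right_comm z h (x - y)]
        simp only [LinearMap.sub_apply, LinearMap.flip_apply]; abel
      · ring) hy hh.1
      (fun t _ => by
        have hm := (𝓑.mem_add _ _ _ hy (𝓑.mem_smul _ t _ hh.1))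
        exact d2lip _ _ _ _ _ _ _ (𝓑.mem_add _ _ _ hm hr.1) hm (by simpa using hr) hh hk)
    refine this.congr ?_ le_rfl
    have e1 : y + h + (x - y) = x + h := by abel
    have e2 : y + (x - y) = x := by abel
    simp only [e1, e2]; abel
  refine ⟨hG.maps θ hθ, d1, lip, dlip, lip2, dlip2, ?_, ?_⟩
  · intro x y h r s hx hy hr hh
    have := bd_mvt_dir (a := a) (b := b) (R := C * (r * (s * s))) (Q := 1)
      (fun z => G (z + (x - y)) - G z - (DG x z - DG y z))
      (fun z => DG (z + (x - y)) - DG z - (DG x - DG y)) zero_le_one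
      (fun z hz => sm (sm (hG.maps θ hθ _ (𝓑.mem_add _ _ _ hz hr.1)) (hG.maps θ hθ _ hz))
        (sm (hG.DG_maps θ hθ _ _ hx hz) (hG.DG_maps θ hθ _ _ hy hz))) (by
      intro z hz ε hε
      obtain ⟨δ, hδ, H⟩ := D1' _ hr.1 z hz ε hε
      refine ⟨δ, hδ, fun h hh hn => ((H h hh hn).congr ?_ (by simp)).2⟩
      simp only [LinearMap.sub_apply, map_add]; abel) hy hh.1
      (fun t ht => by
        have hth : Bd a (t • h) (1 * s) := hh.smul (by rw [abs_of_nonneg ht.1]; exact ht.2)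
        refine (dlip2 x y (t • h) h _ _ _ hx hy hr hth hh).congr ?_ (by simp)
        have e1 : y + t • h + (x - y) = x + t • h := by abel
        simp only [LinearMap.sub_apply, e1]; abel)
    refine this.congr ?_ le_rfl
    have e1 : y + h + (x - y) = x + h := by abel
    have e2 : y + (x - y) = x := by abel
    simp only [e1, e2, map_add]; abel
  · intro x h k r s u hx hh hk hu
    have hxk := 𝓑.mem_add _ _ _ hx hk.1
    have := bd_mvt_dir (a := a) (b := b) (R := C * ((r + s) * u)) (Q := 1)
      (fun z => G z - DG x z)
      (fun z => DG z - DG x) zero_le_one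
      (fun z hz => sm (hG.maps θ hθ _ hz) (hG.DG_maps θ hθ _ _ hx hz)) (by
      intro z hz ε hε
      obtain ⟨δ, hδ, H⟩ := D1 z hz ε hε
      refine ⟨δ, hδ, fun h hh hn => ((H h hh hn).congr ?_ (by simp)).2⟩
      simp only [LinearMap.sub_apply, map_add]; abel) (x := x + k) (h := h - k) hxk hu.1
      (fun t ht => by
        refine dlip _ _ _ _ _ (𝓑.mem_add _ _ _ hxk (𝓑.mem_smul _ _ _ hu.1)) hx ?_ hu
        have h1 : Bd a (t • h) (t * r) := hh.smul (abs_of_nonneg ht.1).le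
        have h2 : Bd a ((1 - t) • k) ((1 - t) * s) :=
          hk.smul (abs_of_nonneg (by linarith [ht.2])).le
        refine (h1.add h2).congr ?_ ?_
        · rw [sub_smul, smul_sub, one_smul]; abel
        · nlinarith [ht.1, ht.2, hh.nonneg, hk.nonneg])
    refine this.congr ?_ le_rfl
    have e1 : x + k + (h - k) = x + h := by abel
    simp only [e1, map_add, map_sub]; abel

lemma exists_cross (t : ℕ → ℝ) (m : ℝ) (i j : ℕ) (hij : i < j) (hi : t i ≤ m) (hj : m ≤ t j) :
    ∃ k, i ≤ k ∧ k < j ∧ t k ≤ m ∧ m ≤ t (k + 1) := by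
  induction j, hij using Nat.le_induction with
  | base => exact ⟨i, le_rfl, by omega, hi, hj⟩
  | succ j hj' ih =>
    rcases le_total m (t j) with h | h
    · obtain ⟨k, h1, h2, h3, h4⟩ := ih h
      exact ⟨k, h1, by omega, h3, h4⟩
    · exact ⟨j, by omega, by omega, h, hj⟩

lemma sew_seq {𝓑 : BanachScale} {θ p K : ℝ} (hp : 1 < p) (Ξ : ℝ → ℝ → 𝓑.E) (t : ℕ → ℝ)
    (ht : Monotone t) (n : ℕ) (h0 : ∀ i ≤ n, Ξ (t i) (t i) = 0) (hK : 0 ≤ K)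
    (hδ : ∀ i j k, i ≤ j → j ≤ k → k ≤ n →
      Bd θ (Ξ (t i) (t k) - Ξ (t i) (t j) - Ξ (t j) (t k)) (K * (t k - t i) ^ p)) :
    ∀ i j, i ≤ j → j ≤ n →
      Bd θ (∑ k ∈ Finset.Ico i j, Ξ (t k) (t (k+1)) - Ξ (t i) (t j))
        (2 / (1 - 2 ^ (1 - p)) * K * (t j - t i) ^ p) := by
  have h2 : (2:ℝ) ^ (1 - p) < 1 := Real.rpow_lt_one_of_one_lt_of_neg one_lt_two (by linarith)
  set q : ℝ := 2 ^ (1 - p) with hq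
  have hq0 : 0 < 1 - q := by linarith
  have main : ∀ d i j, j - i ≤ d → i ≤ j → j ≤ n →
      Bd θ (∑ k ∈ Finset.Ico i j, Ξ (t k) (t (k+1)) - Ξ (t i) (t j))
        (2 / (1 - q) * K * (t j - t i) ^ p) := by
    intro d
    induction d with
    | zero =>
      intro i j hd hij hjn
      have : i = j := by omega
      subst this
      simp only [Finset.Ico_self, Finset.sum_empty, h0 i hjn, sub_self]
      exact Bd.zero (mul_nonneg (by positivity) (Real.rpow_nonneg le_rfl _))
    | succ d ih =>
      intro i j hd hij hjn
      rcases hij.eq_or_lt with rfl | hlt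
      · exact ih i i (by omega) le_rfl hjn
      have hmono := ht hij
      obtain ⟨k, hik, hkj, hk1, hk2⟩ := exists_cross t ((t i + t j) / 2) i j hlt (by linarith)
        (by linarith)
      have L := ih i k (by omega) hik (by omega)
      have R := ih (k+1) j (by omega) (by omega) hjn
      have A := hδ i k j hik hkj.le hjn
      have B := hδ k (k+1) j (by omega) (by omega) hjn
      have hki := ht hik
      have hkj' := ht (show k + 1 ≤ j by omega)
      have hkj'' := ht (show k ≤ j by omega)
      set ℓ := t j - t i with hl
      have hl0 : 0 ≤ ℓ := by linarith
      have half : (ℓ / 2) ^ p * 2 = q * ℓ ^ p := by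
        rw [Real.div_rpow hl0 (by norm_num), hq, Real.rpow_sub two_pos, Real.rpow_one]; ring
      have hL : (t k - t i) ^ p ≤ (ℓ / 2) ^ p :=
        Real.rpow_le_rpow (by linarith) (by linarith) (by linarith)
      have hR : (t j - t (k+1)) ^ p ≤ (ℓ / 2) ^ p :=
        Real.rpow_le_rpow (by linarith) (by linarith) (by linarith)
      have hB : (t j - t k) ^ p ≤ ℓ ^ p :=
        Real.rpow_le_rpow (by linarith) (by linarith) (by linarith)
      have hlp : 0 ≤ ℓ ^ p := Real.rpow_nonneg hl0 _
      refine (((L.add R).sub A).sub B).congr ?_ ?_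
      · rw [← Finset.sum_Ico_consecutive _ hik hkj.le, Finset.sum_eq_sum_Ico_succ_bot hkj]
        abel
      · have hD : 0 ≤ 2 / (1 - q) * K := by positivity
        calc _ ≤ 2 / (1 - q) * K * (ℓ/2) ^ p + 2 / (1 - q) * K * (ℓ/2) ^ p + K * ℓ ^ p + K * ℓ ^ p := by
              gcongr
          _ = 2 / (1 - q) * K * ((ℓ/2) ^ p * 2) + 2 * K * ℓ ^ p := by ring
          _ = 2 / (1 - q) * K * ℓ ^ p := by
              rw [half]; field_simp; ring
  exact fun i j => main (j - i) i j le_rfl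

/-- Bundled rough path bounds on `[0,T]`, `T ≤ 1`. -/
structure RB (α CX T : ℝ) (X : ℝ → ℝ) (X2 : ℝ → ℝ → ℝ) : Prop where
  one : 1 ≤ CX
  Tle : T ≤ 1
  x1 : ∀ s t, 0 ≤ s → s ≤ t → t ≤ T → |X t - X s| ≤ CX * (t - s) ^ α
  x2 : ∀ s t, 0 ≤ s → s ≤ t → t ≤ T → |X2 s t| ≤ CX * (t - s) ^ (2 * α)
  chen : ∀ s u t, 0 ≤ s → s ≤ u → u ≤ t → t ≤ T →
    X2 s t - X2 s u - X2 u t = (X u - X s) * (X t - X u)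

/-- bounds on integrands -/
structure IB (𝓑 : BanachScale) (α σ γ : ℝ) (X : ℝ → ℝ) (p q : ℝ) (g g' : ℝ → 𝓑.E) (k K : ℝ) :
    Prop where
  kK : k ≤ K
  g0 : ∀ t, p ≤ t → t ≤ q → Bd (γ - σ) (g t) K
  g1 : ∀ t, p ≤ t → t ≤ q → Bd (γ - α - σ) (g' t) k
  g2 : ∀ s t, p ≤ s → s < t → t ≤ q → Bd (γ - 2 * α - σ) (g' t - g' s) (K * (t - s) ^ α)
  gr : ∀ s t, p ≤ s → s < t → t ≤ q →
    Bd (γ - 2 * α - σ) (g t - g s - (X t - X s) • g' s) (K * (t - s) ^ (2 * α))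

lemma IB.restrict {𝓑 : BanachScale} {α σ γ : ℝ} {X : ℝ → ℝ} {p q p' q' : ℝ} {g g' : ℝ → 𝓑.E}
    {k K : ℝ} (h : IB 𝓑 α σ γ X p q g g' k K) (hp : p ≤ p') (hq : q' ≤ q) :
    IB 𝓑 α σ γ X p' q' g g' k K :=
  ⟨h.kK, fun t h1 h2 => h.g0 t (hp.trans h1) (h2.trans hq),
    fun t h1 h2 => h.g1 t (hp.trans h1) (h2.trans hq),
    fun s t h1 h2 h3 => h.g2 s t (hp.trans h1) h2 (h3.trans hq),
    fun s t h1 h2 h3 => h.gr s t (hp.trans h1) h2 (h3.trans hq)⟩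

/-- the germ -/
def germ {𝓑 : BanachScale} (X : ℝ → ℝ) (X2 : ℝ → ℝ → ℝ) (g g' : ℝ → 𝓑.E) (s t : ℝ) : 𝓑.E :=
  (X t - X s) • g s + X2 s t • g' s

def IsSew {𝓑 : BanachScale} (Sg : ScaleSemigroup 𝓑) (α σ γ : ℝ) (X : ℝ → ℝ) (X2 : ℝ → ℝ → ℝ)
    (p q : ℝ) (g g' v : ℝ → 𝓑.E) (C : ℝ) : Prop :=
  ∀ s t, p ≤ s → s < t → t ≤ q →
    Bd (γ - 2 * α - σ) (v t - Sg.S (t - s) (v s) - Sg.S (t - s) (germ X X2 g g' s t))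
      (C * (t - s) ^ (3 * α))

section
variable {𝓑 : BanachScale} (Sg : ScaleSemigroup 𝓑) {α σ γ : ℝ}

lemma RB.x2_self {α CX T : ℝ} {X : ℝ → ℝ} {X2 : ℝ → ℝ → ℝ} (h : RB α CX T X X2) (hα : 0 < α)
    {t : ℝ} (h0 : 0 ≤ t) (h1 : t ≤ T) : X2 t t = 0 := by
  have := h.x2 t t h0 le_rfl h1
  rw [sub_self, Real.zero_rpow (by positivity), mul_zero] at this
  exact abs_nonpos_iff.1 this

lemma germ_self {α CX T : ℝ} {X : ℝ → ℝ} {X2 : ℝ → ℝ → ℝ} (h : RB α CX T X X2) (hα : 0 < α)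
    (g g' : ℝ → 𝓑.E) {t : ℝ} (h0 : 0 ≤ t) (h1 : t ≤ T) : germ X X2 g g' t t = 0 := by
  simp [germ, h.x2_self hα h0 h1]

lemma germ_delta (hα : 1/3 < α) (hα' : α < 1/2) {CX : ℝ} (hCX : 1 ≤ CX) :
    ∃ C ≥ (1:ℝ), ∀ (T : ℝ) (X : ℝ → ℝ) (X2 : ℝ → ℝ → ℝ) (p q : ℝ) (g g' : ℝ → 𝓑.E) (k K : ℝ),
      RB α CX T X X2 → 0 ≤ p → q ≤ T → IB 𝓑 α σ γ X p q g g' k K →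
      ∀ u v w, p ≤ u → u ≤ v → v ≤ w → w ≤ q →
      Bd (γ - 2 * α - σ) (Sg.S (v - u) (germ X X2 g g' u w - germ X X2 g g' u v) - germ X X2 g g' v w)
        (C * K * (w - u) ^ (3 * α)) := by
  obtain ⟨C1, hC1, H1⟩ := sg_hold Sg (γ - 2 * α - σ) (γ - σ) (by linarith) (by linarith)
  obtain ⟨C2, hC2, H2⟩ := sg_hold Sg (γ - 2 * α - σ) (γ - α - σ) (by linarith) (by linarith)
  refine ⟨CX * C1 + 2 * CX * C2 + 2 * CX, by nlinarith, ?_⟩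
  intro T X X2 p q g g' k K hX hp hq hI u v w hu huv hvw hw
  have hT := hX.Tle
  have hg := hI.g0 u hu (by linarith)
  have hg' := hI.g1 u hu (by linarith)
  have hK := hg.nonneg
  rcases (huv.trans hvw).eq_or_lt with huw | huw
  · have e1 : u = v := by linarith
    have e2 : v = w := by linarith
    subst e1; subst e2
    rw [germ_self hX (by linarith) g g' (by linarith) (by linarith)]
    simp only [sub_self, map_zero]
    exact Bd.zero (by have : (0:ℝ) ≤ 0 ^ (3 * α) := Real.rpow_nonneg le_rfl _
                      positivity)
  set ℓ := w - u with hl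
  have hl0 : 0 < ℓ := by linarith
  have pw : ∀ x : ℝ, 0 ≤ x → x ≤ ℓ → ∀ z : ℝ, 0 ≤ z → x ^ z ≤ ℓ ^ z := fun x h0 h1 z hz =>
    Real.rpow_le_rpow h0 h1 hz
  have e3 : ℓ ^ (3 * α) = ℓ ^ (2 * α) * ℓ ^ α := by rw [← Real.rpow_add hl0]; congr 1; ring
  have P1 := Real.rpow_pos_of_pos hl0 α
  have P2 := Real.rpow_pos_of_pos hl0 (2 * α)
  -- coefficients
  have c1 : |X w - X v| ≤ CX * ℓ ^ α := (hX.x1 v w (by linarith) hvw (by linarith)).trans (by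
    exact mul_le_mul_of_nonneg_left (pw _ (by linarith) (by linarith) _ (by linarith)) (by linarith))
  have c2 : |X2 v w| ≤ CX * ℓ ^ (2 * α) := (hX.x2 v w (by linarith) hvw (by linarith)).trans (by
    exact mul_le_mul_of_nonneg_left (pw _ (by linarith) (by linarith) _ (by linarith)) (by linarith))
  have c3 : |X2 u w - X2 u v| ≤ 2 * CX * ℓ ^ (2 * α) := by
    have a1 := hX.x2 u w (by linarith) (by linarith) (by linarith)
    have a2 : |X2 u v| ≤ CX * ℓ ^ (2 * α) := (hX.x2 u v (by linarith) huv (by linarith)).trans (by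
      exact mul_le_mul_of_nonneg_left (pw _ (by linarith) (by linarith) _ (by linarith)) (by linarith))
    have := abs_sub (X2 u w) (X2 u v)
    linarith
  have ch := hX.chen u v w (by linarith) huv hvw (by linarith)
  -- the four terms
  have t1 := (H1 (v - u) (g u) K (by linarith) (by linarith) hg).smul c1
  have t2 := (H2 (v - u) (g' u) k (by linarith) (by linarith) hg').smul c3
  have r1 : Bd (γ - 2 * α - σ) (g v - g u - (X v - X u) • g' u) (K * ℓ ^ (2 * α)) := by
    rcases huv.eq_or_lt with h | h
    · subst h; simp only [sub_self, zero_smul]; exact Bd.zero (by positivity)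
    · refine (hI.gr u v hu h (by linarith)).mono ?_
      exact mul_le_mul_of_nonneg_left (pw _ (by linarith) (by linarith) _ (by linarith)) (by linarith)
  have r2 : Bd (γ - 2 * α - σ) (g' v - g' u) (K * ℓ ^ α) := by
    rcases huv.eq_or_lt with h | h
    · subst h; simp only [sub_self]; exact Bd.zero (by positivity)
    · refine (hI.g2 u v hu h (by linarith)).mono ?_
      exact mul_le_mul_of_nonneg_left (pw _ (by linarith) (by linarith) _ (by linarith)) (by linarith)
  have t3 := r1.smul c1
  have t4 := r2.smul c2
  refine (((t1.add t2).sub t3).sub t4).congr ?_ ?_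
  · have ch' : X2 u w = X2 u v + X2 v w + (X v - X u) * (X w - X v) := by linarith
    simp only [germ, map_sub, map_add, map_smul]
    rw [ch']
    module
  · have hk0 := hg'.nonneg
    have hk := hI.kK
    have b1 : (v - u) ^ (γ - σ - (γ - 2 * α - σ)) ≤ ℓ ^ (2 * α) := by
      rw [show γ - σ - (γ - 2 * α - σ) = 2 * α by ring]
      exact pw _ (by linarith) (by linarith) _ (by linarith)
    have b2 : (v - u) ^ (γ - α - σ - (γ - 2 * α - σ)) ≤ ℓ ^ α := by
      rw [show γ - α - σ - (γ - 2 * α - σ) = α by ring]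
      exact pw _ (by linarith) (by linarith) _ (by linarith)
    calc _ ≤ CX * ℓ ^ α * (C1 * ℓ ^ (2 * α) * K) + 2 * CX * ℓ ^ (2 * α) * (C2 * ℓ ^ α * K)
          + CX * ℓ ^ α * (K * ℓ ^ (2 * α)) + CX * ℓ ^ (2 * α) * (K * ℓ ^ α) := by gcongr
      _ = _ := by rw [e3]; ring
end

lemma sum_double {M : Type*} [AddCommMonoid M] (f : ℕ → M) (n : ℕ) :
    ∑ i ∈ Finset.range (2 * n), f i = ∑ i ∈ Finset.range n, (f (2 * i) + f (2 * i + 1)) := by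
  induction n with
  | zero => simp
  | succ n ih =>
    rw [show 2 * (n + 1) = 2 * n + 1 + 1 by ring, Finset.sum_range_succ, Finset.sum_range_succ, ih,
      Finset.sum_range_succ, add_assoc]

/-- an abstract germ on `[p,q]` compatible with the semigroup -/
structure AGerm {𝓑 : BanachScale} (Sg : ScaleSemigroup 𝓑) (θ z p q K : ℝ)
    (Ξ : ℝ → ℝ → ℝ → 𝓑.E) : Prop where
  z1 : 1 < z
  qle : q ≤ p + 1
  K0 : 0 ≤ K
  diag : ∀ t u, p ≤ u → u ≤ t → t ≤ q → Ξ t u u = 0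
  comp : ∀ t s u v, p ≤ u → u ≤ v → v ≤ s → s ≤ t → t ≤ q → Sg.S (t - s) (Ξ s u v) = Ξ t u v
  del : ∀ t u v w, p ≤ u → u ≤ v → v ≤ w → w ≤ t → t ≤ q →
    Bd θ (Ξ t u w - Ξ t u v - Ξ t v w) (K * (w - u) ^ z)

/-- dyadic grid -/
noncomputable def tau (p : ℝ) (n k : ℕ) : ℝ := p + k / 2 ^ n

lemma tau_mono (p : ℝ) (n : ℕ) : Monotone (tau p n) := fun a b h => by
  unfold tau
  have : (a : ℝ) ≤ b := by exact_mod_cast h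
  gcongr

lemma tau_zero (p : ℝ) (n : ℕ) : tau p n 0 = p := by simp [tau]
lemma tau_last (p : ℝ) (n : ℕ) : tau p n (2 ^ n) = p + 1 := by simp [tau]
lemma tau_double (p : ℝ) (n k : ℕ) : tau p (n+1) (2 * k) = tau p n k := by
  simp only [tau, pow_succ]; push_cast; field_simp
lemma tau_succ (p : ℝ) (n k : ℕ) : tau p n (k+1) = tau p n k + (1/2) ^ n := by
  simp only [tau]; push_cast; rw [one_div, inv_pow]; field_simp; ring

lemma pow_aux (z : ℝ) (n : ℕ) : (2:ℝ) ^ n * ((1/2:ℝ) ^ n) ^ z = ((2:ℝ) ^ (1 - z)) ^ n := by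
  have e1 : ((1/2:ℝ) ^ n) ^ z = ((2:ℝ) ^ (-z)) ^ n := by
    rw [← Real.rpow_natCast, ← Real.rpow_natCast, ← Real.rpow_mul (by norm_num),
      ← Real.rpow_mul (by norm_num), one_div, Real.inv_rpow (by norm_num),
      ← Real.rpow_neg (by norm_num)]
    congr 1; ring
  rw [e1, ← mul_pow]
  congr 1
  rw [sub_eq_add_neg, Real.rpow_add two_pos, Real.rpow_one]

section
variable {𝓑 : BanachScale} (Sg : ScaleSemigroup 𝓑)

lemma sew_abs {θ z p q K : ℝ} {Ξ : ℝ → ℝ → ℝ → 𝓑.E} (h : AGerm Sg θ z p q K Ξ) :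
    ∃ v : ℝ → 𝓑.E, v p = 0 ∧ ∀ s t, p ≤ s → s < t → t ≤ q →
      Bd θ (v t - Sg.S (t - s) (v s) - Ξ t s t) (2 / (1 - 2 ^ (1 - z)) * K * (t - s) ^ z) := by
  classical
  have hz := h.z1
  have hqle := h.qle
  have hK := h.K0
  have h2 : (2:ℝ) ^ (1 - z) < 1 := Real.rpow_lt_one_of_one_lt_of_neg one_lt_two (by linarith)
  have h20 : (0:ℝ) < (2:ℝ) ^ (1 - z) := Real.rpow_pos_of_pos two_pos _
  set r : ℝ := 2 ^ (1 - z) with hr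
  let a : ℕ → ℝ → ℕ → ℝ := fun n t k => min (tau p n k) t
  have ap : ∀ n t k, p ≤ t → p ≤ a n t k := fun n t k ht => by
    refine le_min ?_ ht
    simp only [tau]; have : (0:ℝ) ≤ k / 2 ^ n := by positivity
    linarith
  have amono : ∀ n t, Monotone (a n t) := fun n t i j hij => min_le_min (tau_mono p n hij) le_rfl
  have astep : ∀ n t k, a n t (k+1) - a n t k ≤ (1/2)^n := by
    intro n t k
    simp only [a, tau_succ]
    have : (0:ℝ) ≤ (1/2)^n := by positivity
    rcases le_total (tau p n k) t with h1 | h1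
    · rw [min_eq_left h1]; have := min_le_left (tau p n k + (1/2)^n) t; linarith
    · rw [min_eq_right h1]; have := min_le_right (tau p n k + (1/2)^n) t; linarith
  let Z : ℝ → ℕ → 𝓑.E := fun t n => ∑ k ∈ Finset.range (2 ^ n), Ξ t (a n t k) (a n t (k+1))
  -- consecutive differences
  have hcons : ∀ t, p ≤ t → t ≤ q → ∀ n, Bd θ (Z t (n+1) - Z t n) (K * r ^ n) := by
    intro t ht htq n
    have e : Z t n - Z t (n+1) = ∑ k ∈ Finset.range (2 ^ n),
        (Ξ t (a (n+1) t (2*k)) (a (n+1) t (2*k+2)) - Ξ t (a (n+1) t (2*k)) (a (n+1) t (2*k+1))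
          - Ξ t (a (n+1) t (2*k+1)) (a (n+1) t (2*k+2))) := by
      simp only [Z]
      rw [show 2 ^ (n+1) = 2 * 2 ^ n by ring, sum_double, ← Finset.sum_sub_distrib]
      refine Finset.sum_congr rfl fun k _ => ?_
      have e1 : a n t k = a (n+1) t (2*k) := by simp only [a, tau_double]
      have e2 : a n t (k+1) = a (n+1) t (2*k+2) := by
        simp only [a]; rw [show 2 * k + 2 = 2 * (k+1) by ring, tau_double]
      rw [e1, e2]; abel
    refine Bd.symm ?_
    rw [e]
    refine (Bd.sum _ _ (fun _ => K * ((1/2)^n) ^ z) fun k _ => ?_).congr rfl ?_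
    · refine (h.del t _ _ _ (ap _ _ _ ht) (amono _ _ (by omega)) (amono _ _ (by omega))
        (min_le_right _ _) htq).mono ?_
      refine mul_le_mul_of_nonneg_left (Real.rpow_le_rpow ?_ ?_ (by linarith)) hK
      · have := amono (n+1) t (show 2*k ≤ 2*k+2 by omega); linarith
      · have e1 : a n t k = a (n+1) t (2*k) := by simp only [a, tau_double]
        have e2 : a n t (k+1) = a (n+1) t (2*k+2) := by
          simp only [a]; rw [show 2 * k + 2 = 2 * (k+1) by ring, tau_double]
        rw [← e1, ← e2]; exact astep n t k
    · rw [Finset.sum_const, Finset.card_range, nsmul_eq_mul, ← pow_aux]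
      push_cast; apply le_of_eq; ring
  have hlim : ∀ t, ∃ l, (t = p → l = 0) ∧ (p ≤ t → t ≤ q → ∀ n, Bd θ (l - Z t n) (K * r ^ n / (1 - r))) := by
    intro t
    by_cases ht : p ≤ t ∧ t ≤ q
    · by_cases htp : t = p
      · refine ⟨0, fun _ => rfl, fun _ _ n => ?_⟩
        have : Z t n = 0 := by
          refine Finset.sum_eq_zero fun k _ => ?_
          have : ∀ k, a n t k = p := fun k => le_antisymm (by rw [← htp]; exact min_le_right _ _) (ap n t k ht.1)
          rw [this, this]; exact h.diag _ _ le_rfl ht.1 ht.2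
        rw [this, sub_zero]
        exact Bd.zero (div_nonneg (by positivity) (by linarith))
      · obtain ⟨l, hl⟩ := bd_geom (Z t) h20.le h2 (hcons t ht.1 ht.2)
        exact ⟨l, fun h => absurd h htp, fun _ _ => hl⟩
    · exact ⟨0, fun _ => rfl, fun h1 h2 => absurd ⟨h1, h2⟩ ht⟩
  choose v hv0 hv using hlim
  refine ⟨v, hv0 p rfl, fun s t hs hst ht => ?_⟩
  obtain ⟨CS, hCS, HS⟩ := sg_bdd Sg θ
  refine Bd.lim fun ε hε => ?_
  have htend : Filter.Tendsto (fun n : ℕ => (K / (1 - r) + CS * (K / (1 - r)) + K) * r ^ n) Filter.atTop (nhds 0) := by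
    simpa using (tendsto_pow_atTop_nhds_zero_of_lt_one h20.le h2).const_mul (K / (1 - r) + CS * (K / (1 - r)) + K)
  obtain ⟨n, hn⟩ := (htend.eventually (ge_mem_nhds hε)).exists
  let b : ℕ → ℝ := fun k => max s (a n t k)
  have bmono : Monotone b := fun i j hij => max_le_max le_rfl (amono n t hij)
  have bs : ∀ k, s ≤ b k := fun k => le_max_left _ _
  have bt : ∀ k, b k ≤ t := fun k => max_le hst.le (min_le_right _ _)
  have hsew := sew_seq (θ := θ) (K := K) hz (Ξ t) b bmono (2 ^ n)
    (fun i _ => h.diag _ _ (hs.trans (bs i)) (bt i) ht) hK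
    (fun i j k hij hjk _ => h.del t _ _ _ (hs.trans (bs i)) (bmono hij) (bmono hjk) (bt k) ht)
    0 (2 ^ n) (Nat.zero_le _) le_rfl
  have b0 : b 0 = s := by
    simp only [b, a, tau_zero]; rw [min_eq_left (by linarith), max_eq_left hs]
  have bN : b (2 ^ n) = t := by
    simp only [b, a, tau_last]; rw [min_eq_right (by linarith), max_eq_right hst.le]
  rw [b0, bN, ← Finset.range_eq_Ico] at hsew
  refine ⟨_, hsew, ?_⟩
  -- comparison
  have hcmp : Bd θ (Z t n - Sg.S (t - s) (Z s n) - ∑ k ∈ Finset.range (2 ^ n), Ξ t (b k) (b (k+1)))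
      (K * r ^ n) := by
    have e : Z t n - Sg.S (t - s) (Z s n) - ∑ k ∈ Finset.range (2 ^ n), Ξ t (b k) (b (k+1))
      = ∑ k ∈ Finset.range (2 ^ n), (Ξ t (a n t k) (a n t (k+1)) - Ξ t (a n s k) (a n s (k+1)) - Ξ t (b k) (b (k+1))) := by
      simp only [Z]
      rw [map_sum, Finset.sum_sub_distrib, Finset.sum_sub_distrib]
      congr 2
      refine Finset.sum_congr rfl fun k _ => ?_
      exact h.comp _ _ _ _ (ap _ _ _ hs) (amono _ _ (by omega)) (min_le_right _ _) hst.le ht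
    rw [e]
    refine (Bd.sum _ _ (fun _ => K * ((1/2)^n) ^ z) fun k _ => ?_).congr rfl ?_
    · have hpos : 0 ≤ K * ((1/2:ℝ)^n) ^ z := by positivity
      have as : ∀ k, a n s k = min (a n t k) s := fun k => by
        simp only [a]; rw [min_assoc, min_eq_right hst.le]
      have m := amono n t (show k ≤ k + 1 by omega)
      simp only [b, as]
      set x := a n t k
      have hy : a n t (k+1) - x ≤ (1/2)^n := astep n t k
      have hxt : x ≤ t := min_le_right _ _
      have hyt : a n t (k+1) ≤ t := min_le_right _ _
      have hpx : p ≤ x := ap _ _ _ (hs.trans hst.le)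
      set y := a n t (k+1)
      have hss := h.diag t s hs hst.le ht
      rcases le_total y s with h1 | h1
      · rw [min_eq_left h1, min_eq_left (m.trans h1), max_eq_left h1, max_eq_left (m.trans h1), hss]
        simpa using Bd.zero hpos
      · rcases le_total s x with h3 | h3
        · rw [min_eq_right h1, min_eq_right h3, max_eq_right h1, max_eq_right h3, hss]
          simpa using Bd.zero hpos
        · rw [min_eq_right h1, min_eq_left h3, max_eq_right h1, max_eq_left h3]
          refine (h.del t x s y hpx h3 h1 hyt ht).mono ?_
          exact mul_le_mul_of_nonneg_left (Real.rpow_le_rpow (by linarith) hy (by linarith)) hK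
    · rw [Finset.sum_const, Finset.card_range, nsmul_eq_mul, ← pow_aux]
      push_cast; apply le_of_eq; ring
  have A1 := hv t (by linarith) ht n
  have A2 := HS (t - s) _ _ (by linarith) (by linarith) (hv s hs (by linarith) n)
  refine ((A1.sub A2).add hcmp).congr ?_ ?_
  · rw [map_sub]; abel
  · refine le_trans (le_of_eq ?_) hn; ring

/-- any sewing path has the good constant -/
lemma sew_improve {θ z p q K C : ℝ} {Ξ : ℝ → ℝ → ℝ → 𝓑.E} (h : AGerm Sg θ z p q K Ξ)
    {v : ℝ → 𝓑.E} (hv : ∀ s t, p ≤ s → s < t → t ≤ q →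
      Bd θ (v t - Sg.S (t - s) (v s) - Ξ t s t) (C * (t - s) ^ z)) :
    ∀ s t, p ≤ s → s < t → t ≤ q →
      Bd θ (v t - Sg.S (t - s) (v s) - Ξ t s t) (2 / (1 - 2 ^ (1 - z)) * K * (t - s) ^ z) := by
  intro s t hs hst ht
  have hz := h.z1
  have hqle := h.qle
  have hK := h.K0
  have h2 : (2:ℝ) ^ (1 - z) < 1 := Real.rpow_lt_one_of_one_lt_of_neg one_lt_two (by linarith)
  have h20 : (0:ℝ) < (2:ℝ) ^ (1 - z) := Real.rpow_pos_of_pos two_pos _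
  set r : ℝ := 2 ^ (1 - z) with hr
  obtain ⟨CS, hCS, HS⟩ := sg_bdd Sg θ
  refine Bd.lim fun ε hε => ?_
  have htend : Filter.Tendsto (fun n : ℕ => (CS * |C|) * r ^ n) Filter.atTop (nhds 0) := by
    simpa using (tendsto_pow_atTop_nhds_zero_of_lt_one h20.le h2).const_mul (CS * |C|)
  obtain ⟨n, hn⟩ := (htend.eventually (ge_mem_nhds hε)).exists
  let b : ℕ → ℝ := fun k => min (tau s n k) t
  have bmono : Monotone b := fun i j hij => min_le_min (tau_mono s n hij) le_rfl
  have bs : ∀ k, s ≤ b k := fun k => by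
    refine le_min ?_ hst.le
    simp only [tau]; have : (0:ℝ) ≤ k / 2 ^ n := by positivity
    linarith
  have bt : ∀ k, b k ≤ t := fun k => min_le_right _ _
  have b0 : b 0 = s := by
    simp only [b, tau_zero]; rw [min_eq_left (by linarith)]
  have bN : b (2 ^ n) = t := by
    simp only [b, tau_last]; rw [min_eq_right (by linarith)]
  have bstep : ∀ k, b (k+1) - b k ≤ (1/2)^n := by
    intro k
    simp only [b, tau_succ]
    have : (0:ℝ) ≤ (1/2)^n := by positivity
    rcases le_total (tau s n k) t with h1 | h1
    · rw [min_eq_left h1]; have := min_le_left (tau s n k + (1/2)^n) t; linarith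
    · rw [min_eq_right h1]; have := min_le_right (tau s n k + (1/2)^n) t; linarith
  have hsew := sew_seq (θ := θ) (K := K) hz (Ξ t) b bmono (2 ^ n)
    (fun i _ => h.diag _ _ (hs.trans (bs i)) (bt i) ht) hK
    (fun i j k hij hjk _ => h.del t _ _ _ (hs.trans (bs i)) (bmono hij) (bmono hjk) (bt k) ht)
    0 (2 ^ n) (Nat.zero_le _) le_rfl
  rw [b0, bN, ← Finset.range_eq_Ico] at hsew
  refine ⟨_, hsew, ?_⟩
  have e : v t - Sg.S (t - s) (v s) - Ξ t s t
      - (∑ k ∈ Finset.range (2 ^ n), Ξ t (b k) (b (k+1)) - Ξ t s t)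
      = ∑ k ∈ Finset.range (2 ^ n), Sg.S (t - b (k+1)) (v (b (k+1)) - Sg.S (b (k+1) - b k) (v (b k)) - Ξ (b (k+1)) (b k) (b (k+1))) := by
    have tel := Finset.sum_range_sub (fun k => Sg.S (t - b k) (v (b k))) (2 ^ n)
    simp only [b0, bN, sub_self, Sg.S_id] at tel
    rw [← tel, sub_sub_sub_cancel_right, ← Finset.sum_sub_distrib]
    refine Finset.sum_congr rfl fun k _ => ?_
    rw [map_sub, map_sub, sg_add' Sg (bmono (by omega)) (bt _),
      h.comp _ _ _ _ (hs.trans (bs k)) (bmono (by omega)) le_rfl (bt _) ht]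
  rw [e]
  refine (Bd.sum _ _ (fun _ => CS * (|C| * ((1/2)^n) ^ z)) fun k _ => ?_).congr rfl ?_
  · refine HS _ _ _ (by linarith [bt (k+1)]) (by linarith [bs (k+1)]) ?_
    rcases (bmono (show k ≤ k+1 by omega)).eq_or_lt with h1 | h1
    · rw [← h1, sub_self, Sg.S_id, h.diag _ _ (hs.trans (bs k)) le_rfl ((bt _).trans ht)]
      simpa using Bd.zero (by positivity)
    · refine (hv _ _ (hs.trans (bs k)) h1 ((bt _).trans ht)).mono ?_
      have : (b (k+1) - b k)^z ≤ ((1/2)^n)^z :=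
        Real.rpow_le_rpow (by linarith) (bstep k) (by linarith)
      have h0 : 0 ≤ (b (k+1) - b k)^z := Real.rpow_nonneg (by linarith) _
      exact mul_le_mul (le_abs_self _) this h0 (abs_nonneg _)
  · rw [Finset.sum_const, Finset.card_range, nsmul_eq_mul]
    refine le_trans (le_of_eq ?_) hn
    rw [← pow_aux]; push_cast; ring
end

lemma RPartition.mono' {a b : ℝ} (π : RPartition a b) {i j : ℕ} (hij : i ≤ j) (hj : j ≤ π.n) :
    π.t i ≤ π.t j := by
  induction j, hij using Nat.le_induction with
  | base => exact le_rfl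
  | succ j hij ih => exact (ih (by omega)).trans (π.strict j (by omega)).le

lemma RPartition.ge {a b : ℝ} (π : RPartition a b) {i : ℕ} (hi : i ≤ π.n) : a ≤ π.t i := by
  have h := π.mono' (Nat.zero_le i) hi
  rwa [π.first] at h
lemma RPartition.le {a b : ℝ} (π : RPartition a b) {i : ℕ} (hi : i ≤ π.n) : π.t i ≤ b := by
  have h := π.mono' hi le_rfl
  rwa [π.last] at h

lemma RPartition.step_le {a b : ℝ} (π : RPartition a b) {i : ℕ} (hi : i < π.n) :
    π.t (i+1) - π.t i ≤ π.mesh := by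
  refine le_csSup ?_ ⟨i, hi, rfl⟩
  refine ⟨b - a, ?_⟩
  rintro r ⟨j, hj, rfl⟩
  have := π.ge (i := j) (by omega)
  have := π.le (i := j+1) (by omega)
  linarith

/-- uniform partition -/
lemma exists_partition {a b : ℝ} (hab : a < b) {δ : ℝ} (hδ : 0 < δ) :
    ∃ π : RPartition a b, π.mesh < δ := by
  obtain ⟨n, hn⟩ := exists_nat_gt ((b - a) / (δ/2))
  have hn0 : (0:ℝ) < n := lt_trans (by have : 0 < b - a := by linarith
                                       positivity) hn
  have hn' : 0 < n := by exact_mod_cast hn0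
  refine ⟨⟨n, fun i => a + i * ((b - a) / n), hn', fun i _ => ?_, by simp, by field_simp; ring⟩, ?_⟩
  · have : 0 < (b - a) / n := div_pos (by linarith) hn0
    push_cast; linarith
  · refine lt_of_le_of_lt (csSup_le (a := δ/2) ⟨_, 0, hn', rfl⟩ ?_) (by linarith)
    rintro r ⟨i, _, rfl⟩
    simp only
    push_cast
    have : (b - a) / n ≤ δ / 2 := by
      rw [div_lt_iff₀ (by positivity)] at hn
      rw [div_le_iff₀ hn0]; linarith
    linarith

lemma tele_aux {ν a b : ℝ} (h0 : 0 ≤ ν) (h1 : ν < 1) (hb : 0 ≤ b) (hab : b < a) :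
    (1 - ν) * (a ^ (-ν) * (a - b)) ≤ a ^ (1 - ν) - b ^ (1 - ν) := by
  have ha : 0 < a := by linarith
  have := rpow_one_add_le_one_add_mul_self (s := b / a - 1) (p := 1 - ν)
    (by have := div_nonneg hb ha.le; linarith) (by linarith) (by linarith)
  rw [show 1 + (b / a - 1) = b / a by ring, Real.div_rpow hb ha.le,
    div_le_iff₀ (Real.rpow_pos_of_pos ha _)] at this
  have e : a ^ (1 - ν) = a ^ (-ν) * a := by
    rw [sub_eq_add_neg, add_comm, Real.rpow_add ha, Real.rpow_one]
  have e2 : (1 + (1 - ν) * (b / a - 1)) * a ^ (1 - ν)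
      = a ^ (1-ν) - (1 - ν) * (a ^ (-ν) * (a - b)) := by
    rw [e]; field_simp; ring
  linarith

/-- half rule -/
lemma tele_half {ν a b x : ℝ} (h0 : 0 ≤ ν) (h1 : ν < 1) (hb : 0 ≤ b) (hab : b < a) (hx : a / 2 ≤ x) :
    x ^ (-ν) * (a - b) ≤ 2 / (1 - ν) * (a ^ (1 - ν) - b ^ (1 - ν)) := by
  have ha : 0 < a := by linarith
  have t := tele_aux h0 h1 hb hab
  have e : x ^ (-ν) ≤ 2 * a ^ (-ν) := by
    have e1 : x ^ (-ν) ≤ (a/2) ^ (-ν) :=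
      Real.rpow_le_rpow_of_nonpos (by linarith) hx (by linarith)
    have e2 : (a/2) ^ (-ν) = a ^ (-ν) * 2 ^ ν := by
      rw [Real.div_rpow ha.le (by norm_num), Real.rpow_neg two_pos.le, div_inv_eq_mul]
    have e3 : (2:ℝ) ^ ν ≤ 2 := by
      simpa using Real.rpow_le_rpow_of_exponent_le one_le_two h1.le
    have e4 : 0 < a ^ (-ν) := Real.rpow_pos_of_pos ha _
    nlinarith
  calc x ^ (-ν) * (a - b) ≤ 2 * a ^ (-ν) * (a - b) :=
        mul_le_mul_of_nonneg_right e (by linarith)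
    _ = 2 / (1 - ν) * ((1 - ν) * (a ^ (-ν) * (a - b))) := by
        have : 1 - ν ≠ 0 := by linarith
        field_simp
    _ ≤ _ := mul_le_mul_of_nonneg_left t (div_nonneg (by norm_num) (by linarith))

section
variable {𝓑 : BanachScale} (Sg : ScaleSemigroup 𝓑)

/-- telescoping of a path along a partition -/
lemma riemann_abs {θ0 θ : ℝ} (h1 : θ0 ≤ θ) (h2 : θ - θ0 < 1) :
    ∃ C ≥ (1:ℝ), ∀ (v : ℝ → 𝓑.E) (Ξ : ℝ → ℝ → 𝓑.E) (s t ω h : ℝ), t ≤ s + 1 → 0 ≤ ω →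
      (∀ u w, s ≤ u → u < w → w ≤ t → w - u ≤ h →
        Bd θ0 (v w - Sg.S (w - u) (v u) - Sg.S (w - u) (Ξ u w)) (ω * (w - u)) ∧
        Bd θ (v w - Sg.S (w - u) (v u) - Sg.S (w - u) (Ξ u w)) (ω * (w - u) ^ (1 - (θ - θ0)))) →
      ∀ π : RPartition s t, π.mesh ≤ h →
        Bd θ (∑ i ∈ Finset.range π.n, Sg.S (t - π.t i) (Ξ (π.t i) (π.t (i+1)))
          - (v t - Sg.S (t - s) (v s))) (C * ω) := by
  obtain ⟨C1, hC1, H1⟩ := sg_bdd Sg θ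
  obtain ⟨C2, hC2, H2⟩ := sg_smooth Sg θ0 θ h1 (by linarith)
  set ν := θ - θ0 with hν
  have hν0 : 0 ≤ ν := by linarith
  have hc : 1 ≤ 2 / (1 - ν) := by rw [le_div_iff₀ (by linarith)]; linarith
  refine ⟨(C1 + C2) * (2 / (1 - ν)), by nlinarith, fun v Ξ s t ω h ht hω hρ π hπ => ?_⟩
  have e : ∑ i ∈ Finset.range π.n, Sg.S (t - π.t i) (Ξ (π.t i) (π.t (i+1)))
      - (v t - Sg.S (t - s) (v s)) = - ∑ i ∈ Finset.range π.n, Sg.S (t - π.t (i+1))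
        (v (π.t (i+1)) - Sg.S (π.t (i+1) - π.t i) (v (π.t i)) - Sg.S (π.t (i+1) - π.t i) (Ξ (π.t i) (π.t (i+1)))) := by
    have tel := Finset.sum_range_sub (fun k => Sg.S (t - π.t k) (v (π.t k))) π.n
    simp only [π.first, π.last, sub_self, Sg.S_id] at tel
    rw [← tel, ← Finset.sum_sub_distrib, ← Finset.sum_neg_distrib]
    refine Finset.sum_congr rfl fun k hk => ?_
    rw [Finset.mem_range] at hk
    have := (π.strict k hk).le
    have := π.le (i := k+1) hk
    rw [map_sub, map_sub, sg_add' Sg (by assumption) (by assumption), sg_add' Sg (by assumption) (by assumption)]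
    abel
  rw [e]
  refine ((Bd.sum _ _ (fun i => (C1 + C2) * (2 / (1 - ν)) * ω * ((t - π.t i) ^ (1 - ν) - (t - π.t (i+1)) ^ (1 - ν))) fun k hk => ?_).neg).mono ?_
  · rw [Finset.mem_range] at hk
    have hst := (π.strict k hk)
    have hle := π.le (i := k+1) hk
    have hge := π.ge (i := k) hk.le
    have hst' := (π.step_le hk).trans hπ
    obtain ⟨r1, r2⟩ := hρ _ _ hge hst hle hst'
    set u := π.t k
    set w := π.t (k+1)
    set ρ := v w - Sg.S (w - u) (v u) - Sg.S (w - u) (Ξ u w)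
    have ea : t - u - (t - w) = w - u := by ring
    rcases le_total ((t - u) / 2) (t - w) with hh | hh
    · have tt := tele_half hν0 h2 (a := t - u) (b := t - w) (by linarith) (by linarith) hh
      rw [ea] at tt
      refine (H2 (t - w) ρ _ (by linarith) (by linarith) r1).mono ?_
      calc C2 * (t - w) ^ (-ν) * (ω * (w - u)) = C2 * ω * ((t - w) ^ (-ν) * (w - u)) := by ring
        _ ≤ C2 * ω * (2 / (1 - ν) * ((t - u) ^ (1 - ν) - (t - w) ^ (1 - ν))) :=
            mul_le_mul_of_nonneg_left tt (by positivity)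
        _ ≤ (C1 + C2) * ω * (2 / (1 - ν) * ((t - u) ^ (1 - ν) - (t - w) ^ (1 - ν))) := by
            have p1 : 0 ≤ (t - u) ^ (1 - ν) - (t - w) ^ (1 - ν) := by
              have := Real.rpow_le_rpow (z := 1 - ν) (show 0 ≤ t - w by linarith) (show t - w ≤ t - u by linarith) (by linarith)
              linarith
            have p2 : 0 ≤ 2 / (1 - ν) := by linarith
            gcongr; linarith
        _ = _ := by ring
    · have tt := tele_half hν0 h2 (a := t - u) (b := t - w) (x := w - u) (by linarith) (by linarith) (by linarith)
      rw [ea] at tt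
      have ew : (w - u) ^ (1 - ν) = (w - u) ^ (-ν) * (w - u) := by
        rw [sub_eq_add_neg 1, add_comm, Real.rpow_add (by linarith), Real.rpow_one]
      refine (H1 (t - w) ρ _ (by linarith) (by linarith) r2).mono ?_
      rw [ew]
      calc C1 * (ω * ((w - u) ^ (-ν) * (w - u))) = C1 * ω * ((w - u) ^ (-ν) * (w - u)) := by ring
        _ ≤ C1 * ω * (2 / (1 - ν) * ((t - u) ^ (1 - ν) - (t - w) ^ (1 - ν))) :=
            mul_le_mul_of_nonneg_left tt (by positivity)
        _ ≤ (C1 + C2) * ω * (2 / (1 - ν) * ((t - u) ^ (1 - ν) - (t - w) ^ (1 - ν))) := by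
            have p1 : 0 ≤ (t - u) ^ (1 - ν) - (t - w) ^ (1 - ν) := by
              have := Real.rpow_le_rpow (z := 1 - ν) (show 0 ≤ t - w by linarith) (show t - w ≤ t - u by linarith) (by linarith)
              linarith
            have p2 : 0 ≤ 2 / (1 - ν) := by linarith
            gcongr; linarith
        _ = _ := by ring
  · rw [← Finset.mul_sum, Finset.sum_range_sub' (fun i => (t - π.t i) ^ (1 - ν)), π.first, π.last,
      sub_self, Real.zero_rpow (by linarith), sub_zero]
    have hts : s ≤ t := by have := π.ge (i := π.n) le_rfl; rwa [π.last] at this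
    have : (t - s) ^ (1 - ν) ≤ 1 := Real.rpow_le_one (by linarith) (by linarith) (by linarith)
    exact mul_le_of_le_one_right (by positivity) this

/-- smoothing up along dyadic times approaching `t` -/
lemma smooth_up {θ0 θ ζ : ℝ} (h1 : θ0 ≤ θ) (hζ : 0 < ζ) :
    ∃ C ≥ (1:ℝ), ∀ (v : ℝ → 𝓑.E) (p q K K' ζ' : ℝ), 0 < ζ' →
      (∀ u w, p ≤ u → u < w → w ≤ q →
        Bd θ (Sg.S (w - u) (v w - Sg.S (w - u) (v u))) (K * (w - u) ^ ζ)) →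
      (∀ u w, p ≤ u → u < w → w ≤ q → Bd θ0 (v w - Sg.S (w - u) (v u)) (K' * (w - u) ^ ζ')) →
      ∀ s t, p ≤ s → s < t → t ≤ q → Bd θ (v t - Sg.S (t - s) (v s)) (C * K * (t - s) ^ ζ) := by
  have h2 : (1/2:ℝ) ^ ζ < 1 := Real.rpow_lt_one (by norm_num) (by norm_num) hζ
  have h20 : 0 < (1/2:ℝ) ^ ζ := Real.rpow_pos_of_pos (by norm_num) _
  set r := (1/2:ℝ) ^ ζ with hr
  have hr1 : 1 ≤ 1 / (1 - r) := by rw [le_div_iff₀ (by linarith)]; linarith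
  refine ⟨1 / (1 - r), hr1, fun v p q K K' ζ' hζ' hK hK' s t hs hst ht => ?_⟩
  set L := t - s with hL
  have hL0 : 0 < L := by linarith
  let R : ℕ → ℝ := fun n => t - L * (1/2) ^ n
  have hpos : ∀ n, 0 < L * (1/2:ℝ)^n := fun n => by positivity
  have hle : ∀ n, L * (1/2:ℝ)^n ≤ L := fun n =>
    mul_le_of_le_one_right hL0.le (pow_le_one₀ (by norm_num) (by norm_num))
  let A : ℕ → 𝓑.E := fun n => Sg.S (t - R n) (v (R n))
  have hstep : ∀ n, R (n+1) - R n = L * (1/2)^(n+1) := fun n => by simp only [R]; ring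
  have htR : ∀ n, t - R n = L * (1/2)^n := fun n => by simp only [R]; ring
  have hA : ∀ n, Bd θ (A (n+1) - A n) (K * L ^ ζ * r ^ n) := by
    intro n
    have b := hK (R n) (R (n+1)) (by simp only [R]; linarith [hle n]) (by linarith [hstep n, hpos (n+1)])
      (by simp only [R]; linarith [hpos (n+1)])
    have hK0 : 0 ≤ K := by
      have := b.nonneg
      rw [hstep] at this
      exact nonneg_of_mul_nonneg_left this (Real.rpow_pos_of_pos (hpos _) _)
    refine b.congr ?_ ?_
    · have e : t - R (n+1) = R (n+1) - R n := by rw [htR, hstep]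
      simp only [A]
      rw [map_sub, ← e, sg_add Sg (by rw [htR]; exact (hpos _).le) (by rw [htR]; exact (hpos _).le), e]
      congr 3
      rw [hstep, htR]; ring
    · rw [hstep, Real.mul_rpow hL0.le (by positivity), hr, ← Real.rpow_natCast, ← Real.rpow_natCast, ← Real.rpow_mul (by norm_num), ← Real.rpow_mul (by norm_num), mul_assoc]
      have : (1/2:ℝ) ^ ((n+1:ℕ) * ζ) ≤ (1/2) ^ (ζ * (n:ℕ)) := by
        apply Real.rpow_le_rpow_of_exponent_ge (by norm_num) (by norm_num)
        push_cast; nlinarith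
      have : 0 ≤ L ^ ζ := by positivity
      gcongr
  obtain ⟨l, hl⟩ := bd_geom A h20.le h2 hA
  have hlt : l = v t := by
    obtain ⟨CE, hCE, HE⟩ := bd_embed 𝓑 h1
    have : ∀ ε > 0, Bd θ0 (l - v t) ε := by
      intro ε hε
      have h2' : (1/2:ℝ) ^ ζ' < 1 := Real.rpow_lt_one (by norm_num) (by norm_num) hζ'
      have h20' : 0 < (1/2:ℝ) ^ ζ' := Real.rpow_pos_of_pos (by norm_num) _
      have l1 : Filter.Tendsto (fun n : ℕ => CE * (K * L ^ ζ * r ^ n / (1 - r)) + K' * L ^ ζ' * ((1/2) ^ ζ') ^ n) Filter.atTop (nhds 0) := by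
        have a1 := ((tendsto_pow_atTop_nhds_zero_of_lt_one h20.le h2).const_mul (CE * (K * L ^ ζ) / (1 - r)))
        have a2 := ((tendsto_pow_atTop_nhds_zero_of_lt_one h20'.le h2').const_mul (K' * L ^ ζ'))
        have a3 := a1.add a2
        simp only [mul_zero, add_zero] at a3
        refine a3.congr fun n => ?_
        ring
      obtain ⟨n, hn⟩ := (l1.eventually (ge_mem_nhds hε)).exists
      have b1 := HE _ _ (hl n)
      have b2 := hK' (R n) t (by simp only [R]; linarith [hle n]) (by simp only [R]; linarith [hpos n]) ht
      refine (b1.sub b2).congr ?_ (le_trans (le_of_eq ?_) hn)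
      · simp only [A]; abel
      · rw [htR, Real.mul_rpow hL0.le (by positivity)]
        have : ((1/2:ℝ) ^ n) ^ ζ' = ((1/2) ^ ζ') ^ n := by
          rw [← Real.rpow_natCast, ← Real.rpow_natCast, ← Real.rpow_mul (by norm_num), ← Real.rpow_mul (by norm_num)]
          congr 1; ring
        rw [this]; ring
    exact sub_eq_zero.1 (Bd.eq_zero this)
  have := hl 0
  have hR0 : R 0 = s := by simp [R, hL]
  simp only [A, hR0, hlt] at this
  refine this.congr rfl (le_of_eq ?_)
  rw [pow_zero]; ring
end

lemma rpow_le_exp {L x y : ℝ} (h0 : 0 < L) (h1 : L ≤ 1) (h : y ≤ x) : L ^ x ≤ L ^ y :=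
  Real.rpow_le_rpow_of_exponent_ge h0 h1 h

section
variable {𝓑 : BanachScale} (Sg : ScaleSemigroup 𝓑) {α σ γ : ℝ}

lemma IB.K0 {X : ℝ → ℝ} {p q : ℝ} {g g' : ℝ → 𝓑.E} {k K : ℝ} (h : IB 𝓑 α σ γ X p q g g' k K)
    (hpq : p ≤ q) : 0 ≤ K := (h.g0 p le_rfl hpq).nonneg

lemma germ_agerm (hα : 1/3 < α) (hα' : α < 1/2) {CX : ℝ} (hCX : 1 ≤ CX) :
    ∃ C ≥ (1:ℝ), ∀ (T : ℝ) (X : ℝ → ℝ) (X2 : ℝ → ℝ → ℝ) (p q : ℝ) (g g' : ℝ → 𝓑.E) (k K : ℝ),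
      RB α CX T X X2 → 0 ≤ p → p ≤ q → q ≤ T → IB 𝓑 α σ γ X p q g g' k K →
      AGerm Sg (γ - 2 * α - σ) (3 * α) p q (C * K)
        (fun t u v => Sg.S (t - u) (germ X X2 g g' u v)) := by
  obtain ⟨C1, hC1, H1⟩ := germ_delta (σ := σ) (γ := γ) Sg hα hα' hCX
  obtain ⟨C2, hC2, H2⟩ := sg_bdd Sg (γ - 2 * α - σ)
  refine ⟨C2 * C1, by nlinarith, fun T X X2 p q g g' k K hX hp hpq hq hI => ?_⟩
  have hT := hX.Tle
  refine ⟨by linarith, by linarith, ?_, ?_, ?_, ?_⟩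
  · have := hI.K0 hpq
    positivity
  · intro t u h1 h2 h3
    rw [germ_self hX (by linarith) g g' (by linarith) (by linarith), map_zero]
  · intro t s u v h1 h2 h3 h4 h5
    exact sg_add' Sg (by linarith) h4 _
  · intro t u v w h1 h2 h3 h4 h5
    have := H2 (t - v) _ _ (by linarith) (by linarith) (H1 T X X2 p q g g' k K hX hp hq hI u v w h1 h2 h3 (by linarith))
    refine this.congr ?_ (le_of_eq (by ring))
    rw [map_sub, map_sub, map_sub, sg_add' Sg h2 (by linarith), sg_add' Sg h2 (by linarith)]

lemma germ_bd (hα : 1/3 < α) (hα' : α < 1/2) (hσ : 0 ≤ σ) (hσα : σ < α) {CX : ℝ} (hCX : 1 ≤ CX) :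
    ∃ C ≥ (1:ℝ), ∀ (T : ℝ) (X : ℝ → ℝ) (X2 : ℝ → ℝ → ℝ) (p q : ℝ) (g g' : ℝ → 𝓑.E) (k K : ℝ),
      RB α CX T X X2 → 0 ≤ p → q ≤ T → IB 𝓑 α σ γ X p q g g' k K →
      ∀ s t, p ≤ s → s < t → t ≤ q →
      Bd γ (Sg.S (t - s) (germ X X2 g g' s t)) (C * K * (t - s) ^ (α - σ)) ∧
      Bd (γ - 2 * α - σ) (Sg.S (t - s) (germ X X2 g g' s t)) (C * K * (t - s) ^ α) ∧
      Bd (γ - α) (Sg.S (t - s) (germ X X2 g g' s t) - (X t - X s) • g s) (C * K * (t - s) ^ (2 * α - σ)) ∧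
      Bd (γ - 2 * α) (Sg.S (t - s) (germ X X2 g g' s t) - (X t - X s) • g s)
        (C * k * (t - s) ^ (2 * α) + C * K * (t - s) ^ (3 * α - σ)) := by
  obtain ⟨A1, hA1, H1⟩ := sg_smooth Sg (γ - σ) γ (by linarith) (by linarith)
  obtain ⟨A2, hA2, H2⟩ := sg_smooth Sg (γ - α - σ) γ (by linarith) (by linarith)
  obtain ⟨A3, hA3, H3⟩ := sg_bdd Sg (γ - 2 * α - σ)
  obtain ⟨A4, hA4, H4⟩ := bd_embed 𝓑 (show γ - 2 * α - σ ≤ γ - σ by linarith)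
  obtain ⟨A5, hA5, H5⟩ := bd_embed 𝓑 (show γ - 2 * α - σ ≤ γ - α - σ by linarith)
  obtain ⟨A6, hA6, H6⟩ := sg_hold Sg (γ - α) (γ - σ) (by linarith) (by linarith)
  obtain ⟨A7, hA7, H7⟩ := sg_hold Sg (γ - 2 * α) (γ - σ) (by linarith) (by linarith)
  obtain ⟨A8, hA8, H8⟩ := sg_smooth Sg (γ - α - σ) (γ - α) (by linarith) (by linarith)
  obtain ⟨A9, hA9, H9⟩ := sg_bdd Sg (γ - α - σ)
  obtain ⟨A10, hA10, H10⟩ := bd_embed 𝓑 (show γ - 2 * α ≤ γ - α - σ by linarith)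
  set C := A1 * CX + A2 * CX + A3 * A4 * CX + A3 * A5 * CX + A6 * CX + A7 * CX + A8 * CX + A9 * A10 * CX with hC
  have q1 : 1 ≤ A1 * CX := by nlinarith
  have q2 : 1 ≤ A2 * CX := by nlinarith
  have q3 : 1 ≤ A3 * A4 * CX := by nlinarith [mul_le_mul hA3 hA4 (by norm_num) (by linarith)]
  have q4 : 1 ≤ A3 * A5 * CX := by nlinarith [mul_le_mul hA3 hA5 (by norm_num) (by linarith)]
  have q6 : 1 ≤ A6 * CX := by nlinarith
  have q7 : 1 ≤ A7 * CX := by nlinarith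
  have q8 : 1 ≤ A8 * CX := by nlinarith
  have q9 : 1 ≤ A9 * A10 * CX := by nlinarith [mul_le_mul hA9 hA10 (by norm_num) (by linarith)]
  refine ⟨C, by linarith, ?_⟩
  intro T X X2 p q g g' k K hX hp hq hI s t hs hst ht
  have hT := hX.Tle
  set L := t - s with hL
  have hL0 : 0 < L := by linarith
  have hL1 : L ≤ 1 := by linarith
  have hg := hI.g0 s hs (by linarith)
  have hg' := hI.g1 s hs (by linarith)
  have hK := hg.nonneg
  have hk := hg'.nonneg
  have hkK := hI.kK
  have c1 := hX.x1 s t (by linarith) hst.le (by linarith)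
  have c2 := hX.x2 s t (by linarith) hst.le (by linarith)
  rw [← hL] at c1 c2
  have eS : Sg.S L (germ X X2 g g' s t) = (X t - X s) • Sg.S L (g s) + X2 s t • Sg.S L (g' s) := by
    simp only [germ, map_add, map_smul]
  have eD : Sg.S L (germ X X2 g g' s t) - (X t - X s) • g s = (X t - X s) • (Sg.S L (g s) - g s) + X2 s t • Sg.S L (g' s) := by
    rw [eS, smul_sub]; abel
  have ea := fun a b => Real.rpow_add hL0 a b
  have pp := fun a => Real.rpow_pos_of_pos hL0 a
  refine ⟨?_, ?_, ?_, ?_⟩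
  · rw [eS]
    refine (((H1 L _ _ hL0 hL1 hg).smul c1).add ((H2 L _ _ hL0 hL1 hg').smul c2)).mono ?_
    have x1 : L ^ α * L ^ (-(γ - (γ - σ))) = L ^ (α - σ) := by rw [← ea]; congr 1; ring
    have x2 : L ^ (2 * α) * L ^ (-(γ - (γ - α - σ))) = L ^ (α - σ) := by rw [← ea]; congr 1; ring
    calc _ = A1 * CX * K * (L ^ α * L ^ (-(γ - (γ - σ)))) + A2 * CX * k * (L ^ (2 * α) * L ^ (-(γ - (γ - α - σ)))) := by ring
      _ ≤ A1 * CX * K * L ^ (α - σ) + A2 * CX * K * L ^ (α - σ) := by rw [x1, x2]; gcongr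
      _ = (A1 * CX + A2 * CX) * K * L ^ (α - σ) := by ring
      _ ≤ _ := by
        have := pp (α - σ)
        gcongr; linarith
  · rw [eS]
    refine (((H3 L _ _ hL0.le hL1 (H4 _ _ hg)).smul c1).add ((H3 L _ _ hL0.le hL1 (H5 _ _ hg')).smul c2)).mono ?_
    have x1 : L ^ (2 * α) ≤ L ^ α := rpow_le_exp hL0 hL1 (by linarith)
    calc _ = A3 * A4 * CX * K * L ^ α + A3 * A5 * CX * k * L ^ (2 * α) := by ring
      _ ≤ A3 * A4 * CX * K * L ^ α + A3 * A5 * CX * K * L ^ α := by gcongr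
      _ = (A3 * A4 * CX + A3 * A5 * CX) * K * L ^ α := by ring
      _ ≤ _ := by
        have := pp α
        gcongr; linarith
  · rw [eD]
    refine (((H6 L _ _ hL0.le hL1 hg).smul c1).add ((H8 L _ _ hL0 hL1 hg').smul c2)).mono ?_
    have x1 : L ^ α * L ^ (γ - σ - (γ - α)) = L ^ (2 * α - σ) := by rw [← ea]; congr 1; ring
    have x2 : L ^ (2 * α) * L ^ (-(γ - α - (γ - α - σ))) = L ^ (2 * α - σ) := by rw [← ea]; congr 1; ring
    calc _ = A6 * CX * K * (L ^ α * L ^ (γ - σ - (γ - α))) + A8 * CX * k * (L ^ (2 * α) * L ^ (-(γ - α - (γ - α - σ)))) := by ring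
      _ ≤ A6 * CX * K * L ^ (2 * α - σ) + A8 * CX * K * L ^ (2 * α - σ) := by rw [x1, x2]; gcongr
      _ = (A6 * CX + A8 * CX) * K * L ^ (2 * α - σ) := by ring
      _ ≤ _ := by
        have := pp (2 * α - σ)
        gcongr; linarith
  · rw [eD]
    refine (((H7 L _ _ hL0.le hL1 hg).smul c1).add ((H10 _ _ (H9 L _ _ hL0.le hL1 hg')).smul c2)).mono ?_
    have x1 : L ^ α * L ^ (γ - σ - (γ - 2 * α)) = L ^ (3 * α - σ) := by rw [← ea]; congr 1; ring
    have h1 := pp (2 * α)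
    have h2 := pp (3 * α - σ)
    calc _ = A7 * CX * K * (L ^ α * L ^ (γ - σ - (γ - 2 * α))) + A9 * A10 * CX * k * L ^ (2 * α) := by ring
      _ = A9 * A10 * CX * k * L ^ (2 * α) + A7 * CX * K * L ^ (3 * α - σ) := by rw [x1, add_comm]
      _ ≤ _ := by
        gcongr <;> linarith

/-- main facts on rough convolutions -/
lemma rough_main (hα : 1/3 < α) (hα' : α < 1/2) (hσ : 0 ≤ σ) (hσα : σ < α) {CX : ℝ} (hCX : 1 ≤ CX) :
    ∃ C ≥ (1:ℝ), ∀ (T : ℝ) (X : ℝ → ℝ) (X2 : ℝ → ℝ → ℝ) (p q : ℝ) (g g' : ℝ → 𝓑.E) (k K : ℝ),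
      RB α CX T X X2 → 0 ≤ p → p ≤ q → q ≤ T → IB 𝓑 α σ γ X p q g g' k K →
      (∃ v, v p = 0 ∧ IsSew Sg α σ γ X X2 p q g g' v (C * K)) ∧
      ∀ v C', IsSew Sg α σ γ X X2 p q g g' v C' → ∀ s t, p ≤ s → s < t → t ≤ q →
        Bd (γ - 2 * α - σ) (v t - Sg.S (t - s) (v s) - Sg.S (t - s) (germ X X2 g g' s t)) (C * K * (t - s) ^ (3 * α)) ∧
        Bd (γ - 2 * α) (v t - Sg.S (t - s) (v s) - Sg.S (t - s) (germ X X2 g g' s t)) (C * K * (t - s) ^ (3 * α - σ)) ∧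
        Bd γ (v t - Sg.S (t - s) (v s)) (C * K * (t - s) ^ (α - σ)) ∧
        Bd (γ - α) (v t - Sg.S (t - s) (v s) - (X t - X s) • g s) (C * K * (t - s) ^ (2 * α - σ)) ∧
        Bd (γ - 2 * α) (v t - Sg.S (t - s) (v s) - (X t - X s) • g s)
          (C * k * (t - s) ^ (2 * α) + C * K * (t - s) ^ (3 * α - σ)) := by
  obtain ⟨A1, hA1, H1⟩ := germ_agerm (σ := σ) (γ := γ) Sg hα hα' hCX
  obtain ⟨A2, hA2, H2⟩ := germ_bd (γ := γ) Sg hα hα' hσ hσα hCX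
  obtain ⟨A3, hA3, H3⟩ := sg_smooth Sg (γ - 2 * α - σ) γ (by linarith) (by linarith)
  obtain ⟨A4, hA4, H4⟩ := sg_bdd Sg γ
  obtain ⟨A5, hA5, H5⟩ := smooth_up Sg (θ0 := γ - 2 * α - σ) (θ := γ) (ζ := α - σ) (by linarith) (by linarith)
  obtain ⟨A6, hA6, H6⟩ := bd_interp 𝓑 (show γ - 2 * α - σ < γ - α by linarith) (show γ - α < γ by linarith)
  obtain ⟨A7, hA7, H7⟩ : ∃ C ≥ (1:ℝ), ∀ (x : 𝓑.E) K L, 0 < L → L ≤ 1 → Bd (γ - 2 * α - σ) x (K * L ^ (3 * α)) → Bd γ x (K * L ^ (α - σ)) → Bd (γ - 2 * α) x (C * (K * L ^ (3 * α - σ))) := by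
    rcases hσ.eq_or_lt with rfl | hσ'
    · refine ⟨1, le_rfl, fun x K L h0 h1 hx _ => ?_⟩
      simpa using hx
    · obtain ⟨C, hC, H⟩ := bd_interp 𝓑 (show γ - 2 * α - σ < γ - 2 * α by linarith) (show γ - 2 * α < γ by linarith)
      refine ⟨C, hC, fun x K L h0 h1 hx hx' => ?_⟩
      have := H x K L _ _ h0 hx hx'
      convert this using 4
      have : 2 * α + σ ≠ 0 := by linarith
      have e : γ - (γ - 2 * α - σ) = 2 * α + σ := by ring
      rw [e]; field_simp; ring
  set D := 2 / (1 - (2:ℝ) ^ (1 - 3 * α)) with hD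
  have h2 : (2:ℝ) ^ (1 - 3 * α) < 1 := Real.rpow_lt_one_of_one_lt_of_neg one_lt_two (by linarith)
  have h20 : (0:ℝ) < (2:ℝ) ^ (1 - 3 * α) := Real.rpow_pos_of_pos two_pos _
  have hD1 : 1 ≤ D := by rw [hD, le_div_iff₀ (by linarith)]; linarith
  set E1 := D * A1 with hE1
  have hE1' : 1 ≤ E1 := by nlinarith
  set E2 := A5 * (A4 * A2 + A3 * E1) with hE2
  have hE2a : 1 ≤ A4 * A2 + A3 * E1 := by nlinarith
  have hE2' : 1 ≤ E2 := by nlinarith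
  set E3 := E1 + E2 + A2 with hE3
  have hE3' : 1 ≤ E3 := by linarith
  have q6 : E3 ≤ A6 * E3 := by nlinarith
  have q7 : E3 ≤ A7 * E3 := by nlinarith
  refine ⟨A6 * E3 + A7 * E3 + A2, by linarith, ?_⟩
  intro T X X2 p q g g' k K hX hp hpq hq hI
  have hK := hI.K0 hpq
  have hG := H1 T X X2 p q g g' k K hX hp hpq hq hI
  have hT := hX.Tle
  constructor
  · obtain ⟨v, hv0, hv⟩ := sew_abs Sg hG
    refine ⟨v, hv0, fun s t h1 h2 h3 => (hv s t h1 h2 h3).mono ?_⟩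
    have : (0:ℝ) ≤ (t - s) ^ (3 * α) := Real.rpow_nonneg (by linarith) _
    rw [← hD, ← mul_assoc, ← hE1]
    gcongr; linarith
  intro v C' hv
  have hv1 : ∀ s t, p ≤ s → s < t → t ≤ q → Bd (γ - 2 * α - σ) (v t - Sg.S (t - s) (v s) - Sg.S (t - s) (germ X X2 g g' s t)) (E1 * K * (t - s) ^ (3 * α)) := by
    intro s t h1 h2 h3
    refine (sew_improve Sg hG hv s t h1 h2 h3).congr rfl (le_of_eq ?_)
    rw [hE1]; ring
  have hGB := H2 T X X2 p q g g' k K hX hp hq hI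
  have hm : ∀ s t, p ≤ s → s < t → t ≤ q → Bd γ (v t - Sg.S (t - s) (v s)) (E2 * K * (t - s) ^ (α - σ)) := by
    intro s t h1 h2 h3
    refine (H5 v p q ((A4 * A2 + A3 * E1) * K) ((A2 + E1) * K) α (by linarith) ?_ ?_ s t h1 h2 h3).congr rfl (le_of_eq ?_)
    · intro u w k1 k2 k3
      have hL0 : 0 < w - u := by linarith
      have a1 := H4 (w - u) _ _ hL0.le (by linarith) (hGB u w k1 k2 k3).1
      have a2 := H3 (w - u) _ _ hL0 (by linarith) (hv1 u w k1 k2 k3)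
      refine (a1.add a2).congr (by rw [← map_add]; congr 1; abel) (le_of_eq ?_)
      have : (w - u) ^ (-(γ - (γ - 2 * α - σ))) * (w - u) ^ (3 * α) = (w - u) ^ (α - σ) := by
        rw [← Real.rpow_add hL0]; congr 1; ring
      calc _ = A4 * A2 * K * (w - u) ^ (α - σ) + A3 * E1 * K * ((w - u) ^ (-(γ - (γ - 2 * α - σ))) * (w - u) ^ (3 * α)) := by ring
        _ = _ := by rw [this]; ring
    · intro u w k1 k2 k3
      have hL0 : 0 < w - u := by linarith
      refine ((hGB u w k1 k2 k3).2.1.add (hv1 u w k1 k2 k3)).congr (by abel) ?_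
      have : (w - u) ^ (3 * α) ≤ (w - u) ^ α := rpow_le_exp hL0 (by linarith) (by linarith)
      calc _ ≤ A2 * K * (w - u) ^ α + E1 * K * (w - u) ^ α := by gcongr
        _ = _ := by ring
    · rw [hE2]; ring
  intro s t h1 h2 h3
  have hL0 : 0 < t - s := by linarith
  have hL1 : t - s ≤ 1 := by linarith
  have pp := fun a => Real.rpow_pos_of_pos hL0 a
  have g4 := hGB s t h1 h2 h3
  set L := t - s with hL
  have hmst := hm s t h1 h2 h3
  have hρ := hv1 s t h1 h2 h3
  rw [← hL] at hmst hρ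
  set ρ := v t - Sg.S L (v s) - Sg.S L (germ X X2 g g' s t) with hρdef
  have ρ3 : Bd (γ - 2 * α - σ) ρ (E3 * K * L ^ (3 * α)) := hρ.mono (by
    have := pp (3 * α)
    gcongr; linarith)
  have ρ0 : Bd γ ρ (E3 * K * L ^ (α - σ)) := (hmst.sub g4.1).mono (by
    have := pp (α - σ)
    have : 0 ≤ E1 * K * L ^ (α - σ) := by positivity
    rw [hE3]; linarith)
  have ρ1 : Bd (γ - α) ρ (A6 * E3 * K * L ^ (2 * α - σ)) := by
    have := H6 _ _ _ _ _ hL0 ρ3 ρ0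
    convert this using 1
    rw [show A6 * E3 * K * L ^ (2 * α - σ) = A6 * (E3 * K * L ^ (2 * α - σ)) by ring]
    congr 3
    have : 2 * α + σ ≠ 0 := by linarith
    rw [show γ - (γ - 2 * α - σ) = 2 * α + σ by ring]; field_simp; ring
  have ρ2 : Bd (γ - 2 * α) ρ (A7 * E3 * K * L ^ (3 * α - σ)) := (H7 _ _ _ hL0 hL1 ρ3 ρ0).congr rfl (le_of_eq (by ring))
  refine ⟨ρ3.mono ?_, ρ2.mono ?_, hmst.mono ?_, (g4.2.2.1.add ρ1).congr (by rw [hρdef]; abel) ?_, (g4.2.2.2.add ρ2).congr (by rw [hρdef]; abel) ?_⟩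
  · have := pp (3 * α)
    gcongr; linarith
  · have := pp (3 * α - σ)
    gcongr; linarith
  · have := pp (α - σ)
    gcongr; linarith
  · have := pp (2 * α - σ)
    have : 0 ≤ A7 * E3 * K * L ^ (2 * α - σ) := by positivity
    linarith
  · have := pp (2 * α)
    have := pp (3 * α - σ)
    have hk : 0 ≤ k := (hI.g1 s h1 (by linarith)).nonneg
    have : 0 ≤ A6 * E3 * K * L ^ (3 * α - σ) := by positivity
    have : 0 ≤ A6 * E3 * k * L ^ (2 * α) := by positivity
    have : 0 ≤ A7 * E3 * k * L ^ (2 * α) := by positivity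
    linarith

lemma rough_conv (hα : 1/3 < α) (hα' : α < 1/2) (hσ : 0 ≤ σ) (hσα : σ < α) {CX : ℝ} (hCX : 1 ≤ CX)
    {T : ℝ} {X : ℝ → ℝ} {X2 : ℝ → ℝ → ℝ} {q : ℝ} {g g' : ℝ → 𝓑.E} {k K : ℝ}
    (hX : RB α CX T X X2) (hqT : q ≤ T) (hI : IB 𝓑 α σ γ X 0 q g g' k K) {v : ℝ → 𝓑.E} {C' : ℝ}
    (hv0 : v 0 = 0) (hv : IsSew Sg α σ γ X X2 0 q g g' v C') {t : ℝ} (ht : 0 < t) (htq : t ≤ q) :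
    IsRoughConvolution 𝓑 Sg X X2 g g' (γ - 2 * α) 0 t (v t) := by
  obtain ⟨A, hA, H⟩ := rough_main (γ := γ) Sg hα hα' hσ hσα hCX
  have H' := (H T X X2 0 q g g' k K hX le_rfl (by linarith) hqT hI).2 v C' hv
  obtain ⟨B, hB, HB⟩ := riemann_abs Sg (show γ - 2 * α - σ ≤ γ - 2 * α by linarith) (by linarith)
  have hK := hI.K0 (by linarith)
  have hT := hX.Tle
  refine ⟨𝓑.mem_mono (show γ - 2 * α ≤ γ by linarith) _ ?_, ?_⟩
  · have := (H' 0 t le_rfl ht htq).2.2.1.1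
    simpa [hv0] using this
  intro ε hε
  have hcont : Filter.Tendsto (fun h : ℝ => B * (A * K * h ^ (3 * α - 1))) (nhdsWithin 0 (Ioi 0)) (nhds 0) := by
    have h1 : Filter.Tendsto (fun h : ℝ => h ^ (3 * α - 1)) (nhdsWithin 0 (Ioi 0)) (nhds 0) := by
      have := (Real.continuousAt_rpow_const 0 (3 * α - 1) (Or.inr (by linarith))).tendsto
      rw [Real.zero_rpow (by linarith)] at this
      exact this.mono_left nhdsWithin_le_nhds
    simpa using (h1.const_mul (A * K)).const_mul B
  obtain ⟨h, hh, hh0⟩ := ((hcont.eventually (ge_mem_nhds hε)).and self_mem_nhdsWithin).exists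
  have hh0' : 0 < h := hh0
  refine ⟨h, hh0, fun π hπ => ?_⟩
  have := HB v (germ X X2 g g') 0 t (A * K * h ^ (3 * α - 1)) h (by linarith) (by positivity) ?_ π hπ.le
  · rw [hv0, map_zero, sub_zero] at this
    exact this.2.trans hh
  · intro u w h1 h2 h3 h4
    have b := H' u w h1 h2 (by linarith)
    have hL0 : 0 < w - u := by linarith
    have e : (w - u) ^ (3 * α - 1) ≤ h ^ (3 * α - 1) := Real.rpow_le_rpow hL0.le h4 (by linarith)
    refine ⟨b.1.mono ?_, b.2.1.mono ?_⟩
    · have e1 : (w - u) ^ (3 * α) = (w - u) ^ (3 * α - 1) * (w - u) := by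
        rw [← Real.rpow_add_one hL0.ne']; congr 1; ring
      rw [e1, ← mul_assoc]; gcongr
    · have e1 : (w - u) ^ (3 * α - σ) = (w - u) ^ (3 * α - 1) * (w - u) ^ (1 - (γ - 2 * α - (γ - 2 * α - σ))) := by
        rw [← Real.rpow_add hL0]; congr 1; ring
      have := Real.rpow_pos_of_pos hL0 (1 - (γ - 2 * α - (γ - 2 * α - σ)))
      rw [e1, ← mul_assoc]; gcongr

lemma rconv_unique {X : ℝ → ℝ} {X2 : ℝ → ℝ → ℝ} {g g' : ℝ → 𝓑.E} {θ a b : ℝ} (hab : a < b) {I J : 𝓑.E}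
    (hθ : ∀ π : RPartition a b, 𝓑.Mem θ (convRiemannSum 𝓑 Sg X X2 g g' π))
    (hI : IsRoughConvolution 𝓑 Sg X X2 g g' θ a b I) (hJ : IsRoughConvolution 𝓑 Sg X X2 g g' θ a b J) : I = J := by
  refine sub_eq_zero.1 (Bd.eq_zero (θ := θ) fun ε hε => ?_)
  obtain ⟨d1, hd1, h1⟩ := hI.2 (ε/2) (by linarith)
  obtain ⟨d2, hd2, h2⟩ := hJ.2 (ε/2) (by linarith)
  obtain ⟨π, hπ⟩ := exists_partition hab (lt_min hd1 hd2)
  have mI : Bd θ _ _ := ⟨((Bd.of_mem (hθ π)).sub (Bd.of_mem hI.1)).1, h1 π (hπ.trans_le (min_le_left _ _))⟩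
  have mJ : Bd θ _ _ := ⟨((Bd.of_mem (hθ π)).sub (Bd.of_mem hJ.1)).1, h2 π (hπ.trans_le (min_le_right _ _))⟩
  exact (mJ.sub mI).congr (by abel) (by linarith)

lemma rint_unique {f : ℝ → 𝓑.E} {θ a b : ℝ} (hab : a < b) {I J : 𝓑.E}
    (hθ : ∀ π : RPartition a b, 𝓑.Mem θ (intRiemannSum 𝓑 f π))
    (hI : IsRiemannIntegral 𝓑 θ f a b I) (hJ : IsRiemannIntegral 𝓑 θ f a b J) : I = J := by
  refine sub_eq_zero.1 (Bd.eq_zero (θ := θ) fun ε hε => ?_)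
  obtain ⟨d1, hd1, h1⟩ := hI.2 (ε/2) (by linarith)
  obtain ⟨d2, hd2, h2⟩ := hJ.2 (ε/2) (by linarith)
  obtain ⟨π, hπ⟩ := exists_partition hab (lt_min hd1 hd2)
  have mI : Bd θ _ _ := ⟨((Bd.of_mem (hθ π)).sub (Bd.of_mem hI.1)).1, h1 π (hπ.trans_le (min_le_left _ _))⟩
  have mJ : Bd θ _ _ := ⟨((Bd.of_mem (hθ π)).sub (Bd.of_mem hJ.1)).1, h2 π (hπ.trans_le (min_le_right _ _))⟩
  exact (mJ.sub mI).congr (by abel) (by linarith)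
end

section
variable {𝓑 : BanachScale} (Sg : ScaleSemigroup 𝓑)

/-- drift path -/
def IsDr (θ p q : ℝ) (f e : ℝ → 𝓑.E) : Prop :=
  ∀ ε > 0, ∃ h > 0, ∀ s t, p ≤ s → s < t → t ≤ q → t - s ≤ h →
    Bd θ (e t - Sg.S (t - s) (e s) - Sg.S (t - s) ((t - s) • f s)) (ε * (t - s))

/-- uniform continuity along the semigroup -/
def UCS (θ p q : ℝ) (f : ℝ → 𝓑.E) : Prop :=
  ∀ ε > 0, ∃ h > 0, ∀ s t, p ≤ s → s ≤ t → t ≤ q → t - s ≤ h →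
    Bd θ (f t - Sg.S (t - s) (f s)) ε

/-- continuity on an interval -/
def COn (θ p q : ℝ) (f : ℝ → 𝓑.E) : Prop :=
  (∀ t, p ≤ t → t ≤ q → 𝓑.Mem θ (f t)) ∧
  ∀ t, p ≤ t → t ≤ q → ∀ ε > (0:ℝ), ∃ δ > (0:ℝ), ∀ s, p ≤ s → s ≤ q →
    |s - t| < δ → 𝓑.N θ (f s - f t) < ε

/-- typed extension -/
noncomputable def text {θ p q : ℝ} {f : ℝ → 𝓑.E} (hf : COn θ p q f) (hpq : p ≤ q) (r : ℝ) : 𝓑.sub θ :=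
  ⟨f (max p (min r q)), hf.1 _ (le_max_left _ _) (max_le hpq (min_le_right _ _))⟩

lemma text_cont {θ p q : ℝ} {f : ℝ → 𝓑.E} (hf : COn θ p q f) (hpq : p ≤ q) :
    Continuous (text hf hpq) := by
  rw [Metric.continuous_iff]
  intro t ε hε
  have hcl : Continuous (fun r : ℝ => max p (min r q)) := by fun_prop
  obtain ⟨d, hd, h⟩ := hf.2 (max p (min t q)) (le_max_left _ _) (max_le hpq (min_le_right _ _)) ε hε
  obtain ⟨d', hd', h'⟩ := Metric.continuous_iff.1 hcl t d hd
  refine ⟨d', hd', fun s hs => ?_⟩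
  rw [dist_eq_norm, BanachScale.norm_def]
  exact h _ (le_max_left _ _) (max_le hpq (min_le_right _ _)) (by simpa [Real.dist_eq] using h' s hs)

lemma text_val {θ p q : ℝ} {f : ℝ → 𝓑.E} (hf : COn θ p q f) (hpq : p ≤ q) {r : ℝ} (h1 : p ≤ r) (h2 : r ≤ q) :
    (text hf hpq r).1 = f r := by
  simp only [text, min_eq_left h2, max_eq_right h1]

/-- uniform small-time bound on orbits -/
lemma sg_unif {θ p q : ℝ} {f : ℝ → 𝓑.E} (hf : COn θ p q f) (hpq : p ≤ q) {ε : ℝ} (hε : 0 < ε) :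
    ∃ h > 0, h ≤ 1 ∧ ∀ s t, p ≤ s → s ≤ q → 0 ≤ t → t < h → Bd θ (Sg.S t (f s) - f s) ε := by
  obtain ⟨C, hC, H⟩ := sg_bdd Sg θ
  have hK : IsCompact (text hf hpq '' Icc p q) := isCompact_Icc.image (text_cont hf hpq)
  have hr : 0 < ε / (4 * C) := by positivity
  obtain ⟨t, hfin, hcov⟩ := Metric.totallyBounded_iff.1 hK.totallyBounded (ε / (4 * C)) hr
  have hx : ∀ x : 𝓑.sub θ, ∃ h > 0, h ≤ 1 ∧ ∀ t, 0 ≤ t → t < h → Bd θ (Sg.S t x.1 - x.1) (ε / 4) := by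
    intro x
    obtain ⟨d, hd, h⟩ := Sg.S_strong_cont θ x.1 x.2 (ε/4) (by linarith)
    refine ⟨min d 1, by positivity, min_le_right _ _, fun t h0 h1 => ?_⟩
    rcases h0.eq_or_lt with rfl | h0
    · rw [Sg.S_id, sub_self]; exact Bd.zero (by linarith)
    · exact ⟨((Bd.of_mem (Sg.S_mem t θ _ h0.le x.2)).sub (Bd.of_mem x.2)).1, (h t h0 (h1.trans_le (min_le_left _ _))).le⟩
  choose d hd hd1 hd2 using hx
  obtain ⟨h, hh, hh1⟩ : ∃ h > 0, h ≤ 1 ∧ ∀ x ∈ t, h ≤ d x := by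
    clear hcov
    induction t, hfin using Set.Finite.induction_on with
    | empty => exact ⟨1, one_pos, le_rfl, fun x hx => absurd hx (by simp)⟩
    | insert _ _ ih =>
      obtain ⟨h, h0, h1, h2⟩ := ih
      rename_i a s _ _
      refine ⟨min h (d a), lt_min h0 (hd a), (min_le_left _ _).trans h1, ?_⟩
      rintro x (rfl | hx)
      · exact min_le_right _ _
      · exact (min_le_left _ _).trans (h2 x hx)
  refine ⟨h, hh, hh1.1, fun s τ h1 h2 h3 h4 => ?_⟩
  have hs := hcov ⟨s, ⟨h1, h2⟩, rfl⟩
  simp only [mem_iUnion, Metric.mem_ball, dist_eq_norm] at hs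
  obtain ⟨x, hxt, hx⟩ := hs
  have b1 : Bd θ (f s - x.1) (ε / (4 * C)) := by
    have := (BanachScale.bd_iff _ θ _ _).2 hx.le
    rwa [show (text hf hpq s - x).1 = (text hf hpq s).1 - x.1 from rfl, text_val hf hpq h1 h2] at this
  have b2 := H τ _ _ h3 (by linarith [hh1.1]) b1
  have b3 := hd2 x τ h3 (h4.trans_le (hh1.2 x hxt))
  refine ((b2.add b3).sub b1).congr (by rw [map_sub]; abel) ?_
  have e : C * (ε / (4 * C)) = ε / 4 := by field_simp
  have : ε / (4 * C) ≤ ε / 4 := by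
    rw [div_le_div_iff_of_pos_left hε (by positivity) (by positivity)]; linarith
  linarith

lemma ucs_of_con {θ p q : ℝ} {f : ℝ → 𝓑.E} (hf : COn θ p q f) (hpq : p ≤ q) : UCS Sg θ p q f := by
  intro ε hε
  obtain ⟨h1, hh1, _, H1⟩ := sg_unif Sg hf hpq (half_pos hε)
  have hu := isCompact_Icc.uniformContinuousOn_of_continuous (text_cont hf hpq).continuousOn (s := Icc p q)
  rw [Metric.uniformContinuousOn_iff] at hu
  obtain ⟨h2, hh2, H2⟩ := hu (ε/2) (half_pos hε)
  have hm : 0 < min h1 h2 := lt_min hh1 hh2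
  refine ⟨min h1 h2 / 2, half_pos hm, fun s t k1 k2 k3 k4 => ?_⟩
  have b1 := H1 s (t - s) k1 (k2.trans k3) (by linarith) (by linarith [min_le_left h1 h2])
  have b2 := H2 t ⟨k1.trans k2, k3⟩ s ⟨k1, k2.trans k3⟩ (by
    rw [Real.dist_eq, abs_of_nonneg (by linarith)]; linarith [min_le_right h1 h2])
  rw [dist_eq_norm] at b2
  have b3 := (BanachScale.bd_iff _ θ _ _).2 b2.le
  rw [show (text hf hpq t - text hf hpq s).1 = (text hf hpq t).1 - (text hf hpq s).1 from rfl,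
    text_val hf hpq (k1.trans k2) k3, text_val hf hpq k1 (k2.trans k3)] at b3
  exact (b3.sub b1).congr (by abel) (by linarith)

/-- semigroup as a bounded operator -/
noncomputable def SC (θ : ℝ) (t : ℝ) (ht : 0 ≤ t) (ht1 : t ≤ 1) : 𝓑.sub θ →L[ℝ] 𝓑.sub θ :=
  LinearMap.mkContinuous
    ({ toFun := fun x => ⟨Sg.S t x.1, Sg.S_mem t θ x.1 ht x.2⟩
       map_add' := fun x y => Subtype.ext (map_add _ _ _)
       map_smul' := fun c x => Subtype.ext (map_smul _ _ _) } : 𝓑.sub θ →ₗ[ℝ] 𝓑.sub θ)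
    (sg_bdd Sg θ).choose (fun x => by
      have := (sg_bdd Sg θ).choose_spec.2 t x.1 _ ht ht1 (Bd.of_mem x.2)
      exact this.2)

lemma SC_val (θ t : ℝ) (ht : 0 ≤ t) (ht1 : t ≤ 1) (x : 𝓑.sub θ) : (SC Sg θ t ht ht1 x).1 = Sg.S t x.1 := rfl

/-- clamp into the unit interval -/
noncomputable def cl (x : ℝ) : ℝ := max 0 (min x 1)
lemma cl0 (x : ℝ) : 0 ≤ cl x := le_max_left _ _
lemma cl1 (x : ℝ) : cl x ≤ 1 := max_le zero_le_one (min_le_right _ _)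
lemma cl_val {x : ℝ} (h0 : 0 ≤ x) (h1 : x ≤ 1) : cl x = x := by
  simp only [cl, min_eq_left h1, max_eq_right h0]

lemma orbit_cont (θ : ℝ) (x : 𝓑.sub θ) : Continuous fun t => SC Sg θ (cl t) (cl0 t) (cl1 t) x := by
  obtain ⟨C, hC, H⟩ := sg_bdd Sg θ
  rw [Metric.continuous_iff]
  intro t ε hε
  have hcl : Continuous cl := by unfold cl; fun_prop
  obtain ⟨d, hd, h⟩ := Sg.S_strong_cont θ x.1 x.2 (ε/(2*C)) (by positivity)
  obtain ⟨d', hd', h'⟩ := Metric.continuous_iff.1 hcl t d hd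
  have key : ∀ a b, 0 ≤ a → a ≤ b → b ≤ 1 → b - a < d → Bd θ (Sg.S b x.1 - Sg.S a x.1) (ε/2) := by
    intro a b h0 h1 h2 h3
    rcases h1.eq_or_lt with rfl | h1
    · rw [sub_self]; exact Bd.zero (by linarith)
    have b1 : Bd θ (Sg.S (b - a) x.1 - x.1) (ε/(2*C)) :=
      ⟨((Bd.of_mem (Sg.S_mem (b - a) θ _ (by linarith) x.2)).sub (Bd.of_mem x.2)).1, (h (b-a) (by linarith) h3).le⟩
    refine (H a _ _ h0 (by linarith) b1).congr ?_ (le_of_eq (by field_simp))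
    rw [map_sub, sg_add Sg h0 (by linarith)]; congr 3; ring
  refine ⟨d', hd', fun s hs => ?_⟩
  have h1 := h' s hs
  rw [Real.dist_eq] at h1
  rw [dist_eq_norm]
  refine lt_of_le_of_lt ((BanachScale.bd_iff _ θ _ (ε/2)).1 ?_) (by linarith)
  change Bd θ (Sg.S (cl s) x.1 - Sg.S (cl t) x.1) (ε/2)
  rcases le_total (cl s) (cl t) with h2 | h2
  · exact (key _ _ (cl0 s) h2 (cl1 t) (by rw [abs_sub_comm] at h1; exact lt_of_abs_lt h1)).symm
  · exact key _ _ (cl0 t) h2 (cl1 s) (lt_of_abs_lt h1)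

lemma orbit_cont2 {θ : ℝ} {φ : ℝ → 𝓑.sub θ} (hφ : Continuous φ) (t : ℝ) :
    Continuous fun r => SC Sg θ (cl (t - r)) (cl0 _) (cl1 _) (φ r) := by
  obtain ⟨C, hC, H⟩ := sg_bdd Sg θ
  rw [Metric.continuous_iff]
  intro r ε hε
  obtain ⟨d1, hd1, h1⟩ := Metric.continuous_iff.1 hφ r (ε/(2*C)) (by positivity)
  obtain ⟨d2, hd2, h2⟩ := Metric.continuous_iff.1 ((orbit_cont Sg θ (φ r)).comp (continuous_const.sub continuous_id : Continuous fun r => t - r)) r (ε/2) (by linarith)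
  refine ⟨min d1 d2, lt_min hd1 hd2, fun s hs => ?_⟩
  have a1 := h1 s (hs.trans_le (min_le_left _ _))
  have a2 := h2 s (hs.trans_le (min_le_right _ _))
  rw [dist_eq_norm] at a1
  have b1 := H (cl (t - s)) _ _ (cl0 _) (cl1 _) ((BanachScale.bd_iff _ θ _ _).2 a1.le)
  have b2 : dist (SC Sg θ (cl (t - s)) (cl0 _) (cl1 _) (φ s)) (SC Sg θ (cl (t - s)) (cl0 _) (cl1 _) (φ r)) ≤ ε/2 := by
    rw [dist_eq_norm, ← map_sub]
    refine (BanachScale.bd_iff _ θ _ _).1 (Bd.mono b1 (le_of_eq (by field_simp)))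
  have a3 : dist (SC Sg θ (cl (t - s)) (cl0 _) (cl1 _) (φ r)) (SC Sg θ (cl (t - r)) (cl0 _) (cl1 _) (φ r)) < ε/2 := a2
  exact lt_of_le_of_lt (dist_triangle _ _ _) (by linarith)

lemma drift_exist {θ p q : ℝ} {f : ℝ → 𝓑.E} (hf : COn θ p q f) (hpq : p ≤ q) (hq : q ≤ p + 1) :
    ∃ e : ℝ → 𝓑.E, e p = 0 ∧ IsDr Sg θ p q f e := by
  obtain ⟨C, hC, H⟩ := sg_bdd Sg θ
  let φ := text hf hpq
  have hφ : Continuous φ := text_cont hf hpq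
  let Φ : ℝ → ℝ → 𝓑.sub θ := fun t r => SC Sg θ (cl (t - r)) (cl0 _) (cl1 _) (φ r)
  have hΦ : ∀ t, Continuous (Φ t) := fun t => orbit_cont2 Sg hφ t
  have hintg : ∀ t a b, IntervalIntegrable (Φ t) MeasureTheory.volume a b := fun t a b =>
    (hΦ t).intervalIntegrable a b
  refine ⟨fun t => (∫ r in p..t, Φ t r : 𝓑.sub θ).1, by simp, ?_⟩
  intro ε hε
  obtain ⟨h, hh, HH⟩ := ucs_of_con Sg hf hpq (ε / C) (by positivity)
  refine ⟨h, hh, fun s t h1 h2 h3 h4 => ?_⟩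
  have e1 : Sg.S (t - s) (∫ r in p..s, Φ s r : 𝓑.sub θ).1 = (∫ r in p..s, Φ t r : 𝓑.sub θ).1 := by
    rw [← SC_val Sg θ (t - s) (by linarith) (by linarith), ← ContinuousLinearMap.intervalIntegral_comp_comm _ (hintg s p s)]
    congr 1
    refine intervalIntegral.integral_congr fun r hr => ?_
    rw [uIcc_of_le h1] at hr
    refine Subtype.ext ?_
    simp only [Φ, SC_val]
    rw [cl_val (by linarith [hr.2]) (by linarith [hr.1]), cl_val (by linarith [hr.2]) (by linarith [hr.1]),
      sg_add' Sg hr.2 h2.le]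
  let c : 𝓑.sub θ := SC Sg θ (t - s) (by linarith) (by linarith) (φ s)
  have hc : Sg.S (t - s) ((t - s) • f s) = ((t - s) • c : 𝓑.sub θ).1 := by
    rw [map_smul]
    change _ = (t - s) • c.1
    rw [SC_val, text_val hf hpq h1 (by linarith)]
  have e2 : (∫ r in p..t, Φ t r) - (∫ r in p..s, Φ t r) - (t - s) • c = ∫ r in s..t, (Φ t r - c) := by
    rw [intervalIntegral.integral_sub (hintg t s t) intervalIntegrable_const, intervalIntegral.integral_const,
      intervalIntegral.integral_interval_sub_left (hintg t p t) (hintg t p s)]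
  simp only [e1, hc]
  change Bd θ (((∫ r in p..t, Φ t r) - (∫ r in p..s, Φ t r) - (t - s) • c : 𝓑.sub θ)).1 _
  rw [BanachScale.bd_iff, e2]
  have := intervalIntegral.norm_integral_le_of_norm_le_const (a := s) (b := t) (f := fun r => Φ t r - c) (C := ε) ?_
  · rwa [abs_of_nonneg (by linarith)] at this
  intro r hr
  rw [uIoc_of_le h2.le] at hr
  rw [← BanachScale.bd_iff]
  refine (H (t - r) _ _ (by linarith [hr.2]) (by linarith [hr.1]) (HH s r h1 hr.1.le (hr.2.trans h3) (by linarith [hr.2]))).congr ?_ (le_of_eq (by field_simp))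
  change (Φ t r).1 - c.1 = _
  simp only [Φ, c, SC_val]
  rw [cl_val (by linarith [hr.2]) (by linarith [hr.1]), text_val hf hpq (by linarith [hr.1]) (by linarith [hr.2]),
    text_val hf hpq h1 (by linarith), map_sub, sg_add' Sg hr.1.le hr.2]

lemma dr_bd0 (θ : ℝ) : ∃ C ≥ (1:ℝ), ∀ (p q K : ℝ) (f e : ℝ → 𝓑.E), q ≤ p + 1 →
    (∀ t, p ≤ t → t ≤ q → Bd θ (f t) K) → IsDr Sg θ p q f e →
    ∀ s t, p ≤ s → s < t → t ≤ q → Bd θ (e t - Sg.S (t - s) (e s)) (C * K * (t - s)) := by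
  obtain ⟨C, hC, H⟩ := sg_bdd Sg θ
  obtain ⟨A, hA, HA⟩ := riemann_abs Sg (le_refl θ) (by linarith)
  refine ⟨C, hC, fun p q K f e hq hf he s t hs hst ht => Bd.lim fun ε hε => ?_⟩
  obtain ⟨h, hh, Hh⟩ := he (ε / A) (by positivity)
  obtain ⟨π, hπ⟩ := exists_partition hst hh
  refine ⟨_, ?_, (HA e (fun u w => (w - u) • f u) s t (ε / A) h (by linarith) (by positivity) (fun u w k1 k2 k3 k4 => ?_) π hπ.le).symm.congr rfl (le_of_eq (by field_simp))⟩
  · refine (Bd.sum _ _ (fun i => C * K * (π.t (i+1) - π.t i)) fun i hi => ?_).congr rfl ?_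
    · rw [Finset.mem_range] at hi
      have g1 := π.ge hi.le
      have g2 := π.le hi.le
      have g3 := π.strict i hi
      refine (H (t - π.t i) _ _ (by linarith) (by linarith) ((hf (π.t i) (by linarith) (by linarith)).smul (le_of_eq (abs_of_nonneg (by linarith))))).mono (le_of_eq (by ring))
    · rw [← Finset.mul_sum, Finset.sum_range_sub, π.first, π.last]
  · have := Hh u w (by linarith) k2 (by linarith) k4
    exact ⟨this, by simpa using this⟩

lemma dr_up {θ0 θ : ℝ} (h1 : θ0 ≤ θ) (h2 : θ - θ0 < 1) : ∃ C ≥ (1:ℝ), ∀ (p q K : ℝ) (f e : ℝ → 𝓑.E), q ≤ p + 1 →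
    (∀ t, p ≤ t → t ≤ q → Bd θ0 (f t) K) → IsDr Sg θ0 p q f e →
    ∀ s t, p ≤ s → s < t → t ≤ q → Bd θ (e t - Sg.S (t - s) (e s)) (C * K * (t - s) ^ (1 - (θ - θ0))) := by
  obtain ⟨A, hA, HA⟩ := dr_bd0 Sg θ0
  obtain ⟨B, hB, HB⟩ := sg_smooth Sg θ0 θ h1 (by linarith)
  obtain ⟨D, hD, HD⟩ := smooth_up Sg h1 (ζ := 1 - (θ - θ0)) (by linarith)
  have hBA : 1 ≤ B * A := by nlinarith
  refine ⟨D * (B * A), by nlinarith, fun p q K f e hq hf he s t hs hst ht => ?_⟩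
  have b0 := HA p q K f e hq hf he
  refine (HD e p q (B * A * K) (A * K) 1 one_pos ?_ ?_ s t hs hst ht).congr rfl (le_of_eq (by ring))
  · intro u w k1 k2 k3
    have hL : 0 < w - u := by linarith
    refine (HB (w - u) _ _ hL (by linarith) (b0 u w k1 k2 k3)).mono (le_of_eq ?_)
    have : (w - u) ^ (1 - (θ - θ0)) = (w - u) ^ (-(θ - θ0)) * (w - u) := by
      rw [← Real.rpow_add_one hL.ne']; congr 1; ring
    rw [this]; ring
  · intro u w k1 k2 k3
    simpa using b0 u w k1 k2 k3

lemma dr_bd {γ δ η x : ℝ} (hδ : 0 ≤ δ) (hδ' : δ < 1) (hx : 0 ≤ x) (h1 : η ≤ 1 - δ) (h2 : x + η ≤ 1) :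
    ∃ C ≥ (1:ℝ), ∀ (p q K : ℝ) (f e : ℝ → 𝓑.E), q ≤ p + 1 →
    (∀ t, p ≤ t → t ≤ q → Bd (γ - δ) (f t) K) → IsDr Sg (γ - δ) p q f e →
    ∀ s t, p ≤ s → s < t → t ≤ q → Bd (γ - x) (e t - Sg.S (t - s) (e s)) (C * K * (t - s) ^ (x + η)) := by
  rcases le_total x δ with h | h
  · obtain ⟨C, hC, H⟩ := dr_up Sg (show γ - δ ≤ γ - x by linarith) (by linarith)
    refine ⟨C, hC, fun p q K f e hq hf he s t hs hst ht => (H p q K f e hq hf he s t hs hst ht).mono ?_⟩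
    have := (hf s hs (by linarith)).nonneg
    exact mul_le_mul_of_nonneg_left (rpow_le_exp (by linarith) (by linarith) (by linarith)) (by positivity)
  · obtain ⟨C, hC, H⟩ := dr_bd0 Sg (γ - δ)
    obtain ⟨A, hA, HA⟩ := bd_embed 𝓑 (show γ - x ≤ γ - δ by linarith)
    refine ⟨A * C, by nlinarith, fun p q K f e hq hf he s t hs hst ht => (HA _ _ (H p q K f e hq hf he s t hs hst ht)).mono ?_⟩
    have := (hf s hs (by linarith)).nonneg
    have := rpow_le_exp (L := t - s) (by linarith) (by linarith) h2
    rw [Real.rpow_one] at this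
    calc _ = A * C * K * (t - s) := by ring
      _ ≤ _ := mul_le_mul_of_nonneg_left this (by positivity)

lemma dr_riemann {γ δ : ℝ} (hδ : 0 ≤ δ) (hδ' : δ < 1) {p q : ℝ} {f e : ℝ → 𝓑.E} (hq : q ≤ p + 1)
    (hf : UCS Sg (γ - δ) p q f) (he : IsDr Sg (γ - δ) p q f e) (he0 : e p = 0) (hm : ∀ t, p ≤ t → t ≤ q → 𝓑.Mem (γ - δ) (f t))
    {t : ℝ} (ht : p < t) (htq : t ≤ q) :
    IsRiemannIntegral 𝓑 γ (fun s => Sg.S (t - s) (f s)) p t (e t) := by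
  obtain ⟨C, hC, H⟩ := dr_up Sg (show γ - δ ≤ γ by linarith) (by linarith)
  obtain ⟨D, hD, HD⟩ := riemann_abs Sg (show γ - δ ≤ γ by linarith) (by linarith)
  -- local remainder estimate
  have key : ∀ ε > 0, ∃ h > 0, ∀ s t, p ≤ s → s < t → t ≤ q → t - s ≤ h →
      Bd γ (e t - Sg.S (t - s) (e s) - Sg.S (t - s) ((t - s) • f s)) (C * ε * (t - s) ^ (1 - (γ - (γ - δ)))) := by
    intro ε hε
    obtain ⟨h, hh, Hh⟩ := hf ε hε
    refine ⟨h, hh, fun s t k1 k2 k3 k4 => ?_⟩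
    let f' : ℝ → 𝓑.E := fun r => f r - Sg.S (r - s) (f s)
    let w : ℝ → 𝓑.E := fun r => e r - Sg.S (r - s) (e s) - (r - s) • Sg.S (r - s) (f s)
    have := H s t ε f' w (by linarith) (fun r h1 h2 => Hh s r k1 h1 (by linarith) (by linarith)) ?_ s t le_rfl k2 le_rfl
    · refine this.congr ?_ le_rfl
      simp [w, Sg.S_id]
    · intro ε' hε'
      obtain ⟨h', hh', Hh'⟩ := he ε' hε'
      refine ⟨h', hh', fun a b l1 l2 l3 l4 => (Hh' a b (by linarith) l2 (by linarith) l4).congr ?_ le_rfl⟩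
      simp only [w, f', map_sub, map_smul]
      rw [sg_add' Sg l1 l2.le, sg_add' Sg l1 l2.le]
      module
  refine ⟨?_, fun ε hε => ?_⟩
  · obtain ⟨h, hh, Hh⟩ := hf 1 one_pos
    -- boundedness: use a partition
    obtain ⟨h2, hh2, Hk⟩ := key 1 one_pos
    obtain ⟨h3, hh3, Hr⟩ := he 1 one_pos
    obtain ⟨π, hπ⟩ := exists_partition ht (lt_min hh2 hh3)
    have := HD e (fun u w => (w - u) • f u) p t C (min h2 h3) (by linarith) (by linarith) (fun u w k1 k2 k3 k4 =>
      ⟨(Hr u w k1 k2 (by linarith) (k4.trans (min_le_right _ _))).mono (by have : 0 < w - u := by linarith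
                                                                           gcongr),
        (Hk u w k1 k2 (by linarith) (k4.trans (min_le_left _ _))).mono (by simp)⟩) π hπ.le
    rw [he0, map_zero, sub_zero] at this
    have hs : ∃ r, Bd γ (∑ i ∈ Finset.range π.n, Sg.S (t - π.t i) ((π.t (i+1) - π.t i) • f (π.t i))) r := by
      obtain ⟨B, hB, HB⟩ := sg_smooth Sg (γ - δ) γ (by linarith) (by linarith)
      refine ⟨_, Bd.sum _ _ (fun i => 𝓑.N γ (Sg.S (t - π.t i) ((π.t (i+1) - π.t i) • f (π.t i)))) fun i hi => Bd.of_mem ?_⟩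
      rw [Finset.mem_range] at hi
      have g1 := π.ge hi.le
      have g2 := π.le (i := i+1) hi
      have g3 := π.strict i hi
      exact (HB (t - π.t i) _ _ (by linarith) (by linarith) ((Bd.of_mem (hm (π.t i) (by linarith) (by linarith))).smul le_rfl)).1
    obtain ⟨r, hr⟩ := hs
    exact ((hr.sub this).congr (y := e t) (by abel) le_rfl).1
  · obtain ⟨h2, hh2, Hk⟩ := key (ε / (C * D)) (by positivity)
    obtain ⟨h3, hh3, Hr⟩ := he (ε / D) (by positivity)
    refine ⟨min h2 h3, lt_min hh2 hh3, fun π hπ => ?_⟩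
    have := HD e (fun u w => (w - u) • f u) p t (ε / D) (min h2 h3) (by linarith) (by positivity) (fun u w k1 k2 k3 k4 =>
      ⟨Hr u w k1 k2 (by linarith) (k4.trans (min_le_right _ _)),
        (Hk u w k1 k2 (by linarith) (k4.trans (min_le_left _ _))).mono (le_of_eq (by field_simp))⟩) π hπ.le
    rw [he0, map_zero, sub_zero] at this
    have e1 : intRiemannSum 𝓑 (fun s => Sg.S (t - s) (f s)) π = ∑ i ∈ Finset.range π.n, Sg.S (t - π.t i) ((π.t (i+1) - π.t i) • f (π.t i)) := by
      simp only [intRiemannSum, map_smul]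
    rw [e1]
    exact this.2.trans (le_of_eq (by field_simp))
end

lemma small_rpow {A η ε : ℝ} (hA : 0 ≤ A) (hη : 0 < η) (hε : 0 < ε) :
    ∃ r > 0, r ≤ 1 ∧ ∀ x, 0 ≤ x → x ≤ r → A * x ^ η ≤ ε := by
  have h0 : 0 < ε / (A + 1) := by positivity
  refine ⟨min 1 ((ε / (A + 1)) ^ (1/η)), lt_min one_pos (Real.rpow_pos_of_pos h0 _), min_le_left _ _, fun x hx hxr => ?_⟩
  have h1 : x ^ η ≤ ε / (A + 1) := by
    calc x ^ η ≤ ((ε / (A + 1)) ^ (1/η)) ^ η := Real.rpow_le_rpow hx (hxr.trans (min_le_right _ _)) hη.le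
      _ = _ := by rw [← Real.rpow_mul h0.le, one_div_mul_cancel hη.ne', Real.rpow_one]
  calc A * x ^ η ≤ A * (ε / (A + 1)) := mul_le_mul_of_nonneg_left h1 hA
    _ = ε * (A / (A + 1)) := by ring
    _ ≤ ε * 1 := by
      refine mul_le_mul_of_nonneg_left ?_ hε.le
      rw [div_le_one (by linarith)]; linarith
    _ = ε := mul_one _

/-- bounds on a controlled path -/
structure PB (𝓑 : BanachScale) (α γ : ℝ) (X : ℝ → ℝ) (p q : ℝ) (y y' : ℝ → 𝓑.E) (a b c e f : ℝ) : Prop where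
  a0 : ∀ t, p ≤ t → t ≤ q → Bd γ (y t) a
  b0 : ∀ t, p ≤ t → t ≤ q → Bd (γ - α) (y' t) b
  c0 : ∀ s t, p ≤ s → s < t → t ≤ q → Bd (γ - 2 * α) (y' t - y' s) (c * (t - s) ^ α)
  e0 : ∀ s t, p ≤ s → s < t → t ≤ q → Bd (γ - α) (y t - y s - (X t - X s) • y' s) (e * (t - s) ^ α)
  f0 : ∀ s t, p ≤ s → s < t → t ≤ q → Bd (γ - 2 * α) (y t - y s - (X t - X s) • y' s) (f * (t - s) ^ (2 * α))

/-- mild increments -/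
def Mild {𝓑 : BanachScale} (Sg : ScaleSemigroup 𝓑) (α σ γ δ : ℝ) (X : ℝ → ℝ) (X2 : ℝ → ℝ → ℝ) (p q : ℝ)
    (g g' f W : ℝ → 𝓑.E) : Prop :=
  ∃ (e v : ℝ → 𝓑.E) (C : ℝ), IsDr Sg (γ - δ) p q f e ∧ IsSew Sg α σ γ X X2 p q g g' v C ∧
    ∀ s t, p ≤ s → s < t → t ≤ q →
      W t - Sg.S (t - s) (W s) = (e t - Sg.S (t - s) (e s)) + (v t - Sg.S (t - s) (v s))

section
variable {𝓑 : BanachScale} (Sg : ScaleSemigroup 𝓑) {α σ γ δ : ℝ}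

lemma Mild.restrict {X : ℝ → ℝ} {X2 : ℝ → ℝ → ℝ} {p q p' q' : ℝ} {g g' f W : ℝ → 𝓑.E}
    (h : Mild Sg α σ γ δ X X2 p q g g' f W) (hp : p ≤ p') (hq : q' ≤ q) :
    Mild Sg α σ γ δ X X2 p' q' g g' f W := by
  obtain ⟨e, v, C, h1, h2, h3⟩ := h
  refine ⟨e, v, C, fun ε hε => ?_, fun s t k1 k2 k3 => h2 s t (hp.trans k1) k2 (k3.trans hq),
    fun s t k1 k2 k3 => h3 s t (hp.trans k1) k2 (k3.trans hq)⟩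
  obtain ⟨r, hr, H⟩ := h1 ε hε
  exact ⟨r, hr, fun s t k1 k2 k3 => H s t (hp.trans k1) k2 (k3.trans hq)⟩

lemma Mild.sub {X : ℝ → ℝ} {X2 : ℝ → ℝ → ℝ} {p q : ℝ} {g g' f W g1 g1' f1 W1 : ℝ → 𝓑.E}
    (h : Mild Sg α σ γ δ X X2 p q g g' f W) (h1 : Mild Sg α σ γ δ X X2 p q g1 g1' f1 W1) :
    Mild Sg α σ γ δ X X2 p q (fun t => g t - g1 t) (fun t => g' t - g1' t) (fun t => f t - f1 t) (fun t => W t - W1 t) := by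
  obtain ⟨e, v, C, a1, a2, a3⟩ := h
  obtain ⟨e1, v1, C1, b1, b2, b3⟩ := h1
  refine ⟨fun t => e t - e1 t, fun t => v t - v1 t, C + C1, fun ε hε => ?_, fun s t k1 k2 k3 => ?_, fun s t k1 k2 k3 => ?_⟩
  · obtain ⟨r, hr, H⟩ := a1 (ε/2) (half_pos hε)
    obtain ⟨r1, hr1, H1⟩ := b1 (ε/2) (half_pos hε)
    refine ⟨min r r1, lt_min hr hr1, fun s t k1 k2 k3 k4 =>
      ((H s t k1 k2 k3 (k4.trans (min_le_left _ _))).sub (H1 s t k1 k2 k3 (k4.trans (min_le_right _ _)))).congr ?_ (le_of_eq (by ring))⟩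
    simp only [smul_sub, map_sub]; abel
  · refine ((a2 s t k1 k2 k3).sub (b2 s t k1 k2 k3)).congr ?_ (le_of_eq (by ring))
    simp only [germ, smul_sub, map_sub, map_add]; abel
  · have x1 := a3 s t k1 k2 k3
    have x2 := b3 s t k1 k2 k3
    simp only [map_sub]
    rw [show W t - W1 t - (Sg.S (t - s) (W s) - Sg.S (t - s) (W1 s)) = (W t - Sg.S (t - s) (W s)) - (W1 t - Sg.S (t - s) (W1 s)) by abel, x1, x2]
    abel

/-- exponent gain -/
noncomputable def eta (α σ δ : ℝ) : ℝ := min (α - σ) (min (1 - δ) (1 - 2 * α))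

lemma eta_pos (hα' : α < 1/2) (hσα : σ < α) (hδ' : δ < 1) : 0 < eta α σ δ := by
  unfold eta
  refine lt_min (by linarith) (lt_min (by linarith) (by linarith))

lemma step_cst {B Q E1 E2 : ℝ} (hB : 1 ≤ B) (hQ : 1 ≤ Q) (h1 : 1 ≤ E1) (h2 : 1 ≤ E2) :
    B ≤ (1 + E1 + E2) * (B + Q) ∧ Q ≤ (1 + E1 + E2) * (B + Q) ∧ E1 * B ≤ (1 + E1 + E2) * (B + Q) ∧
    E1 * Q + Q ≤ (1 + E1 + E2) * (B + Q) ∧ E2 * B ≤ (1 + E1 + E2) * (B + Q) ∧ E2 * Q + Q ≤ (1 + E1 + E2) * (B + Q) := by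
  have e : (1 + E1 + E2) * (B + Q) = B + Q + E1 * B + E1 * Q + E2 * B + E2 * Q := by ring
  have : 0 ≤ E1 * B := by positivity
  have : 0 ≤ E1 * Q := by positivity
  have : 0 ≤ E2 * B := by positivity
  have : 0 ≤ E2 * Q := by positivity
  refine ⟨?_, ?_, ?_, ?_, ?_, ?_⟩ <;> linarith

set_option maxHeartbeats 1000000 in
lemma step (hα : 1/3 < α) (hα' : α < 1/2) (hσ : 0 ≤ σ) (hσα : σ < α) (hδ : 0 ≤ δ) (hδ' : δ < 1)
    {CX : ℝ} (hCX : 1 ≤ CX) :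
    ∃ C ≥ (1:ℝ), ∀ (T : ℝ) (X : ℝ → ℝ) (X2 : ℝ → ℝ → ℝ) (p q : ℝ) (g g' f W : ℝ → 𝓑.E) (k K w0 ε : ℝ),
      RB α CX T X X2 → 0 ≤ p → p ≤ q → q ≤ T → IB 𝓑 α σ γ X p q g g' k K →
      (∀ t, p ≤ t → t ≤ q → Bd (γ - δ) (f t) K) →
      Mild Sg α σ γ δ X X2 p q g g' f W → Bd γ (W p) w0 → (q - p) ^ eta α σ δ ≤ ε →
      (∀ t, p ≤ t → t ≤ q → Bd γ (W t) (C * w0 + C * K * ε)) ∧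
      (∀ s t, p ≤ s → s < t → t ≤ q → Bd (γ - α) (W t - W s - (X t - X s) • g s)
        ((C * w0 + C * K * ε) * (t - s) ^ α)) ∧
      (∀ s t, p ≤ s → s < t → t ≤ q → Bd (γ - 2 * α) (W t - W s - (X t - X s) • g s)
        ((C * w0 + C * k + C * K * ε) * (t - s) ^ (2 * α))) ∧
      (∀ s t, p ≤ s → s < t → t ≤ q → Bd γ (W t - Sg.S (t - s) (W s)) (C * K * (t - s) ^ eta α σ δ)) := by
  have hη := eta_pos (δ := δ) hα' hσα hδ'
  set η := eta α σ δ with hηd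
  have e1 : η ≤ α - σ := min_le_left _ _
  have e2 : η ≤ 1 - δ := (min_le_right _ _).trans (min_le_left _ _)
  have e3 : η ≤ 1 - 2 * α := (min_le_right _ _).trans (min_le_right _ _)
  obtain ⟨A, hA, HA⟩ := rough_main (γ := γ) Sg hα hα' hσ hσα hCX
  obtain ⟨D0, hD0, HD0⟩ := dr_bd (γ := γ) (δ := δ) (η := η) (x := 0) Sg hδ hδ' le_rfl e2 (by linarith)
  obtain ⟨D1, hD1, HD1⟩ := dr_bd (γ := γ) (δ := δ) (η := η) (x := α) Sg hδ hδ' (by linarith) e2 (by linarith)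
  obtain ⟨D2, hD2, HD2⟩ := dr_bd (γ := γ) (δ := δ) (η := η) (x := 2 * α) Sg hδ hδ' (by linarith) e2 (by linarith)
  obtain ⟨B, hB, HB⟩ := sg_bdd Sg γ
  obtain ⟨E1, hE1, HE1⟩ := sg_hold Sg (γ - α) γ (by linarith) (by linarith)
  obtain ⟨E2, hE2, HE2⟩ := sg_hold Sg (γ - 2 * α) γ (by linarith) (by linarith)
  set Q := A + D0 + D1 + D2 with hQ
  refine ⟨(1 + E1 + E2) * (B + Q) , by linarith [(step_cst hB (show 1 ≤ Q by linarith) hE1 hE2).1], fun T X X2 p q g g' f W k K w0 ε hX hp hpq hqT hI hf hM hw hε => ?_⟩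
  obtain ⟨e, v, C', m1, m2, m3⟩ := hM
  have hT := hX.Tle
  have hK := hI.K0 hpq
  have hk : 0 ≤ k := (hI.g1 p le_rfl hpq).nonneg
  have hw0 := hw.nonneg
  have hpow : ∀ x, 0 ≤ x → x ≤ q - p → x ^ η ≤ ε := fun x h0 h1 => (Real.rpow_le_rpow h0 h1 hη.le).trans hε
  have hε0 : 0 ≤ ε := le_trans (Real.rpow_nonneg (by linarith) _) hε
  have main := (HA T X X2 p q g g' k K hX hp hpq hqT hI).2 v C' m2
  have f0 := HD0 p q K f e (by linarith) hf m1
  have f1 := HD1 p q K f e (by linarith) hf m1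
  have f2 := HD2 p q K f e (by linarith) hf m1
  -- increments
  have i0 : ∀ s t, p ≤ s → s < t → t ≤ q → Bd γ (W t - Sg.S (t - s) (W s)) (Q * K * (t - s) ^ η) := by
    intro s t k1 k2 k3
    have hL : 0 < t - s := by linarith
    have f00 := f0 s t k1 k2 k3
    rw [sub_zero] at f00
    have := f00.add (main s t k1 k2 k3).2.2.1
    refine this.congr (m3 s t k1 k2 k3) ?_
    rw [zero_add]
    have := rpow_le_exp hL (by linarith) e1
    have hK1 : A * K * (t - s) ^ (α - σ) ≤ A * K * (t - s) ^ η := by gcongr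
    have : 0 ≤ (D1 + D2) * K * (t - s) ^ η := by positivity
    rw [hQ]; linarith
  have iA : ∀ t, p ≤ t → t ≤ q → Bd γ (W t) (B * w0 + Q * K * ε) := by
    intro t k1 k2
    rcases k1.eq_or_lt with rfl | k1
    · refine hw.mono ?_
      have : 0 ≤ Q * K * ε := by positivity
      nlinarith
    · refine ((HB (t - p) _ _ (by linarith) (by linarith) hw).add (i0 p t le_rfl k1 k2)).congr (by abel) ?_
      have := hpow (t - p) (by linarith) (by linarith)
      gcongr
  have hQ1 : 1 ≤ Q := by linarith
  have i1 : ∀ s t, p ≤ s → s < t → t ≤ q → Bd (γ - α) (W t - W s - (X t - X s) • g s)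
        ((E1 * (B * w0 + Q * K * ε) + Q * K * ε) * (t - s) ^ α) := by
    intro s t k1 k2 k3
    have hL : 0 < t - s := by linarith
    have b1 := HE1 (t - s) _ _ hL.le (by linarith) (iA s k1 (by linarith))
    have := ((f1 s t k1 k2 k3).add (main s t k1 k2 k3).2.2.2.1).add b1
    refine this.congr ?_ ?_
    · have := m3 s t k1 k2 k3
      rw [sub_eq_iff_eq_add] at this
      rw [this]; abel
    have p1 := rpow_le_exp hL (by linarith) (show α + η ≤ 2 * α - σ by linarith)
    have p2 : (t - s) ^ (α + η) ≤ ε * (t - s) ^ α := by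
      rw [Real.rpow_add hL, mul_comm]; gcongr; exact hpow _ hL.le (by linarith)
    rw [show γ - (γ - α) = α by ring]
    have q1 : D1 * K * (t - s) ^ (α + η) ≤ D1 * K * (ε * (t - s) ^ α) := by gcongr
    have q2 : A * K * (t - s) ^ (2 * α - σ) ≤ A * K * (ε * (t - s) ^ α) := by
      have := p1.trans p2; gcongr
    have : 0 ≤ (D0 + D2) * K * ε * (t - s) ^ α := by positivity
    rw [hQ] at *; linarith
  have i2 : ∀ s t, p ≤ s → s < t → t ≤ q → Bd (γ - 2 * α) (W t - W s - (X t - X s) • g s)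
        ((E2 * (B * w0 + Q * K * ε) + Q * k + Q * K * ε) * (t - s) ^ (2 * α)) := by
    intro s t k1 k2 k3
    have hL : 0 < t - s := by linarith
    have b1 := HE2 (t - s) _ _ hL.le (by linarith) (iA s k1 (by linarith))
    have := ((f2 s t k1 k2 k3).add (main s t k1 k2 k3).2.2.2.2).add b1
    refine this.congr ?_ ?_
    · have := m3 s t k1 k2 k3
      rw [sub_eq_iff_eq_add] at this
      rw [this]; abel
    have p1 := rpow_le_exp hL (by linarith) (show 2 * α + η ≤ 3 * α - σ by linarith)
    have p2 : (t - s) ^ (2 * α + η) ≤ ε * (t - s) ^ (2 * α) := by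
      rw [Real.rpow_add hL, mul_comm]; gcongr; exact hpow _ hL.le (by linarith)
    rw [show γ - (γ - 2 * α) = 2 * α by ring]
    have q1 : D2 * K * (t - s) ^ (2 * α + η) ≤ D2 * K * (ε * (t - s) ^ (2 * α)) := by gcongr
    have q2 : A * K * (t - s) ^ (3 * α - σ) ≤ A * K * (ε * (t - s) ^ (2 * α)) := by
      have := p1.trans p2; gcongr
    have : 0 ≤ (D0 + D1) * K * ε * (t - s) ^ (2 * α) := by positivity
    have : 0 ≤ (D0 + D1 + D2) * k * (t - s) ^ (2 * α) := by positivity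
    rw [hQ] at *; linarith
  set CC := (1 + E1 + E2) * (B + Q) with hCC
  obtain ⟨c1, c2, c3, c4, c5, c6⟩ : B ≤ CC ∧ Q ≤ CC ∧ E1 * B ≤ CC ∧ E1 * Q + Q ≤ CC ∧ E2 * B ≤ CC ∧ E2 * Q + Q ≤ CC := step_cst hB hQ1 hE1 hE2
  have hKε : 0 ≤ K * ε := by positivity
  refine ⟨fun t k1 k2 => (iA t k1 k2).mono ?_, fun s t k1 k2 k3 => (i1 s t k1 k2 k3).mono ?_,
    fun s t k1 k2 k3 => (i2 s t k1 k2 k3).mono ?_, fun s t k1 k2 k3 => (i0 s t k1 k2 k3).mono ?_⟩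
  · gcongr
  · have hL : 0 < t - s := by linarith
    refine mul_le_mul_of_nonneg_right ?_ (by positivity)
    have := mul_le_mul_of_nonneg_right c3 hw0
    have := mul_le_mul_of_nonneg_right c4 hKε
    linarith
  · have hL : 0 < t - s := by linarith
    refine mul_le_mul_of_nonneg_right ?_ (by positivity)
    have := mul_le_mul_of_nonneg_right c5 hw0
    have := mul_le_mul_of_nonneg_right c6 hKε
    have := mul_le_mul_of_nonneg_right c2 hk
    linarith
  · have hL : 0 < t - s := by linarith
    gcongr

/-- continuity from mild increments -/
lemma con_of_incr {p q A η : ℝ} {W : ℝ → 𝓑.E} (hη : 0 < η) (hA : 0 ≤ A) (hq : q ≤ p + 1)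
    (hm : ∀ t, p ≤ t → t ≤ q → 𝓑.Mem γ (W t))
    (h : ∀ s t, p ≤ s → s < t → t ≤ q → Bd γ (W t - Sg.S (t - s) (W s)) (A * (t - s) ^ η)) :
    COn γ p q W := by
  refine ⟨hm, fun t h1 h2 ε hε => ?_⟩
  obtain ⟨r, hr, _, Hr⟩ := small_rpow hA hη (show 0 < ε/4 by linarith)
  let s0 := max p (t - r/2)
  have hs0 : p ≤ s0 := le_max_left _ _
  have hs0' : t - r/2 ≤ s0 := le_max_right _ _
  have hs0t : s0 ≤ t := max_le h1 (by linarith)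
  have inc : ∀ s, s0 ≤ s → s ≤ q → s ≤ t + r/2 → Bd γ (W s - Sg.S (s - s0) (W s0)) (ε/4) := by
    intro s k1 k2 k3
    rcases k1.eq_or_lt with rfl | k1
    · rw [sub_self, Sg.S_id, sub_self]; exact Bd.zero (by linarith)
    · exact (h s0 s hs0 k1 k2).mono (Hr _ (by linarith) (by linarith))
  obtain ⟨d, hd, Hd⟩ := Metric.continuous_iff.1 (orbit_cont Sg γ ⟨W s0, hm s0 hs0 (by linarith)⟩) (t - s0) (ε/4) (by linarith)
  refine ⟨min d (r/2), lt_min hd (by linarith), fun s k1 k2 k3 => ?_⟩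
  have k4 := k3.trans_le (min_le_left _ _)
  have k5 := abs_lt.1 (k3.trans_le (min_le_right _ _))
  have hs : s0 ≤ s := max_le k1 (by linarith)
  have b1 := inc s hs k2 (by linarith)
  have b2 := inc t hs0t h2 (by linarith)
  have b3 := Hd (s - s0) (by rw [Real.dist_eq]; rw [show s - s0 - (t - s0) = s - t by ring]; exact k4)
  rw [dist_eq_norm] at b3
  have b4 := (BanachScale.bd_iff _ γ _ _).2 b3.le
  rw [show ∀ x y : 𝓑.sub γ, (x - y).1 = x.1 - y.1 from fun _ _ => rfl, SC_val, SC_val, cl_val (by linarith) (by linarith),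
    cl_val (by linarith) (by linarith)] at b4
  have := ((b1.sub b2).add b4).congr (y := W s - W t) (by abel) le_rfl
  exact lt_of_le_of_lt this.2 (by linarith)
end

/-- embeddings used -/
structure Emb (𝓑 : BanachScale) (α σ γ C : ℝ) : Prop where
  one : 1 ≤ C
  e01 : ∀ (x : 𝓑.E) r, Bd γ x r → Bd (γ - α) x (C * r)
  e02 : ∀ (x : 𝓑.E) r, Bd γ x r → Bd (γ - 2 * α) x (C * r)
  e12 : ∀ (x : 𝓑.E) r, Bd (γ - α) x r → Bd (γ - 2 * α) x (C * r)
  es1 : ∀ (x : 𝓑.E) r, Bd (γ - σ) x r → Bd (γ - α) x (C * r)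
  es2 : ∀ (x : 𝓑.E) r, Bd (γ - α - σ) x r → Bd (γ - 2 * α) x (C * r)

lemma emb_ex (𝓑 : BanachScale) {α σ γ : ℝ} (hα : 0 < α) (hσα : σ < α) : ∃ C₀, ∀ C ≥ C₀, Emb 𝓑 α σ γ C := by
  obtain ⟨C1, h1, H1⟩ := bd_embed 𝓑 (show γ - α ≤ γ by linarith)
  obtain ⟨C2, h2, H2⟩ := bd_embed 𝓑 (show γ - 2 * α ≤ γ by linarith)
  obtain ⟨C3, h3, H3⟩ := bd_embed 𝓑 (show γ - 2 * α ≤ γ - α by linarith)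
  obtain ⟨C4, h4, H4⟩ := bd_embed 𝓑 (show γ - α ≤ γ - σ by linarith)
  obtain ⟨C5, h5, H5⟩ := bd_embed 𝓑 (show γ - 2 * α ≤ γ - α - σ by linarith)
  have key : ∀ {a b D C : ℝ} (H : ∀ (x : 𝓑.E) r, Bd b x r → Bd a x (D * r)), D ≤ C →
      ∀ (x : 𝓑.E) r, Bd b x r → Bd a x (C * r) := fun H hD x r hx =>
    (H x r hx).mono (mul_le_mul_of_nonneg_right hD hx.nonneg)
  refine ⟨C1 + C2 + C3 + C4 + C5, fun C hC => ⟨by linarith, key H1 (by linarith), key H2 (by linarith),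
    key H3 (by linarith), key H4 (by linarith), key H5 (by linarith)⟩⟩

section
variable {𝓑 : BanachScale} {α σ γ : ℝ} {G : 𝓑.E → 𝓑.E} {DG : 𝓑.E → 𝓑.E →ₗ[ℝ] 𝓑.E}

lemma PB.mono {X : ℝ → ℝ} {p q : ℝ} {y y' : ℝ → 𝓑.E} {a b c e f a1 b1 c1 e1 f1 : ℝ}
    (h : PB 𝓑 α γ X p q y y' a b c e f) (ha : a ≤ a1) (hb : b ≤ b1) (hc : c ≤ c1) (he : e ≤ e1) (hf : f ≤ f1) :
    PB 𝓑 α γ X p q y y' a1 b1 c1 e1 f1 := by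
  refine ⟨fun t k1 k2 => (h.a0 t k1 k2).mono ha, fun t k1 k2 => (h.b0 t k1 k2).mono hb,
    fun s t k1 k2 k3 => (h.c0 s t k1 k2 k3).mono ?_, fun s t k1 k2 k3 => (h.e0 s t k1 k2 k3).mono ?_,
    fun s t k1 k2 k3 => (h.f0 s t k1 k2 k3).mono ?_⟩
  all_goals exact mul_le_mul_of_nonneg_right (by assumption) (Real.rpow_nonneg (by linarith) _)

lemma PB.restrict {X : ℝ → ℝ} {p q p1 q1 : ℝ} {y y' : ℝ → 𝓑.E} {a b c e f : ℝ}
    (h : PB 𝓑 α γ X p q y y' a b c e f) (hp : p ≤ p1) (hq : q1 ≤ q) :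
    PB 𝓑 α γ X p1 q1 y y' a b c e f :=
  ⟨fun t k1 k2 => h.a0 t (hp.trans k1) (k2.trans hq), fun t k1 k2 => h.b0 t (hp.trans k1) (k2.trans hq),
    fun s t k1 k2 k3 => h.c0 s t (hp.trans k1) k2 (k3.trans hq), fun s t k1 k2 k3 => h.e0 s t (hp.trans k1) k2 (k3.trans hq),
    fun s t k1 k2 k3 => h.f0 s t (hp.trans k1) k2 (k3.trans hq)⟩

lemma PB.inc1 {X : ℝ → ℝ} {X2 : ℝ → ℝ → ℝ} {CX T p q : ℝ} {y y' : ℝ → 𝓑.E} {a b c e f : ℝ}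
    (h : PB 𝓑 α γ X p q y y' a b c e f) (hX : RB α CX T X X2) (hp : 0 ≤ p) (hq : q ≤ T)
    {s t : ℝ} (k1 : p ≤ s) (k2 : s < t) (k3 : t ≤ q) :
    Bd (γ - α) (y t - y s) ((e + CX * b) * (t - s) ^ α) := by
  refine ((h.e0 s t k1 k2 k3).add ((h.b0 s k1 (by linarith)).smul (hX.x1 s t (by linarith) k2.le (by linarith)))).congr (by abel) (le_of_eq (by ring))

lemma PB.inc2 {X : ℝ → ℝ} {X2 : ℝ → ℝ → ℝ} {CX T p q Ce : ℝ} {y y' : ℝ → 𝓑.E} {a b c e f : ℝ}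
    (h : PB 𝓑 α γ X p q y y' a b c e f) (hX : RB α CX T X X2) (hE : Emb 𝓑 α σ γ Ce) (hα : 0 < α) (hf : 0 ≤ f) (hp : 0 ≤ p) (hq : q ≤ T)
    {s t : ℝ} (k1 : p ≤ s) (k2 : s < t) (k3 : t ≤ q) :
    Bd (γ - 2 * α) (y t - y s) ((f + CX * Ce * b) * (t - s) ^ α) := by
  have := hX.Tle
  refine ((h.f0 s t k1 k2 k3).add ((hE.e12 _ _ (h.b0 s k1 (by linarith))).smul (hX.x1 s t (by linarith) k2.le (by linarith)))).congr (by abel) ?_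
  have := mul_le_mul_of_nonneg_left (rpow_le_exp (L := t - s) (by linarith) (by linarith) (show α ≤ 2 * α by linarith)) hf
  linarith

/-- difference estimate: integrand remainder pieces -/
lemma comp_diff (hα : 0 < α) {C CX : ℝ} (hCX : 1 ≤ CX)
    (hE : Emb 𝓑 α σ γ C) (hG0 : GLev 𝓑 γ (γ - σ) C G DG) (hG1 : GLev 𝓑 (γ - α) (γ - α - σ) C G DG)
    (hG2 : GLev 𝓑 (γ - 2 * α) (γ - 2 * α - σ) C G DG) {M : ℝ} (hM : 1 ≤ M) :
    ∃ CM ≥ C * C, ∀ (T : ℝ) (X : ℝ → ℝ) (X2 : ℝ → ℝ → ℝ) (p q : ℝ) (y y' z z' : ℝ → 𝓑.E) (a b c e f : ℝ),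
      RB α CX T X X2 → 0 ≤ p → p ≤ q → q ≤ T → 0 ≤ c → 0 ≤ f →
      PB 𝓑 α γ X p q y y' M M M M M → PB 𝓑 α γ X p q z z' M M M M M →
      PB 𝓑 α γ X p q (fun t => y t - z t) (fun t => y' t - z' t) a b c e f →
      IB 𝓑 α σ γ X p q (fun t => G (y t) - G (z t)) (fun t => DG (y t) (y' t) - DG (z t) (z' t))
        (C * b + CM * a) (CM * (a + b + c + f)) ∧
      (∀ t, p ≤ t → t ≤ q → Bd (γ - α) (G (y t) - G (z t)) (C * C * a)) ∧
      (∀ s t, p ≤ s → s < t → t ≤ q → Bd (γ - 2 * α) (G (y t) - G (z t) - (G (y s) - G (z s)))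
        ((C * C * (e + CX * b) + CM * a) * (t - s) ^ α)) := by
  have hC := hE.one
  set M1 := M + CX * M with hM1
  set M2 := M + CX * C * M with hM2
  have hM1p : 0 ≤ M1 := by positivity
  have hM2p : 0 ≤ M2 := by positivity
  set P := CX * C with hP
  have hPp : 1 ≤ P := by nlinarith
  -- constants
  set CM := C * C + C * (C * M) + C * (C * (C * M1))
    + (C + C * (C * M) + C * (M2 * C) + C * (C * (M2 * (C * M))) + C * (P * (C * M)))
    + (C * M + C * (C * (M2 * M2)) + C * ((M2 + M2) * P)) + C * (C * M2) with hCM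
  refine ⟨CM, ?_, fun T X X2 p q y y' z z' a b c e f hX hp hpq hqT hc hf hy hz hd => ?_⟩
  · have : 0 ≤ C * (C * M) + C * (C * (C * M1))
      + (C + C * (C * M) + C * (M2 * C) + C * (C * (M2 * (C * M))) + C * (P * (C * M)))
      + (C * M + C * (C * (M2 * M2)) + C * ((M2 + M2) * P)) + C * (C * M2) := by positivity
    linarith
  have hT := hX.Tle
  have ha : 0 ≤ a := (hd.a0 p le_rfl hpq).nonneg
  have hb : 0 ≤ b := (hd.b0 p le_rfl hpq).nonneg
  have my0 : ∀ t, p ≤ t → t ≤ q → 𝓑.Mem γ (y t) := fun t k1 k2 => (hy.a0 t k1 k2).1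
  have mz0 : ∀ t, p ≤ t → t ≤ q → 𝓑.Mem γ (z t) := fun t k1 k2 => (hz.a0 t k1 k2).1
  have my1 : ∀ t, p ≤ t → t ≤ q → 𝓑.Mem (γ - α) (y t) := fun t k1 k2 => (hE.e01 _ _ (hy.a0 t k1 k2)).1
  have mz1 : ∀ t, p ≤ t → t ≤ q → 𝓑.Mem (γ - α) (z t) := fun t k1 k2 => (hE.e01 _ _ (hz.a0 t k1 k2)).1
  have my2 : ∀ t, p ≤ t → t ≤ q → 𝓑.Mem (γ - 2 * α) (y t) := fun t k1 k2 => (hE.e02 _ _ (hy.a0 t k1 k2)).1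
  have mz2 : ∀ t, p ≤ t → t ≤ q → 𝓑.Mem (γ - 2 * α) (z t) := fun t k1 k2 => (hE.e02 _ _ (hz.a0 t k1 k2)).1
  have d2 : ∀ t, p ≤ t → t ≤ q → Bd (γ - 2 * α) (y t - z t) (C * a) := fun t k1 k2 => hE.e02 _ _ (hd.a0 t k1 k2)
  have d1 : ∀ t, p ≤ t → t ≤ q → Bd (γ - α) (y t - z t) (C * a) := fun t k1 k2 => hE.e01 _ _ (hd.a0 t k1 k2)
  have hg0 : ∀ t, p ≤ t → t ≤ q → Bd (γ - σ) (G (y t) - G (z t)) (C * a) := fun t k1 k2 =>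
    hG0.lip _ _ _ (my0 t k1 k2) (mz0 t k1 k2) (hd.a0 t k1 k2)
  refine ⟨⟨?_, ?_, ?_, ?_, ?_⟩, ?_, ?_⟩
  · -- k ≤ K
    have h1 : C * b ≤ CM * b := by
      refine mul_le_mul_of_nonneg_right ?_ hb
      have : 0 ≤ C * (C * M) + C * (C * (C * M1))
        + (C * (C * M) + C * (M2 * C) + C * (C * (M2 * (C * M))) + C * (P * (C * M)))
        + (C * M + C * (C * (M2 * M2)) + C * ((M2 + M2) * P)) + C * (C * M2) := by positivity
      have : 0 ≤ C * C := by positivity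
      linarith
    have hCM0 : 0 ≤ CM := by positivity
    have : 0 ≤ CM * c := by positivity
    have : 0 ≤ CM * f := by positivity
    linarith
  · intro t k1 k2
    refine (hg0 t k1 k2).mono ?_
    have h1 : C * a ≤ CM * a := by
      refine mul_le_mul_of_nonneg_right ?_ ha
      have : 0 ≤ C * (C * M) + C * (C * (C * M1))
        + (C * (C * M) + C * (M2 * C) + C * (C * (M2 * (C * M))) + C * (P * (C * M)))
        + (C * M + C * (C * (M2 * M2)) + C * ((M2 + M2) * P)) + C * (C * M2) := by positivity
      have : 0 ≤ C * C := by positivity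
      linarith
    have hCM0 : 0 ≤ CM := by positivity
    have : 0 ≤ CM * b := by positivity
    have : 0 ≤ CM * c := by positivity
    have : 0 ≤ CM * f := by positivity
    linarith
  · intro t k1 k2
    refine ((hG1.dg _ _ _ (my1 t k1 k2) (hd.b0 t k1 k2)).add
      (hG1.dlip _ _ _ _ _ (my1 t k1 k2) (mz1 t k1 k2) (d1 t k1 k2) (hz.b0 t k1 k2))).congr ?_ ?_
    · rw [map_sub]; abel
    · have h1 : C * (C * M) * a ≤ CM * a := by
        refine mul_le_mul_of_nonneg_right ?_ ha
        have : 0 ≤ C * C + C * (C * (C * M1))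
          + (C + C * (C * M) + C * (M2 * C) + C * (C * (M2 * (C * M))) + C * (P * (C * M)))
          + (C * M + C * (C * (M2 * M2)) + C * ((M2 + M2) * P)) + C * (C * M2) := by positivity
        linarith
      linarith
  · intro s t k1 k2 k3
    have hL : 0 < t - s := by linarith
    have hLa : 0 < (t - s) ^ α := Real.rpow_pos_of_pos hL _
    have ks : s ≤ q := by linarith
    have kt : p ≤ t := by linarith
    have ih := hy.inc2 hX hE hα (by linarith) hp hqT k1 k2 k3
    have ik := hz.inc2 hX hE hα (by linarith) hp hqT k1 k2 k3
    have id := hd.inc2 hX hE hα hf hp hqT k1 k2 k3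
    have b1 := hG2.dg _ _ _ (my2 t kt k3) (hd.c0 s t k1 k2 k3)
    have b2 := hG2.dlip _ _ _ _ _ (my2 t kt k3) (mz2 t kt k3) (d2 t kt k3) (hz.c0 s t k1 k2 k3)
    have b3 := hG2.dlip _ _ _ _ _ (my2 t kt k3) (my2 s k1 ks) ih (hE.e12 _ _ (hd.b0 s k1 ks))
    have b4 := hG2.dlip2 _ _ _ _ _ _ _ (my2 s k1 ks) (mz2 s k1 ks) (d2 s k1 ks) ih (hE.e12 _ _ (hz.b0 s k1 ks))
    have mzh : 𝓑.Mem (γ - 2 * α) (z s + (y t - y s)) := 𝓑.mem_add _ _ _ (mz2 s k1 ks) ih.1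
    have b5 := hG2.dlip (z s + (y t - y s)) (z t) (z' s) _ _ mzh (mz2 t kt k3) (id.congr (by abel) le_rfl) (hE.e12 _ _ (hz.b0 s k1 ks))
    have tot := ((b1.add b2).add b3).add (b4.add b5)
    refine tot.congr ?_ ?_
    · rw [add_sub_cancel]
      simp only [map_sub]
      abel
    · have : C * (c * (t - s) ^ α) + C * (C * a * (M * (t - s) ^ α)) + C * (M2 * (t - s) ^ α * (C * b)) +
        (C * (C * a * (M2 * (t - s) ^ α * (C * M))) + C * ((f + P * b) * (t - s) ^ α * (C * M)))
        = (C * c + C * (C * M) * a + C * (M2 * C) * b + C * (C * (M2 * (C * M))) * a + C * (C * M) * f + C * (P * (C * M)) * b) * (t - s) ^ α := by ring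
      rw [this]
      refine mul_le_mul_of_nonneg_right ?_ hLa.le
      have hPf : C * (C * M) * f ≤ C * (P * (C * M)) * f := by
        have : C * (C * M) * f * 1 ≤ C * (C * M) * f * P := mul_le_mul_of_nonneg_left hPp (by positivity)
        linarith
      set Z1 := C * (C * M)
      set Z2 := C * (M2 * C)
      set Z3 := C * (C * (M2 * (C * M)))
      set Z4 := C * (P * (C * M))
      have hZ1 : 0 ≤ Z1 := by positivity
      have hZ2 : 0 ≤ Z2 := by positivity
      have hZ3 : 0 ≤ Z3 := by positivity
      have hZ4 : 0 ≤ Z4 := by positivity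
      have hZ : C + Z1 + Z2 + Z3 + Z4 ≤ CM := by
        have : 0 ≤ C * C + Z1 + C * (C * (C * M1)) + (C * M + C * (C * (M2 * M2)) + C * ((M2 + M2) * P)) + C * (C * M2) := by positivity
        linarith
      have hs : 0 ≤ a + b + c + f := by positivity
      refine le_trans ?_ (mul_le_mul_of_nonneg_right hZ hs)
      have q1 : C * c ≤ C * (a + b + c + f) := by gcongr; linarith
      have q2 : Z1 * a ≤ Z1 * (a + b + c + f) := by gcongr; linarith
      have q3 : Z2 * b ≤ Z2 * (a + b + c + f) := by gcongr; linarith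
      have q4 : Z3 * a ≤ Z3 * (a + b + c + f) := by gcongr; linarith
      have q5 : Z4 * f + Z4 * b ≤ Z4 * (a + b + c + f) := by rw [← mul_add]; exact mul_le_mul_of_nonneg_left (by linarith) hZ4
      linarith
  · intro s t k1 k2 k3
    have hL : 0 < t - s := by linarith
    have hLa : 0 < (t - s) ^ (2 * α) := Real.rpow_pos_of_pos hL _
    have hLL : (t - s) ^ α * (t - s) ^ α = (t - s) ^ (2 * α) := by
      rw [← Real.rpow_add hL]; congr 1; ring
    have ks : s ≤ q := by linarith
    have kt : p ≤ t := by linarith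
    have ih := hy.inc2 hX hE hα (by linarith) hp hqT k1 k2 k3
    have ik := hz.inc2 hX hE hα (by linarith) hp hqT k1 k2 k3
    have id := hd.inc2 hX hE hα hf hp hqT k1 k2 k3
    have b1 := hG2.dg _ _ _ (my2 s k1 ks) (hd.f0 s t k1 k2 k3)
    have b2 := hG2.dlip _ _ _ _ _ (my2 s k1 ks) (mz2 s k1 ks) (d2 s k1 ks) (hz.f0 s t k1 k2 k3)
    have b3 := hG2.tay _ _ _ _ _ (my2 s k1 ks) (mz2 s k1 ks) (d2 s k1 ks) ih
    have b4 := hG2.tay2 (z s) (y t - y s) (z t - z s) _ _ _ (mz2 s k1 ks) ih ik (id.congr (by abel) le_rfl)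
    have tot := (b1.add b2).add (b3.add b4)
    refine tot.congr ?_ ?_
    · rw [add_sub_cancel, add_sub_cancel]
      simp only [map_sub, map_smul, smul_sub]
      abel
    · have : C * (f * (t - s) ^ (2 * α)) + C * (C * a * (M * (t - s) ^ (2 * α))) +
          (C * (C * a * (M2 * (t - s) ^ α * (M2 * (t - s) ^ α))) + C * ((M2 * (t - s) ^ α + M2 * (t - s) ^ α) * ((f + P * b) * (t - s) ^ α)))
        = (C * f + C * (C * M) * a) * (t - s) ^ (2 * α) + (C * (C * (M2 * M2)) * a + C * (M2 + M2) * f + C * ((M2 + M2) * P) * b) * ((t - s) ^ α * (t - s) ^ α) := by ring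
      rw [this, hLL, ← add_mul]
      refine mul_le_mul_of_nonneg_right ?_ hLa.le
      have hPf : C * (M2 + M2) * f ≤ C * ((M2 + M2) * P) * f := by
        have : C * (M2 + M2) * f * 1 ≤ C * (M2 + M2) * f * P := mul_le_mul_of_nonneg_left hPp (by positivity)
        linarith
      set Z1 := C * (C * M)
      set Z2 := C * (C * (M2 * M2))
      set Z3 := C * ((M2 + M2) * P)
      have hZ1 : 0 ≤ Z1 := by positivity
      have hZ2 : 0 ≤ Z2 := by positivity
      have hZ3 : 0 ≤ Z3 := by positivity
      have hZ : C + Z1 + Z2 + Z3 ≤ CM := by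
        have : 0 ≤ C * C + C * (C * (C * M1)) + (Z1 + C * (M2 * C) + C * (C * (M2 * (C * M))) + C * (P * (C * M))) + C * M + C * (C * M2) := by positivity
        linarith
      have hs : 0 ≤ a + b + c + f := by positivity
      refine le_trans ?_ (mul_le_mul_of_nonneg_right hZ hs)
      have q1 : C * f ≤ C * (a + b + c + f) := by gcongr; linarith
      have q2 : Z1 * a ≤ Z1 * (a + b + c + f) := by gcongr; linarith
      have q4 : Z2 * a ≤ Z2 * (a + b + c + f) := by gcongr; linarith
      have q5 : Z3 * f + Z3 * b ≤ Z3 * (a + b + c + f) := by rw [← mul_add]; exact mul_le_mul_of_nonneg_left (by linarith) hZ3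
      linarith
  · intro t k1 k2
    exact (hE.es1 _ _ (hg0 t k1 k2)).mono (le_of_eq (by ring))
  · intro s t k1 k2 k3
    have hL : 0 < t - s := by linarith
    have hLa : 0 < (t - s) ^ α := Real.rpow_pos_of_pos hL _
    have ks : s ≤ q := by linarith
    have kt : p ≤ t := by linarith
    have ih := hy.inc1 hX hp hqT k1 k2 k3
    have id := hd.inc1 hX hp hqT k1 k2 k3
    have b1 := hG1.lip2 _ _ _ _ _ (my1 s k1 ks) (mz1 s k1 ks) (d1 s k1 ks) ih
    have mzh : 𝓑.Mem (γ - α) (z s + (y t - y s)) := 𝓑.mem_add _ _ _ (mz1 s k1 ks) ih.1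
    have b2 := hG1.lip (z s + (y t - y s)) (z t) _ mzh (mz1 t kt k3) (id.congr (by abel) le_rfl)
    refine (hE.es2 _ _ (b1.add b2)).congr ?_ ?_
    · rw [add_sub_cancel]; abel
    · have : C * (C * (C * a * (M1 * (t - s) ^ α)) + C * ((e + CX * b) * (t - s) ^ α))
        = (C * C * (e + CX * b) + C * (C * (C * M1)) * a) * (t - s) ^ α := by ring
      rw [this]
      refine mul_le_mul_of_nonneg_right ?_ hLa.le
      have h1 : C * (C * (C * M1)) * a ≤ CM * a := by
        refine mul_le_mul_of_nonneg_right ?_ ha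
        have : 0 ≤ C * C + C * (C * M)
          + (C + C * (C * M) + C * (M2 * C) + C * (C * (M2 * (C * M))) + C * (P * (C * M)))
          + (C * M + C * (C * (M2 * M2)) + C * ((M2 + M2) * P)) + C * (C * M2) := by positivity
        linarith
      linarith

end

/-- all standing assumptions -/
structure Setup (𝓑 : BanachScale) (α σ γ δ CX C : ℝ) (F G : 𝓑.E → 𝓑.E)
    (DG : 𝓑.E → 𝓑.E →ₗ[ℝ] 𝓑.E) : Prop where
  hα : 1/3 < α
  hα' : α < 1/2
  hσ : 0 ≤ σ
  hσα : σ < α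
  hδ : 0 ≤ δ
  hδ' : δ < 1
  hCX : 1 ≤ CX
  hE : Emb 𝓑 α σ γ C
  hG0 : GLev 𝓑 γ (γ - σ) C G DG
  hG1 : GLev 𝓑 (γ - α) (γ - α - σ) C G DG
  hG2 : GLev 𝓑 (γ - 2 * α) (γ - 2 * α - σ) C G DG
  hF : AssumptionF 𝓑 γ δ F

section
variable {𝓑 : BanachScale} {α σ γ δ CX C : ℝ} {F G : 𝓑.E → 𝓑.E} {DG : 𝓑.E → 𝓑.E →ₗ[ℝ] 𝓑.E}

lemma IB.mono {X : ℝ → ℝ} {p q : ℝ} {g g' : ℝ → 𝓑.E} {k K k1 K1 : ℝ} (h : IB 𝓑 α σ γ X p q g g' k K)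
    (hk : k ≤ k1) (hK : K ≤ K1) (hkK : k1 ≤ K1) : IB 𝓑 α σ γ X p q g g' k1 K1 := by
  refine ⟨hkK, fun t k1 k2 => (h.g0 t k1 k2).mono hK, fun t k1 k2 => (h.g1 t k1 k2).mono hk,
    fun s t k1 k2 k3 => (h.g2 s t k1 k2 k3).mono ?_, fun s t k1 k2 k3 => (h.gr s t k1 k2 k3).mono ?_⟩
  all_goals exact mul_le_mul_of_nonneg_right hK (Real.rpow_nonneg (by linarith) _)

lemma PB.add {X : ℝ → ℝ} {p q : ℝ} {y y' z z' : ℝ → 𝓑.E} {a b c e f a1 b1 c1 e1 f1 : ℝ}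
    (h : PB 𝓑 α γ X p q y y' a b c e f) (h1 : PB 𝓑 α γ X p q z z' a1 b1 c1 e1 f1) :
    PB 𝓑 α γ X p q (fun t => y t + z t) (fun t => y' t + z' t) (a + a1) (b + b1) (c + c1) (e + e1) (f + f1) := by
  refine ⟨fun t k1 k2 => (h.a0 t k1 k2).add (h1.a0 t k1 k2), fun t k1 k2 => (h.b0 t k1 k2).add (h1.b0 t k1 k2),
    fun s t k1 k2 k3 => ((h.c0 s t k1 k2 k3).add (h1.c0 s t k1 k2 k3)).congr ?_ (le_of_eq (by ring)),
    fun s t k1 k2 k3 => ((h.e0 s t k1 k2 k3).add (h1.e0 s t k1 k2 k3)).congr ?_ (le_of_eq (by ring)),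
    fun s t k1 k2 k3 => ((h.f0 s t k1 k2 k3).add (h1.f0 s t k1 k2 k3)).congr ?_ (le_of_eq (by ring))⟩
  all_goals try simp only [smul_add]
  all_goals abel

lemma PB.sub {X : ℝ → ℝ} {p q : ℝ} {y y' z z' : ℝ → 𝓑.E} {a b c e f a1 b1 c1 e1 f1 : ℝ}
    (h : PB 𝓑 α γ X p q y y' a b c e f) (h1 : PB 𝓑 α γ X p q z z' a1 b1 c1 e1 f1) :
    PB 𝓑 α γ X p q (fun t => y t - z t) (fun t => y' t - z' t) (a + a1) (b + b1) (c + c1) (e + e1) (f + f1) := by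
  refine ⟨fun t k1 k2 => (h.a0 t k1 k2).sub (h1.a0 t k1 k2), fun t k1 k2 => (h.b0 t k1 k2).sub (h1.b0 t k1 k2),
    fun s t k1 k2 k3 => ((h.c0 s t k1 k2 k3).sub (h1.c0 s t k1 k2 k3)).congr ?_ (le_of_eq (by ring)),
    fun s t k1 k2 k3 => ((h.e0 s t k1 k2 k3).sub (h1.e0 s t k1 k2 k3)).congr ?_ (le_of_eq (by ring)),
    fun s t k1 k2 k3 => ((h.f0 s t k1 k2 k3).sub (h1.f0 s t k1 k2 k3)).congr ?_ (le_of_eq (by ring))⟩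
  all_goals try simp only [smul_sub]
  all_goals abel

lemma PB.zero {X : ℝ → ℝ} {p q a : ℝ} (ha : 0 ≤ a) :
    PB 𝓑 α γ X p q (fun _ => 0) (fun _ => 0) a a a a a := by
  refine ⟨fun t k1 k2 => Bd.zero ha, fun t k1 k2 => Bd.zero ha, fun s t k1 k2 k3 => ?_, fun s t k1 k2 k3 => ?_,
    fun s t k1 k2 k3 => ?_⟩
  all_goals
    simp only [sub_self, smul_zero]
    exact Bd.zero (mul_nonneg ha (Real.rpow_nonneg (by linarith) _))

/-- single path composition -/
lemma comp_single (hS : Setup 𝓑 α σ γ δ CX C F G DG) {M : ℝ} (hM : 1 ≤ M) :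
    ∃ K ≥ (0:ℝ), ∀ (T : ℝ) (X : ℝ → ℝ) (X2 : ℝ → ℝ → ℝ) (p q b : ℝ) (y y' : ℝ → 𝓑.E),
      RB α CX T X X2 → 0 ≤ p → p ≤ q → q ≤ T → b ≤ M → PB 𝓑 α γ X p q y y' M b M M M →
      IB 𝓑 α σ γ X p q (fun t => G (y t)) (fun t => DG (y t) (y' t)) (C * b) K ∧
      (∀ t, p ≤ t → t ≤ q → Bd (γ - δ) (F (y t)) K) := by
  have hα := hS.hα
  obtain ⟨CM, hCM, H⟩ := comp_diff (by linarith) hS.hCX hS.hE hS.hG0 hS.hG1 hS.hG2 hM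
  obtain ⟨CF, hCF⟩ := hS.hF.linGrowth
  have hC := hS.hE.one
  have hN := 𝓑.N_nonneg (γ - σ) (G 0)
  have hCM0 : 0 ≤ CM := by nlinarith
  have m0 : 𝓑.Mem γ (0 : 𝓑.E) := 𝓑.mem_zero _
  refine ⟨C * M + CM * (M + M + M + M) + 𝓑.N (γ - σ) (G 0) + |CF| * (1 + M), by positivity,
    fun T X X2 p q b y y' hX hp hpq hqT hb hy => ?_⟩
  have hy1 := hy.mono (a1 := M) (b1 := M) (c1 := M) (e1 := M) (f1 := M) le_rfl hb le_rfl le_rfl le_rfl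
  have hz : PB 𝓑 α γ X p q (fun _ => (0 : 𝓑.E)) (fun _ => (0 : 𝓑.E)) M M M M M := PB.zero (by linarith)
  have hd : PB 𝓑 α γ X p q (fun t => y t - (fun _ => (0 : 𝓑.E)) t) (fun t => y' t - (fun _ => (0 : 𝓑.E)) t) M M M M M := by
    simpa using hy1
  obtain ⟨hI, -, -⟩ := H T X X2 p q y y' _ _ M M M M M hX hp hpq hqT (by linarith) (by linarith) hy1 hz hd
  have hp1 : 0 ≤ C * M := by positivity
  have hp2 : 0 ≤ |CF| * (1 + M) := by positivity
  have hp3 : 0 ≤ CM * (M + M + M + M) := by positivity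
  refine ⟨⟨?_, fun t k1 k2 => ?_, fun t k1 k2 => ?_, fun s t k1 k2 k3 => ?_, fun s t k1 k2 k3 => ?_⟩, fun t k1 k2 => ?_⟩
  · have : C * b ≤ C * M := by gcongr
    linarith
  · refine ((hI.g0 t k1 k2).add (Bd.of_mem (hS.hG0.mem 0 m0))).congr (by abel) (by linarith)
  · exact hS.hG1.dg _ _ _ (hS.hE.e01 _ _ (hy.a0 t k1 k2)).1 (hy.b0 t k1 k2)
  · refine (hI.g2 s t k1 k2 k3).congr (by simp) ?_
    exact mul_le_mul_of_nonneg_right (by linarith) (Real.rpow_nonneg (by linarith) _)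
  · refine (hI.gr s t k1 k2 k3).congr (by simp) ?_
    exact mul_le_mul_of_nonneg_right (by linarith) (Real.rpow_nonneg (by linarith) _)
  · have hm := hy.a0 t k1 k2
    refine ⟨hS.hF.maps _ hm.1, (hCF _ hm.1).trans ?_⟩
    have h1 := 𝓑.N_nonneg γ (y t)
    have h2 := hm.2
    have : CF * (1 + 𝓑.N γ (y t)) ≤ |CF| * (1 + M) :=
      mul_le_mul (le_abs_self _) (by linarith) (by linarith) (abs_nonneg _)
    linarith

/-- weighted smallness of a controlled path -/
def DB (𝓑 : BanachScale) (α γ : ℝ) (X : ℝ → ℝ) (p q : ℝ) (y y' : ℝ → 𝓑.E) (l κ : ℝ) : Prop :=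
  PB 𝓑 α γ X p q y y' κ (l * κ) (l * l * κ) κ (l * l * κ)

lemma contr (Sg : ScaleSemigroup 𝓑) (hS : Setup 𝓑 α σ γ δ CX C F G DG) {M : ℝ} (hM : 1 ≤ M) :
    ∃ l ≥ (1:ℝ), ∃ h > (0:ℝ), ∀ (T : ℝ) (X : ℝ → ℝ) (X2 : ℝ → ℝ → ℝ) (p q κ : ℝ) (y y' z z' W V : ℝ → 𝓑.E),
      RB α CX T X X2 → 0 ≤ p → p ≤ q → q ≤ T → q - p ≤ h → PB 𝓑 α γ X p q y y' M M M M M →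
      PB 𝓑 α γ X p q z z' M M M M M → DB 𝓑 α γ X p q (fun t => y t - z t) (fun t => y' t - z' t) l κ →
      Mild Sg α σ γ δ X X2 p q (fun t => G (y t)) (fun t => DG (y t) (y' t)) (fun t => F (y t)) W →
      Mild Sg α σ γ δ X X2 p q (fun t => G (z t)) (fun t => DG (z t) (z' t)) (fun t => F (z t)) V →
      W p = V p → DB 𝓑 α γ X p q (fun t => W t - V t) (fun t => G (y t) - G (z t)) l (κ / 2) := by
  have hα := hS.hα
  obtain ⟨CM, hCM, H⟩ := comp_diff (by linarith) hS.hCX hS.hE hS.hG0 hS.hG1 hS.hG2 hM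
  obtain ⟨C1, hC1, HS⟩ := step (γ := γ) Sg hS.hα hS.hα' hS.hσ hS.hσα hS.hδ hS.hδ' hS.hCX
  obtain ⟨L, hL⟩ := hS.hF.locLip M (by linarith)
  have hC := hS.hE.one
  have hCX := hS.hCX
  have hCM0 : 0 ≤ CM := by nlinarith
  set P := C1 * C + C1 * CM + 1 + C * C + C * C * CX + CM with hP
  have q1 : 0 ≤ C1 * C := by positivity
  have q2 : 0 ≤ C1 * CM := by positivity
  have q3 : 0 ≤ C * C := by positivity
  have q4 : 0 ≤ C * C * CX := by positivity
  have hP1 : 1 ≤ P := by linarith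
  set l := 2 * P with hl
  have hl1 : 1 ≤ l := by linarith
  have hll : l * l / 2 = l * P := by rw [hl]; ring
  have lx : ∀ x, 0 ≤ x → x ≤ l * x := fun x hx => le_mul_of_one_le_left hx hl1
  set K0 := CM * (1 + l + l * l + l * l) + |L| + (C * l + CM) with hK0
  have hK0p : 0 ≤ K0 := by positivity
  have hη := eta_pos (δ := δ) hS.hα' hS.hσα hS.hδ'
  obtain ⟨h, hh, -, Hh⟩ := small_rpow (A := C1 * K0) (η := eta α σ δ) (ε := 1/4) (by positivity) hη (by norm_num)
  refine ⟨l, hl1, h, hh, fun T X X2 p q κ y y' z z' W V hX hp hpq hqT hqp hy hz hd hW hV h0 => ?_⟩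
  have hκ : 0 ≤ κ := (hd.a0 p le_rfl hpq).nonneg
  have hll0 : 0 ≤ l * l * κ := by positivity
  obtain ⟨hI, hb, hc⟩ := H T X X2 p q y y' z z' _ _ _ _ _ hX hp hpq hqT hll0 hll0 hy hz hd
  have e1 := Hh (q - p) (by linarith) hqp
  have hI' := hI.mono (k1 := (C * l + CM) * κ) (K1 := K0 * κ) (le_of_eq (by ring)) ?_ ?_
  rotate_left
  · have h1 : 0 ≤ |L| * κ := by positivity
    have h2 : 0 ≤ (C * l + CM) * κ := by positivity
    rw [hK0]; linarith
  · have h1 : 0 ≤ |L| * κ := by positivity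
    have h2 : 0 ≤ CM * (1 + l + l * l + l * l) * κ := by positivity
    rw [hK0]; linarith
  have hf : ∀ t, p ≤ t → t ≤ q → Bd (γ - δ) (F (y t) - F (z t)) (K0 * κ) := by
    intro t k1 k2
    have a1 := hy.a0 t k1 k2
    have a2 := hz.a0 t k1 k2
    have a3 := hd.a0 t k1 k2
    refine ⟨((Bd.of_mem (hS.hF.maps _ a1.1)).sub (Bd.of_mem (hS.hF.maps _ a2.1))).1, (hL _ _ a1.1 a2.1 a1.2 a2.2).trans ?_⟩
    have h3 : L * 𝓑.N γ (y t - z t) ≤ |L| * κ :=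
      mul_le_mul (le_abs_self _) a3.2 (𝓑.N_nonneg _ _) (abs_nonneg _)
    have h1 : 0 ≤ CM * (1 + l + l * l + l * l) * κ := by positivity
    have h2 : 0 ≤ (C * l + CM) * κ := by positivity
    rw [hK0]; linarith
  have hw0 : Bd γ (W p - V p) 0 := by rw [h0, sub_self]; exact Bd.zero le_rfl
  obtain ⟨s1, s2, s3, -⟩ := HS T X X2 p q _ _ _ _ _ _ 0 _ hX hp hpq hqT hI' hf (hW.sub Sg hV) hw0 le_rfl
  have e2 : C1 * (K0 * κ) * (q - p) ^ eta α σ δ ≤ κ / 4 := by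
    have := mul_le_mul_of_nonneg_right e1 hκ
    linarith
  refine ⟨fun t k1 k2 => (s1 t k1 k2).mono (by linarith), fun t k1 k2 => (hb t k1 k2).mono ?_,
    fun s t k1 k2 k3 => (hc s t k1 k2 k3).mono ?_, fun s t k1 k2 k3 => (s2 s t k1 k2 k3).mono ?_,
    fun s t k1 k2 k3 => (s3 s t k1 k2 k3).mono ?_⟩
  · have : C * C * κ ≤ P * κ := mul_le_mul_of_nonneg_right (by linarith) hκ
    rw [hl]; linarith
  · refine mul_le_mul_of_nonneg_right ?_ (Real.rpow_nonneg (by linarith) _)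
    have h1 : C * C * (1 + CX * l) + CM ≤ l * P := by
      rw [hP]
      have := lx _ q1; have := lx _ q2; have := lx _ q3; have := lx _ q4; have := lx _ hCM0
      linarith
    have := mul_le_mul_of_nonneg_right h1 hκ
    have h2 : l * l * (κ / 2) = l * P * κ := by rw [← hll]; ring
    rw [h2]; linarith
  · exact mul_le_mul_of_nonneg_right (by linarith) (Real.rpow_nonneg (by linarith) _)
  · refine mul_le_mul_of_nonneg_right ?_ (Real.rpow_nonneg (by linarith) _)
    have h1 : C1 * (C * l + CM) + 1/4 ≤ l * P := by
      rw [hP]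
      have := lx _ q1; have := lx _ q2; have := lx _ q3; have := lx _ q4; have := lx _ hCM0
      linarith
    have := mul_le_mul_of_nonneg_right h1 hκ
    have h2 : l * l * (κ / 2) = l * P * κ := by rw [← hll]; ring
    rw [h2]; linarith

/-- self mapping -/
lemma selfmap (Sg : ScaleSemigroup 𝓑) (hS : Setup 𝓑 α σ γ δ CX C F G DG) {w : ℝ} (hw : 0 ≤ w) :
    ∃ A B Q R M : ℝ, 1 ≤ M ∧ A ≤ M ∧ B ≤ M ∧ Q ≤ M ∧ R ≤ M ∧ ∃ h > (0:ℝ),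
      (∀ (T : ℝ) (X : ℝ → ℝ) (X2 : ℝ → ℝ → ℝ) (p q : ℝ) (y y' W : ℝ → 𝓑.E),
      RB α CX T X X2 → 0 ≤ p → p ≤ q → q ≤ T → q - p ≤ h → PB 𝓑 α γ X p q y y' A B Q A R →
      Mild Sg α σ γ δ X X2 p q (fun t => G (y t)) (fun t => DG (y t) (y' t)) (fun t => F (y t)) W →
      Bd γ (W p) w → PB 𝓑 α γ X p q W (fun t => G (y t)) A B Q A R ∧ COn γ p q W) ∧
      (∀ (T : ℝ) (X : ℝ → ℝ) (X2 : ℝ → ℝ → ℝ) (p q : ℝ) (W : ℝ → 𝓑.E),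
      RB α CX T X X2 → 0 ≤ p → p ≤ q → q ≤ T →
      Mild Sg α σ γ δ X X2 p q (fun _ => 0) (fun _ => 0) (fun _ => 0) W →
      Bd γ (W p) w → PB 𝓑 α γ X p q W (fun _ => 0) A B Q A R ∧ COn γ p q W) := by
  have hα := hS.hα
  obtain ⟨C1, hC1, HS⟩ := step (γ := γ) Sg hS.hα hS.hα' hS.hσ hS.hσα hS.hδ hS.hδ' hS.hCX
  have hC := hS.hE.one
  have hCX := hS.hCX
  have hN := 𝓑.N_nonneg (γ - σ) (G 0)
  have m0 : 𝓑.Mem γ (0 : 𝓑.E) := 𝓑.mem_zero _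
  have hη := eta_pos (δ := δ) hS.hα' hS.hσα hS.hδ'
  set A := C1 * w + 1 with hA
  have hw1 : 0 ≤ C1 * w := by positivity
  have hA0 : 0 ≤ A := by linarith
  set B := C * (𝓑.N (γ - σ) (G 0) + C * A) with hB
  have hB0 : 0 ≤ B := by positivity
  set Q := C * (C * (A + CX * B)) with hQ
  have hQ0 : 0 ≤ Q := by positivity
  set R := C1 * w + C1 * (C * B) + 1 with hR
  have hR0 : 0 ≤ R := by positivity
  set M := 1 + A + B + Q + R with hMd
  have hM : 1 ≤ M := by linarith
  obtain ⟨K, hK, H⟩ := comp_single hS hM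
  obtain ⟨h, hh, -, Hh⟩ := small_rpow (A := C1 * K) (η := eta α σ δ) (ε := 1) (by positivity) hη (by norm_num)
  refine ⟨A, B, Q, R, M, hM, by linarith, by linarith, by linarith, by linarith, h, hh, ?_, ?_⟩
  · intro T X X2 p q y y' W hX hp hpq hqT hqp hy hW hw0
    have hT := hX.Tle
    have hy1 := hy.mono (a1 := M) (b1 := B) (c1 := M) (e1 := M) (f1 := M) (by linarith) le_rfl (by linarith) (by linarith) (by linarith)
    obtain ⟨hI, hf⟩ := H T X X2 p q B y y' hX hp hpq hqT (by linarith) hy1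
    obtain ⟨s1, s2, s3, s4⟩ := HS T X X2 p q _ _ _ _ _ _ w _ hX hp hpq hqT hI hf hW hw0 le_rfl
    have e1 := Hh (q - p) (by linarith) hqp
    refine ⟨⟨fun t k1 k2 => (s1 t k1 k2).mono (by linarith), fun t k1 k2 => ?_, fun s t k1 k2 k3 => ?_,
      fun s t k1 k2 k3 => (s2 s t k1 k2 k3).mono ?_, fun s t k1 k2 k3 => (s3 s t k1 k2 k3).mono ?_⟩, ?_⟩
    · have a1 := hy.a0 t k1 k2
      refine hS.hE.es1 _ _ ?_
      refine ((hS.hG0.lip (y t) 0 A a1.1 m0 (by simpa using a1)).add (Bd.of_mem (hS.hG0.mem 0 m0))).congr (by abel) (by linarith)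
    · have a1 := hy.inc1 hX hp hqT k1 k2 k3
      have n1 := (hS.hE.e01 _ _ (hy.a0 t (by linarith) k3)).1
      have n2 := (hS.hE.e01 _ _ (hy.a0 s k1 (by linarith))).1
      exact (hS.hE.es2 _ _ (hS.hG1.lip _ _ _ n1 n2 a1)).mono (le_of_eq (by rw [hQ]; ring))
    · exact mul_le_mul_of_nonneg_right (by linarith) (Real.rpow_nonneg (by linarith) _)
    · exact mul_le_mul_of_nonneg_right (by linarith) (Real.rpow_nonneg (by linarith) _)
    · exact con_of_incr Sg hη (by positivity) (by linarith) (fun t k1 k2 => (s1 t k1 k2).1) s4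
  · intro T X X2 p q W hX hp hpq hqT hW hw0
    have hT := hX.Tle
    have hI : IB 𝓑 α σ γ X p q (fun _ => (0 : 𝓑.E)) (fun _ => (0 : 𝓑.E)) 0 0 := by
      refine ⟨le_rfl, fun t k1 k2 => Bd.zero le_rfl, fun t k1 k2 => Bd.zero le_rfl, fun s t k1 k2 k3 => ?_, fun s t k1 k2 k3 => ?_⟩
      all_goals
        simp only [sub_self, smul_zero, zero_mul]
        exact Bd.zero le_rfl
    obtain ⟨s1, s2, s3, s4⟩ := HS T X X2 p q _ _ _ _ _ _ w _ hX hp hpq hqT hI (fun t k1 k2 => Bd.zero le_rfl) hW hw0 le_rfl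
    have : 0 ≤ C1 * (C * B) := by positivity
    refine ⟨⟨fun t k1 k2 => (s1 t k1 k2).mono (by linarith), fun t k1 k2 => Bd.zero hB0, fun s t k1 k2 k3 => ?_,
      fun s t k1 k2 k3 => (s2 s t k1 k2 k3).mono ?_, fun s t k1 k2 k3 => (s3 s t k1 k2 k3).mono ?_⟩, ?_⟩
    · simp only [sub_self]
      exact Bd.zero (mul_nonneg hQ0 (Real.rpow_nonneg (by linarith) _))
    · exact mul_le_mul_of_nonneg_right (by linarith) (Real.rpow_nonneg (by linarith) _)
    · exact mul_le_mul_of_nonneg_right (by linarith) (Real.rpow_nonneg (by linarith) _)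
    · exact con_of_incr Sg hη (by simp) (by linarith) (fun t k1 k2 => (s1 t k1 k2).1) s4

end

section
variable {𝓑 : BanachScale} {α σ γ δ CX C : ℝ} {F G : 𝓑.E → 𝓑.E} {DG : 𝓑.E → 𝓑.E →ₗ[ℝ] 𝓑.E}

lemma con_F (hF : AssumptionF 𝓑 γ δ F) {p q M : ℝ} {y : ℝ → 𝓑.E} (hM : 0 < M) (hy : COn γ p q y)
    (hb : ∀ t, p ≤ t → t ≤ q → Bd γ (y t) M) : COn (γ - δ) p q (fun t => F (y t)) := by
  obtain ⟨L, hL⟩ := hF.locLip M hM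
  refine ⟨fun t k1 k2 => hF.maps _ (hy.1 t k1 k2), fun t k1 k2 ε hε => ?_⟩
  obtain ⟨r, hr, H⟩ := hy.2 t k1 k2 (ε / (|L| + 1)) (by positivity)
  refine ⟨r, hr, fun s k3 k4 k5 => ?_⟩
  have h1 := hb t k1 k2
  have h2 := hb s k3 k4
  have h3 := H s k3 k4 k5
  rw [lt_div_iff₀ (by positivity)] at h3
  have h4 := hL _ _ h2.1 h1.1 h2.2 h1.2
  have h5 := 𝓑.N_nonneg γ (y s - y t)
  have h6 : L * 𝓑.N γ (y s - y t) ≤ |L| * 𝓑.N γ (y s - y t) := mul_le_mul_of_nonneg_right (le_abs_self _) h5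
  change 𝓑.N (γ - δ) (F (y s) - F (y t)) < ε
  linarith

lemma con_G (hS : Setup 𝓑 α σ γ δ CX C F G DG) {p q : ℝ} {y : ℝ → 𝓑.E} (hy : COn γ p q y) :
    COn (γ - α) p q (fun t => G (y t)) := by
  have hC := hS.hE.one
  refine ⟨fun t k1 k2 => (hS.hE.es1 _ _ (Bd.of_mem (hS.hG0.mem _ (hy.1 t k1 k2)))).1, fun t k1 k2 ε hε => ?_⟩
  obtain ⟨r, hr, H⟩ := hy.2 t k1 k2 (ε / (C * C)) (by positivity)
  refine ⟨r, hr, fun s k3 k4 k5 => ?_⟩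
  have h3 := H s k3 k4 k5
  rw [lt_div_iff₀ (by positivity)] at h3
  have h1 : Bd γ (y s - y t) (𝓑.N γ (y s - y t)) :=
    Bd.of_mem ((Bd.of_mem (hy.1 s k3 k4)).sub (Bd.of_mem (hy.1 t k1 k2))).1
  have h2 := (hS.hE.es1 _ _ (hS.hG0.lip _ _ _ (hy.1 s k3 k4) (hy.1 t k1 k2) h1)).2
  change 𝓑.N (γ - α) (G (y s) - G (y t)) < ε
  linarith

lemma con_lim {θ p q : ℝ} {y : ℝ → 𝓑.E}
    (h : ∀ ε > 0, ∃ u, COn θ p q u ∧ ∀ t, p ≤ t → t ≤ q → Bd θ (y t - u t) ε) : COn θ p q y := by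
  have hm : ∀ t, p ≤ t → t ≤ q → 𝓑.Mem θ (y t) := fun t k1 k2 => by
    obtain ⟨u, hu, H⟩ := h 1 one_pos
    have := 𝓑.mem_add _ _ _ (H t k1 k2).1 (hu.1 t k1 k2)
    simpa using this
  refine ⟨hm, fun t k1 k2 ε hε => ?_⟩
  obtain ⟨u, hu, H⟩ := h (ε/4) (by linarith)
  obtain ⟨r, hr, Hr⟩ := hu.2 t k1 k2 (ε/4) (by linarith)
  refine ⟨r, hr, fun s k3 k4 k5 => ?_⟩
  have h1 : Bd θ (u s - u t) (ε/4) := ⟨((Bd.of_mem (hu.1 s k3 k4)).sub (Bd.of_mem (hu.1 t k1 k2))).1, (Hr s k3 k4 k5).le⟩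
  have h2 : Bd θ (y s - y t) (ε/4 + ε/4 + ε/4) := (((H s k3 k4).add h1).sub (H t k1 k2)).congr (by abel) le_rfl
  have := h2.2
  linarith

/-- decomposition of a mild path started at `y0` -/
def Dec (Sg : ScaleSemigroup 𝓑) (α σ γ δ : ℝ) (X : ℝ → ℝ) (X2 : ℝ → ℝ → ℝ) (q : ℝ)
    (g g' f : ℝ → 𝓑.E) (y0 : 𝓑.E) (W : ℝ → 𝓑.E) : Prop :=
  ∃ (e v : ℝ → 𝓑.E) (C : ℝ), e 0 = 0 ∧ v 0 = 0 ∧ IsDr Sg (γ - δ) 0 q f e ∧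
    IsSew Sg α σ γ X X2 0 q g g' v C ∧ ∀ t, 0 ≤ t → t ≤ q → W t = Sg.S t y0 + e t + v t

variable (Sg : ScaleSemigroup 𝓑)

lemma Dec.mild {X : ℝ → ℝ} {X2 : ℝ → ℝ → ℝ} {q : ℝ} {g g' f W : ℝ → 𝓑.E} {y0 : 𝓑.E}
    (h : Dec Sg α σ γ δ X X2 q g g' f y0 W) : Mild Sg α σ γ δ X X2 0 q g g' f W := by
  obtain ⟨e, v, C, -, -, h1, h2, h3⟩ := h
  refine ⟨e, v, C, h1, h2, fun s t k1 k2 k3 => ?_⟩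
  rw [h3 t (by linarith) k3, h3 s k1 (by linarith)]
  have := sg_add' Sg (a := 0) k1 k2.le y0
  rw [sub_zero, sub_zero] at this
  simp only [map_add, this]
  abel

lemma Dec.init {X : ℝ → ℝ} {X2 : ℝ → ℝ → ℝ} {q : ℝ} (hq : 0 ≤ q) {g g' f W : ℝ → 𝓑.E} {y0 : 𝓑.E}
    (h : Dec Sg α σ γ δ X X2 q g g' f y0 W) : W 0 = y0 := by
  obtain ⟨e, v, C, h0, h1, -, -, h3⟩ := h
  rw [h3 0 le_rfl hq, h0, h1, Sg.S_id]; simp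

lemma dec_exist (hS : Setup 𝓑 α σ γ δ CX C F G DG) {M : ℝ} (hM : 1 ≤ M) {T : ℝ} {X : ℝ → ℝ} {X2 : ℝ → ℝ → ℝ} {q : ℝ}
    {y y' : ℝ → 𝓑.E} (hX : RB α CX T X X2) (hq : 0 ≤ q) (hqT : q ≤ T)
    (hy : PB 𝓑 α γ X 0 q y y' M M M M M) (hc : COn γ 0 q y) (y0 : 𝓑.E) :
    ∃ W, Dec Sg α σ γ δ X X2 q (fun t => G (y t)) (fun t => DG (y t) (y' t)) (fun t => F (y t)) y0 W := by
  have hT := hX.Tle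
  obtain ⟨K, hK, H⟩ := comp_single hS hM
  obtain ⟨hI, -⟩ := H T X X2 0 q M y y' hX le_rfl hq hqT le_rfl hy
  obtain ⟨A, hA, HA⟩ := rough_main (γ := γ) Sg hS.hα hS.hα' hS.hσ hS.hσα hS.hCX
  obtain ⟨⟨v, hv0, hv⟩, -⟩ := HA T X X2 0 q _ _ _ _ hX le_rfl hq hqT hI
  obtain ⟨e, he0, he⟩ := drift_exist Sg (con_F hS.hF (by linarith) hc hy.a0) hq (by linarith)
  exact ⟨fun t => Sg.S t y0 + e t + v t, e, v, _, he0, hv0, he, hv, fun t _ _ => rfl⟩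

lemma PB.lim (hE : Emb 𝓑 α σ γ C) {X : ℝ → ℝ} {p q : ℝ} {u u' : ℝ → 𝓑.E} {a b c e f : ℝ}
    (h : ∀ ε > 0, ∃ y y', PB 𝓑 α γ X p q y y' a b c e f ∧ (∀ t, p ≤ t → t ≤ q → Bd γ (u t - y t) ε) ∧
      ∀ t, p ≤ t → t ≤ q → Bd (γ - α) (u' t - y' t) ε) :
    PB 𝓑 α γ X p q u u' a b c e f := by
  have hC := hE.one
  refine ⟨fun t k1 k2 => Bd.lim fun ε hε => ?_, fun t k1 k2 => Bd.lim fun ε hε => ?_,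
    fun s t k1 k2 k3 => Bd.lim fun ε hε => ?_, fun s t k1 k2 k3 => Bd.lim fun ε hε => ?_,
    fun s t k1 k2 k3 => Bd.lim fun ε hε => ?_⟩
  · obtain ⟨y, y', h1, h2, h3⟩ := h ε hε
    exact ⟨y t, h1.a0 t k1 k2, h2 t k1 k2⟩
  · obtain ⟨y, y', h1, h2, h3⟩ := h ε hε
    exact ⟨y' t, h1.b0 t k1 k2, h3 t k1 k2⟩
  · obtain ⟨y, y', h1, h2, h3⟩ := h (ε / (2 * C)) (by positivity)
    refine ⟨_, h1.c0 s t k1 k2 k3, ((hE.e12 _ _ (h3 t (by linarith) k3)).sub (hE.e12 _ _ (h3 s k1 (by linarith)))).congr (by abel) (le_of_eq ?_)⟩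
    field_simp; ring
  · have hx := abs_nonneg (X t - X s)
    obtain ⟨y, y', h1, h2, h3⟩ := h (ε / (2 * C + |X t - X s|)) (by positivity)
    refine ⟨_, h1.e0 s t k1 k2 k3, (((hE.e01 _ _ (h2 t (by linarith) k3)).sub (hE.e01 _ _ (h2 s k1 (by linarith)))).sub
      ((h3 s k1 (by linarith)).smul (c := X t - X s) le_rfl)).congr ?_ (le_of_eq ?_)⟩
    · rw [smul_sub]; abel
    · have : 2 * C + |X t - X s| ≠ 0 := by positivity
      field_simp; ring
  · have hx := abs_nonneg (X t - X s)
    obtain ⟨y, y', h1, h2, h3⟩ := h (ε / (2 * C + |X t - X s| * C)) (by positivity)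
    refine ⟨_, h1.f0 s t k1 k2 k3, (((hE.e02 _ _ (h2 t (by linarith) k3)).sub (hE.e02 _ _ (h2 s k1 (by linarith)))).sub
      ((hE.e12 _ _ (h3 s k1 (by linarith))).smul (c := X t - X s) le_rfl)).congr ?_ (le_of_eq ?_)⟩
    · rw [smul_sub]; abel
    · have : 2 * C + |X t - X s| * C ≠ 0 := by positivity
      field_simp; ring

lemma DB.add {X : ℝ → ℝ} {p q l κ κ1 : ℝ} {y y' z z' : ℝ → 𝓑.E}
    (h : DB 𝓑 α γ X p q y y' l κ) (h1 : DB 𝓑 α γ X p q z z' l κ1) :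
    DB 𝓑 α γ X p q (fun t => y t + z t) (fun t => y' t + z' t) l (κ + κ1) := by
  exact (PB.add h h1).mono le_rfl (le_of_eq (by ring)) (le_of_eq (by ring)) le_rfl (le_of_eq (by ring))

lemma DB.mono {X : ℝ → ℝ} {p q l κ κ1 : ℝ} (hl : 1 ≤ l) {y y' : ℝ → 𝓑.E}
    (h : DB 𝓑 α γ X p q y y' l κ) (hk : κ ≤ κ1) : DB 𝓑 α γ X p q y y' l κ1 := by
  refine PB.mono h hk ?_ ?_ hk ?_ <;> gcongr

lemma DB.of_PB {X : ℝ → ℝ} {p q l κ : ℝ} (hl : 1 ≤ l) (hk : 0 ≤ κ) {y y' : ℝ → 𝓑.E}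
    (h : PB 𝓑 α γ X p q y y' κ κ κ κ κ) : DB 𝓑 α γ X p q y y' l κ := by
  have h1 : κ ≤ l * κ := le_mul_of_one_le_left hk hl
  have h2 : l * κ ≤ l * (l * κ) := le_mul_of_one_le_left (by positivity) hl
  exact PB.mono h le_rfl h1 (by linarith) le_rfl (by linarith)

/-- uniqueness from the contraction -/
lemma uniq (hS : Setup 𝓑 α σ γ δ CX C F G DG) {M : ℝ} (hM : 1 ≤ M) {T : ℝ} {X : ℝ → ℝ} {X2 : ℝ → ℝ → ℝ} {q : ℝ}
    {y z : ℝ → 𝓑.E} (hX : RB α CX T X X2) (hqT : q ≤ T)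
    (hy : PB 𝓑 α γ X 0 q y (fun t => G (y t)) M M M M M) (hz : PB 𝓑 α γ X 0 q z (fun t => G (z t)) M M M M M)
    (my : Mild Sg α σ γ δ X X2 0 q (fun t => G (y t)) (fun t => DG (y t) (G (y t))) (fun t => F (y t)) y)
    (mz : Mild Sg α σ γ δ X X2 0 q (fun t => G (z t)) (fun t => DG (z t) (G (z t))) (fun t => F (z t)) z)
    (h0 : y 0 = z 0) : ∀ t, 0 ≤ t → t ≤ q → y t = z t := by
  obtain ⟨l, hl, h, hh, H⟩ := contr Sg hS hM
  have loc : ∀ p, 0 ≤ p → p ≤ q → y p = z p → ∀ t, p ≤ t → t ≤ p + h → t ≤ q → y t = z t := by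
    intro p hp hpq hpe t k1 k2 k3
    have ry := hy.restrict hp k3
    have rz := hz.restrict hp k3
    have it : ∀ n : ℕ, DB 𝓑 α γ X p t (fun t => y t - z t) (fun t => G (y t) - G (z t)) l ((M + M) * (1/2) ^ n) := by
      intro n
      induction n with
      | zero =>
        rw [pow_zero, mul_one]
        exact DB.of_PB hl (by linarith) (ry.sub rz)
      | succ n ih =>
        refine (H T X X2 p t _ y _ z _ y z hX hp k1 (by linarith) (by linarith) ry rz ih (my.restrict Sg hp k3) (mz.restrict Sg hp k3) hpe).mono hl (le_of_eq ?_)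
        rw [pow_succ]; ring
    refine sub_eq_zero.1 (Bd.eq_zero (θ := γ) fun ε hε => ?_)
    obtain ⟨n, hn⟩ := exists_pow_lt_of_lt_one (show 0 < ε / (M + M) by positivity) (show (1/2 : ℝ) < 1 by norm_num)
    refine ((it n).a0 t k1 le_rfl).mono ?_
    rw [lt_div_iff₀ (by positivity)] at hn
    linarith
  have ind : ∀ n : ℕ, ∀ t, 0 ≤ t → t ≤ q → t ≤ n * h → y t = z t := by
    intro n
    induction n with
    | zero =>
      intro t k1 k2 k3
      have : t = 0 := by simp at k3; linarith
      rw [this, h0]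
    | succ n ih =>
      intro t k1 k2 k3
      push_cast at k3
      rcases le_total t (n * h) with k4 | k4
      · exact ih t k1 k2 k4
      · exact loc (n * h) (by positivity) (by linarith) (ih _ (by positivity) (by linarith) le_rfl) t k4 (by linarith) k2
  intro t k1 k2
  obtain ⟨n, hn⟩ := exists_nat_ge (t / h)
  refine ind n t k1 k2 ?_
  rwa [div_le_iff₀ hh] at hn

end

section
variable {𝓑 : BanachScale} {α σ γ δ CX C : ℝ} {F G : 𝓑.E → 𝓑.E} {DG : 𝓑.E → 𝓑.E →ₗ[ℝ] 𝓑.E}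
variable (Sg : ScaleSemigroup 𝓑)

lemma dec_zero {X : ℝ → ℝ} {X2 : ℝ → ℝ → ℝ} {q : ℝ} (y0 : 𝓑.E) :
    Dec Sg α σ γ δ X X2 q (fun _ => 0) (fun _ => 0) (fun _ => 0) y0 (fun t => Sg.S t y0) := by
  refine ⟨fun _ => 0, fun _ => 0, 0, rfl, rfl, fun ε hε => ⟨1, one_pos, fun s t k1 k2 k3 k4 => ?_⟩,
    fun s t k1 k2 k3 => ?_, fun t _ _ => by simp⟩
  · simp only [map_zero, smul_zero, sub_zero]
    exact Bd.zero (mul_nonneg hε.le (by linarith))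
  · simp only [germ, map_zero, smul_zero, sub_zero, add_zero, zero_mul]
    exact Bd.zero le_rfl

lemma exist_loc (hS : Setup 𝓑 α σ γ δ CX C F G DG) {y0 : 𝓑.E} {w : ℝ} (hy0 : Bd γ y0 w) :
    ∃ h > (0:ℝ), ∀ (T : ℝ) (X : ℝ → ℝ) (X2 : ℝ → ℝ → ℝ) (q : ℝ), RB α CX T X X2 → 0 ≤ q → q ≤ T → q ≤ h →
      ∃ M ≥ (1:ℝ), ∃ y : ℝ → 𝓑.E, PB 𝓑 α γ X 0 q y (fun t => G (y t)) M M M M M ∧ COn γ 0 q y ∧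
        Dec Sg α σ γ δ X X2 q (fun t => G (y t)) (fun t => DG (y t) (G (y t))) (fun t => F (y t)) y0 y := by
  obtain ⟨A, B, Q, R, M, hM, hA, hB, hQ, hR, h1, hh1, Hs, Hb⟩ := selfmap Sg hS hy0.nonneg
  obtain ⟨l, hl, h2, hh2, Hc⟩ := contr Sg hS hM
  refine ⟨min h1 h2, lt_min hh1 hh2, fun T X X2 q hX hq hqT hqh => ⟨M, hM, ?_⟩⟩
  have hC := hS.hE.one
  have hq1 : q - 0 ≤ h1 := by linarith [hqh.trans (min_le_left _ _)]
  have hq2 : q - 0 ≤ h2 := by linarith [hqh.trans (min_le_right _ _)]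
  let P : (ℝ → 𝓑.E) × (ℝ → 𝓑.E) → Prop := fun u => PB 𝓑 α γ X 0 q u.1 u.2 A B Q A R ∧ COn γ 0 q u.1
  have toM : ∀ {y y'}, PB 𝓑 α γ X 0 q y y' A B Q A R → PB 𝓑 α γ X 0 q y y' M M M M M :=
    fun h => h.mono hA hB hQ hA hR
  have base : P (fun t => Sg.S t y0, fun _ => 0) :=
    Hb T X X2 0 q _ hX le_rfl hq hqT ((dec_zero Sg y0).mild Sg) (by simpa [Sg.S_id] using hy0)
  have stp : ∀ u : {u // P u}, ∃ w : {u // P u}, w.1.2 = (fun t => G (u.1.1 t)) ∧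
      Dec Sg α σ γ δ X X2 q (fun t => G (u.1.1 t)) (fun t => DG (u.1.1 t) (u.1.2 t)) (fun t => F (u.1.1 t)) y0 w.1.1 := by
    rintro ⟨⟨u, u'⟩, hu, huc⟩
    obtain ⟨W, hW⟩ := dec_exist Sg hS hM hX hq hqT (toM hu) huc y0
    exact ⟨⟨(W, fun t => G (u t)), Hs T X X2 0 q u u' W hX le_rfl hq hqT hq1 hu (hW.mild Sg)
      (by rw [hW.init Sg hq]; exact hy0)⟩, rfl, hW⟩
  choose nx nx1 nx2 using stp
  let sq : ℕ → {u // P u} := fun n => Nat.rec ⟨_, base⟩ (fun _ u => nx u) n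
  let Y : ℕ → ℝ → 𝓑.E := fun n => (sq n).1.1
  let Y' : ℕ → ℝ → 𝓑.E := fun n => (sq n).1.2
  have hYA : ∀ n, PB 𝓑 α γ X 0 q (Y n) (Y' n) A B Q A R := fun n => (sq n).2.1
  have hY : ∀ n, PB 𝓑 α γ X 0 q (Y n) (Y' n) M M M M M := fun n => toM (hYA n)
  have hYc : ∀ n, COn γ 0 q (Y n) := fun n => (sq n).2.2
  have hY' : ∀ n, Y' (n + 1) = fun t => G (Y n t) := fun n => nx1 (sq n)
  have hYd : ∀ n, Dec Sg α σ γ δ X X2 q (fun t => G (Y n t)) (fun t => DG (Y n t) (Y' n t)) (fun t => F (Y n t)) y0 (Y (n + 1)) :=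
    fun n => nx2 (sq n)
  set κ := M + M with hκ
  have hκ0 : 0 < κ := by linarith
  have D : ∀ n, DB 𝓑 α γ X 0 q (fun t => Y (n + 1) t - Y n t) (fun t => Y' (n + 1) t - Y' n t) l (κ * (1/2) ^ n) := by
    intro n
    induction n with
    | zero =>
      rw [pow_zero, mul_one]
      exact DB.of_PB hl hκ0.le ((hY 1).sub (hY 0))
    | succ n ih =>
      have := Hc T X X2 0 q _ _ _ _ _ _ _ hX le_rfl hq hqT hq2 (hY (n + 1)) (hY n) ih ((hYd (n + 1)).mild Sg) ((hYd n).mild Sg)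
        (((hYd (n + 1)).init Sg hq).trans ((hYd n).init Sg hq).symm)
      rw [hY' (n + 1), hY' n]
      refine this.mono hl (le_of_eq ?_)
      rw [pow_succ]; ring
  have D2 : ∀ k n, DB 𝓑 α γ X 0 q (fun t => Y (n + k) t - Y n t) (fun t => Y' (n + k) t - Y' n t) l (2 * κ * (1/2) ^ n) := by
    intro k
    induction k with
    | zero =>
      intro n
      simp only [add_zero, sub_self]
      exact DB.of_PB hl (by positivity) (PB.zero (by positivity))
    | succ k ih =>
      intro n
      have := DB.add (ih (n + 1)) (D n)
      rw [show n + 1 + k = n + (k + 1) by ring] at this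
      simp only [sub_add_sub_cancel] at this
      refine this.mono hl (le_of_eq ?_)
      rw [pow_succ]; ring
  have lim : ∀ t, ∃ x, 0 ≤ t → t ≤ q → ∀ n, Bd γ (x - Y n t) (2 * κ * (1/2) ^ n) := by
    intro t
    by_cases ht : 0 ≤ t ∧ t ≤ q
    · obtain ⟨x, hx⟩ := bd_geom (θ := γ) (c := κ) (q := 1/2) (fun n => Y n t) (by norm_num) (by norm_num)
        (fun n => (D n).a0 t ht.1 ht.2)
      exact ⟨x, fun _ _ n => (hx n).mono (le_of_eq (by ring))⟩
    · exact ⟨0, fun k1 k2 => absurd ⟨k1, k2⟩ ht⟩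
  choose y hy using lim
  have small : ∀ ε > 0, ∃ N : ℕ, ∀ n ≥ N, 2 * κ * (1/2) ^ n ≤ ε := by
    intro ε hε
    obtain ⟨N, hN⟩ := exists_pow_lt_of_lt_one (show 0 < ε / (2 * κ) by positivity) (show (1/2 : ℝ) < 1 by norm_num)
    rw [lt_div_iff₀ (by positivity)] at hN
    refine ⟨N, fun n hn => ?_⟩
    have : (1/2 : ℝ) ^ n ≤ (1/2) ^ N := pow_le_pow_of_le_one (by norm_num) (by norm_num) hn
    have := mul_le_mul_of_nonneg_left this (show 0 ≤ 2 * κ by positivity)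
    linarith
  have ym : ∀ t, 0 ≤ t → t ≤ q → 𝓑.Mem γ (y t) := fun t k1 k2 => by
    have := 𝓑.mem_add _ _ _ (hy t k1 k2 0).1 ((hY 0).a0 t k1 k2).1
    simpa using this
  have app : ∀ ε > 0, ∃ N : ℕ, ∀ n ≥ N, (∀ t, 0 ≤ t → t ≤ q → Bd γ (y t - Y n t) ε) ∧
      ∀ t, 0 ≤ t → t ≤ q → Bd (γ - α) (G (y t) - Y' (n + 1) t) ε := by
    intro ε hε
    obtain ⟨N, hN⟩ := small (ε / (C * C)) (by positivity)
    have hCC : 1 ≤ C * C := by nlinarith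
    refine ⟨N, fun n hn => ⟨fun t k1 k2 => (hy t k1 k2 n).mono ((hN n hn).trans (div_le_self hε.le hCC)), fun t k1 k2 => ?_⟩⟩
    rw [hY' n]
    refine (hS.hE.es1 _ _ (hS.hG0.lip _ _ _ (ym t k1 k2) ((hY n).a0 t k1 k2).1 (hy t k1 k2 n))).mono ?_
    have := hN n hn
    rw [le_div_iff₀ (by positivity)] at this
    linarith
  have Py : PB 𝓑 α γ X 0 q y (fun t => G (y t)) M M M M M := by
    refine PB.lim hS.hE fun ε hε => ?_
    obtain ⟨N, hN⟩ := app ε hε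
    exact ⟨_, _, hY (N + 1), (hN (N + 1) (by omega)).1, (hN N le_rfl).2⟩
  have yc : COn γ 0 q y := by
    refine con_lim fun ε hε => ?_
    obtain ⟨N, hN⟩ := app ε hε
    exact ⟨Y N, hYc N, (hN N le_rfl).1⟩
  have Dy : ∀ n, DB 𝓑 α γ X 0 q (fun t => y t - Y n t) (fun t => G (y t) - Y' n t) l (2 * κ * (1/2) ^ n) := by
    intro n
    refine PB.lim hS.hE fun ε hε => ?_
    obtain ⟨N, hN⟩ := app ε hε
    refine ⟨_, _, D2 (N + 1) n, fun t k1 k2 => ?_, fun t k1 k2 => ?_⟩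
    · exact ((hN (n + (N + 1)) (by omega)).1 t k1 k2).congr (by abel) le_rfl
    · exact ((hN (n + N) (by omega)).2 t k1 k2).congr (by rw [← add_assoc]; abel) le_rfl
  obtain ⟨W, hW⟩ := dec_exist Sg hS hM hX hq hqT Py yc y0
  have eq : ∀ t, 0 ≤ t → t ≤ q → y t = W t := by
    intro t k1 k2
    refine sub_eq_zero.1 (Bd.eq_zero (θ := γ) fun ε hε => ?_)
    obtain ⟨N, hN⟩ := small (ε/2) (by linarith)
    have c1 := Hc T X X2 0 q _ _ _ _ _ _ _ hX le_rfl hq hqT hq2 Py (hY N) (Dy N) (hW.mild Sg) ((hYd N).mild Sg)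
        ((hW.init Sg hq).trans ((hYd N).init Sg hq).symm)
    have h3 := hN N le_rfl
    have h4 := hN (N + 1) (by omega)
    refine ((hy t k1 k2 (N + 1)).sub (c1.a0 t k1 k2)).congr (by abel) (by linarith)
  refine ⟨y, Py, yc, ?_⟩
  obtain ⟨e, v, C', a1, a2, a3, a4, a5⟩ := hW
  exact ⟨e, v, C', a1, a2, a3, a4, fun t k1 k2 => (eq t k1 k2).trans (a5 t k1 k2)⟩

end

section
variable {𝓑 : BanachScale} {α σ γ δ CX C : ℝ} {F G : 𝓑.E → 𝓑.E} {DG : 𝓑.E → 𝓑.E →ₗ[ℝ] 𝓑.E}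
variable (Sg : ScaleSemigroup 𝓑)

lemma con_bdd {θ p q : ℝ} {f : ℝ → 𝓑.E} (hf : COn θ p q f) (hpq : p ≤ q) :
    ∃ M, ∀ t, p ≤ t → t ≤ q → Bd θ (f t) M := by
  obtain ⟨M, hM⟩ := isCompact_Icc.exists_bound_of_continuousOn (text_cont hf hpq).continuousOn (s := Icc p q)
  refine ⟨M, fun t k1 k2 => ⟨hf.1 t k1 k2, ?_⟩⟩
  have := hM t ⟨k1, k2⟩
  rwa [BanachScale.norm_def, text_val hf hpq k1 k2] at this

lemma bd_holder {θ η q A : ℝ} (hη : 0 < η) {R : ℝ → ℝ → 𝓑.E} (h0 : ∀ s, R s s = 0)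
    (h : ∀ s t, 0 ≤ s → s < t → t ≤ q → Bd θ (R s t) (A * (t - s) ^ η)) :
    ∃ C : ℝ, ∀ s t : ℝ, 0 ≤ s → s ≤ t → t ≤ q → 𝓑.N θ (R s t) ≤ C * (t - s) ^ η := by
  refine ⟨A, fun s t k1 k2 k3 => ?_⟩
  rcases k2.eq_or_lt with rfl | k2
  · rw [h0, 𝓑.N_zero, sub_self, Real.zero_rpow hη.ne', mul_zero]
  · exact (h s t k1 k2 k3).2

lemma sol_of (hS : Setup 𝓑 α σ γ δ CX C F G DG) {M : ℝ} (hM : 1 ≤ M) {T : ℝ} {X : ℝ → ℝ} {X2 : ℝ → ℝ → ℝ} {q : ℝ}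
    {y : ℝ → 𝓑.E} {y0 : 𝓑.E} (hX : RB α CX T X X2) (hq : 0 ≤ q) (hqT : q ≤ T)
    (hy : PB 𝓑 α γ X 0 q y (fun t => G (y t)) M M M M M) (hc : COn γ 0 q y)
    (hD : Dec Sg α σ γ δ X X2 q (fun t => G (y t)) (fun t => DG (y t) (G (y t))) (fun t => F (y t)) y0 y) :
    IsSolution 𝓑 Sg α γ X X2 F G DG y0 q y := by
  have hT := hX.Tle
  have hα := hS.hα
  have cG := con_G hS hc
  refine ⟨⟨hc.1, cG.1, hc.2, cG.2, ?_, ?_, ?_⟩, hD.init Sg hq, fun t k1 k2 => ?_⟩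
  · exact bd_holder (R := fun s t => G (y t) - G (y s)) (by linarith) (fun s => sub_self _) hy.c0
  · exact bd_holder (R := gubRemainder 𝓑 X y (fun t => G (y t))) (by linarith) (fun s => by simp [gubRemainder]) hy.e0
  · exact bd_holder (R := gubRemainder 𝓑 X y (fun t => G (y t))) (by linarith) (fun s => by simp [gubRemainder]) hy.f0
  · obtain ⟨e, v, C', he0, hv0, he, hv, hyt⟩ := hD
    obtain ⟨K, hK, H⟩ := comp_single hS hM
    obtain ⟨hI, -⟩ := H T X X2 0 q M y _ hX le_rfl hq hqT le_rfl hy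
    have cF := con_F hS.hF (by linarith) hc hy.a0
    exact ⟨e t, v t, dr_riemann Sg hS.hδ hS.hδ' (by linarith) (ucs_of_con Sg cF hq) he he0 cF.1 k1 k2,
      rough_conv Sg hS.hα hS.hα' hS.hσ hS.hσα hS.hCX hX hqT hI hv0 hv k1 k2, hyt t k1.le k2⟩

lemma sol_to (hS : Setup 𝓑 α σ γ δ CX C F G DG) {T : ℝ} {X : ℝ → ℝ} {X2 : ℝ → ℝ → ℝ} {q : ℝ}
    {y : ℝ → 𝓑.E} {y0 : 𝓑.E} (hX : RB α CX T X X2) (hq : 0 ≤ q) (hqT : q ≤ T)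
    (h : IsSolution 𝓑 Sg α γ X X2 F G DG y0 q y) :
    ∃ M ≥ (1:ℝ), PB 𝓑 α γ X 0 q y (fun t => G (y t)) M M M M M ∧
      Mild Sg α σ γ δ X X2 0 q (fun t => G (y t)) (fun t => DG (y t) (G (y t))) (fun t => F (y t)) y := by
  have hT := hX.Tle
  have hα := hS.hα
  have hσα := hS.hσα
  have hc : COn γ 0 q y := ⟨h.controlled.mem_y, h.controlled.cont_y⟩
  have cG := con_G hS hc
  obtain ⟨M1, h1⟩ := con_bdd hc hq
  obtain ⟨M2, h2⟩ := con_bdd cG hq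
  obtain ⟨M3, h3⟩ := h.controlled.holder_y'
  obtain ⟨M4, h4⟩ := h.controlled.rem_alpha
  obtain ⟨M5, h5⟩ := h.controlled.rem_two_alpha
  have y1 : ∀ t, 0 ≤ t → t ≤ q → 𝓑.Mem (γ - α) (y t) := fun t k1 k2 => 𝓑.mem_mono (by linarith) _ (hc.1 t k1 k2)
  have y2 : ∀ t, 0 ≤ t → t ≤ q → 𝓑.Mem (γ - 2 * α) (y t) := fun t k1 k2 => 𝓑.mem_mono (by linarith) _ (hc.1 t k1 k2)
  have g2 : ∀ t, 0 ≤ t → t ≤ q → 𝓑.Mem (γ - 2 * α) (G (y t)) := fun t k1 k2 => 𝓑.mem_mono (by linarith) _ (cG.1 t k1 k2)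
  set M := 1 + |M1| + |M2| + |M3| + |M4| + |M5| with hMd
  have p1 := abs_nonneg M1
  have p2 := abs_nonneg M2
  have p3 := abs_nonneg M3
  have p4 := abs_nonneg M4
  have p5 := abs_nonneg M5
  have hM : 1 ≤ M := by linarith
  have hPB : PB 𝓑 α γ X 0 q y (fun t => G (y t)) M M M M M := by
    refine ⟨fun t k1 k2 => (h1 t k1 k2).mono (by linarith [le_abs_self M1]),
      fun t k1 k2 => (h2 t k1 k2).mono (by linarith [le_abs_self M2]),
      fun s t k1 k2 k3 => ⟨?_, (h3 s t k1 k2.le k3).trans ?_⟩, fun s t k1 k2 k3 => ⟨?_, (h4 s t k1 k2.le k3).trans ?_⟩,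
      fun s t k1 k2 k3 => ⟨?_, (h5 s t k1 k2.le k3).trans ?_⟩⟩
    · exact (𝓑.sub (γ - 2 * α)).sub_mem (g2 t (by linarith) k3) (g2 s k1 (by linarith))
    · exact mul_le_mul_of_nonneg_right (by linarith [le_abs_self M3]) (Real.rpow_nonneg (by linarith) _)
    · exact (𝓑.sub (γ - α)).sub_mem ((𝓑.sub (γ - α)).sub_mem (y1 t (by linarith) k3) (y1 s k1 (by linarith)))
        (𝓑.mem_smul _ _ _ (cG.1 s k1 (by linarith)))
    · exact mul_le_mul_of_nonneg_right (by linarith [le_abs_self M4]) (Real.rpow_nonneg (by linarith) _)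
    · exact (𝓑.sub (γ - 2 * α)).sub_mem ((𝓑.sub (γ - 2 * α)).sub_mem (y2 t (by linarith) k3) (y2 s k1 (by linarith)))
        (𝓑.mem_smul _ _ _ (g2 s k1 (by linarith)))
    · exact mul_le_mul_of_nonneg_right (by linarith [le_abs_self M5]) (Real.rpow_nonneg (by linarith) _)
  refine ⟨M, hM, hPB, ?_⟩
  obtain ⟨W, e, v, C', he0, hv0, he, hv, hW⟩ := dec_exist Sg hS hM hX hq hqT hPB hc y0
  obtain ⟨K, hK, H⟩ := comp_single hS hM
  obtain ⟨hI, -⟩ := H T X X2 0 q M y _ hX le_rfl hq hqT le_rfl hPB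
  have cF := con_F hS.hF (by linarith) hc hPB.a0
  refine Dec.mild Sg (y0 := y0) ⟨e, v, C', he0, hv0, he, hv, fun t k1 k2 => ?_⟩
  rcases k1.eq_or_lt with rfl | k1
  · rw [he0, hv0, h.init, Sg.S_id]; simp
  obtain ⟨D, Z, i1, i2, i3⟩ := h.mild t k1 k2
  have j1 := dr_riemann Sg hS.hδ hS.hδ' (by linarith) (ucs_of_con Sg cF hq) he he0 cF.1 k1 k2
  have j2 := rough_conv Sg hS.hα hS.hα' hS.hσ hS.hσα hS.hCX hX hqT hI hv0 hv k1 k2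
  have r1 : D = e t := by
    refine rint_unique k1 (fun π => ?_) i1 j1
    refine (𝓑.sub γ).sum_mem fun i hi => (𝓑.sub γ).smul_mem _ ?_
    rw [Finset.mem_range] at hi
    have a1 := π.ge (i := i) hi.le
    have a2 := π.strict i hi
    have a3 := π.le (i := i + 1) hi
    obtain ⟨_, _, hs⟩ := Sg.S_smoothing (γ - δ) δ 1 hS.hδ hS.hδ'.le one_pos
    have := (hs (t - π.t i) _ (by linarith) (by linarith) (cF.1 (π.t i) a1 (by linarith))).1
    rwa [sub_add_cancel] at this
  have r2 : Z = v t := by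
    refine rconv_unique Sg k1 (fun π => ?_) i2 j2
    refine (𝓑.sub (γ - 2 * α)).sum_mem fun i hi => ?_
    rw [Finset.mem_range] at hi
    have a1 := π.ge (i := i) hi.le
    have a3 := π.le (i := i) hi.le
    refine Sg.S_mem _ _ _ (by linarith) (𝓑.mem_add _ _ _ (𝓑.mem_smul _ _ _ (g2 _ a1 (by linarith))) (𝓑.mem_smul _ _ _ ?_))
    exact 𝓑.mem_mono (by linarith) _ (hI.g1 _ a1 (by linarith)).1
  rw [i3, r1, r2]

end

/-- **local existence, Theorem 5.1 of [GHN].** Under assumptions (F) and (G),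
for every `y₀ ∈ B_γ` with `|y₀|_{B_γ} ≤ ρ` there exists `T* ∈ (0,T]` and a unique solution
`(y, G(y)) ∈ D^{2α}_{X,γ}([0,T*])` of the mild formulation
`y_t = S(t)y₀ + ∫₀ᵗ S(t-s)F(y_s)ds + ∫₀ᵗ S(t-s)G(y_s)d𝐗_s`. -/
theorem statement5 (α T γ δ σ : ℝ) (hα : 1/3 < α) (hα' : α < 1/2) (hT : 0 < T)
    (hδ : 0 ≤ δ) (hδ' : δ < 1) (hσ : 0 ≤ σ) (hσα : σ < α)
    (𝓑 : BanachScale) (Sg : ScaleSemigroup 𝓑) (RP : RoughPath α T)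
    (F G : 𝓑.E → 𝓑.E) (DG : 𝓑.E → 𝓑.E →ₗ[ℝ] 𝓑.E)
    (D2G : 𝓑.E → 𝓑.E →ₗ[ℝ] 𝓑.E →ₗ[ℝ] 𝓑.E)
    (D3G : 𝓑.E → 𝓑.E →ₗ[ℝ] 𝓑.E →ₗ[ℝ] 𝓑.E →ₗ[ℝ] 𝓑.E)
    (hF : AssumptionF 𝓑 γ δ F) (hG : AssumptionG 𝓑 α σ γ G DG D2G D3G)
    (ρ : ℝ) (y₀ : 𝓑.E) (hy₀ : 𝓑.Mem γ y₀) (hρ : 𝓑.N γ y₀ ≤ ρ) :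
    ∃ Tstar : ℝ, 0 < Tstar ∧ Tstar ≤ T ∧ ∃ y : ℝ → 𝓑.E,
      IsSolution 𝓑 Sg α γ RP.X RP.X2 F G DG y₀ Tstar y ∧
      ∀ z : ℝ → 𝓑.E, IsSolution 𝓑 Sg α γ RP.X RP.X2 F G DG y₀ Tstar z →
        ∀ t : ℝ, 0 ≤ t → t ≤ Tstar → z t = y t := by
  obtain ⟨c0, H0⟩ := glev_of hG (show (0:ℝ) ∈ ({0, α, 2 * α} : Set ℝ) by simp)
  obtain ⟨c1, H1⟩ := glev_of hG (show α ∈ ({0, α, 2 * α} : Set ℝ) by simp)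
  obtain ⟨c2, H2⟩ := glev_of hG (show 2 * α ∈ ({0, α, 2 * α} : Set ℝ) by simp)
  obtain ⟨c3, H3⟩ := emb_ex (γ := γ) 𝓑 (show 0 < α by linarith) hσα
  obtain ⟨x1, hx1⟩ := RP.holderX
  obtain ⟨x2, hx2⟩ := RP.holderX2
  set C := max (max c0 c1) (max c2 c3) with hC
  set CX := max 1 (max x1 x2) with hCX
  have hG0 := H0 C ((le_max_left _ _).trans (le_max_left _ _))
  rw [sub_zero] at hG0
  have hS : Setup 𝓑 α σ γ δ CX C F G DG :=
    ⟨hα, hα', hσ, hσα, hδ, hδ', le_max_left _ _, H3 C ((le_max_right _ _).trans (le_max_right _ _)), hG0,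
      H1 C ((le_max_right _ _).trans (le_max_left _ _)), H2 C ((le_max_left _ _).trans (le_max_right _ _)), hF⟩
  have hTT : min T 1 ≤ T := min_le_left _ _
  have hX : RB α CX (min T 1) RP.X RP.X2 := by
    refine ⟨le_max_left _ _, min_le_right _ _, fun s t k1 k2 k3 => ?_, fun s t k1 k2 k3 => ?_, fun s u t k1 k2 k3 k4 => ?_⟩
    · exact (hx1 s t k1 k2 (k3.trans hTT)).trans (mul_le_mul_of_nonneg_right
        ((le_max_left _ _).trans (le_max_right _ _)) (Real.rpow_nonneg (by linarith) _))
    · exact (hx2 s t k1 k2 (k3.trans hTT)).trans (mul_le_mul_of_nonneg_right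
        ((le_max_right _ _).trans (le_max_right _ _)) (Real.rpow_nonneg (by linarith) _))
    · exact RP.chen s u t k1 k2 k3 (k4.trans hTT)
  obtain ⟨h, hh, H⟩ := exist_loc Sg hS (show Bd γ y₀ ρ from ⟨hy₀, hρ⟩)
  have hpos : 0 < min h (min T 1) := lt_min hh (lt_min hT one_pos)
  have hq1 : min h (min T 1) ≤ min T 1 := min_le_right _ _
  obtain ⟨M, hM, y, hy, hyc, hyd⟩ := H (min T 1) RP.X RP.X2 (min h (min T 1)) hX hpos.le hq1 (min_le_left _ _)
  refine ⟨min h (min T 1), hpos, hq1.trans hTT, y, sol_of Sg hS hM hX hpos.le hq1 hy hyc hyd, fun z hz => ?_⟩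
  obtain ⟨M', hM', hzP, hzM⟩ := sol_to Sg hS hX hpos.le hq1 hz
  have e1 : M ≤ max M M' := le_max_left _ _
  have e2 : M' ≤ max M M' := le_max_right _ _
  exact uniq Sg hS (hM.trans e1) hX hq1 (hzP.mono e2 e2 e2 e2 e2) (hy.mono e1 e1 e1 e1 e1) hzM (hyd.mild Sg)
    (hz.init.trans (hyd.init Sg hpos.le).symm)
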